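/- arXiv:2006.05151 — 11 statements merged into one kernel-verified Lean document; each statement's English description precedes it below -/
import Mathlib

section
/- Let H be a quaternion skew field with centre F. For quaternions q₁, q₂ ∈ H there exists an inner automorphism of H taking q₁ to q₂ (i.e. there is h ∈ H∖{0} with q₂ = h⁻¹·q₁·h) if, and only if, tr(q₁) = tr(q₂) and N(q₁) = N(q₂). -/
/-- Let `H` be a quaternion skew field with centre `F`
(a division ring that is an `F`-algebra of dimension `4` whose centre is `F·1`),
equipped with its standard involution `star`, trace `tr h` (with `tr h = h + star h`
in `F·1`) and norm `Nm h` (with `Nm h = h * star h` in `F·1`).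
For quaternions `q₁, q₂ ∈ H` there exists an inner automorphism of `H` taking
`q₁` to `q₂` if, and only if, `tr q₁ = tr q₂` and `Nm q₁ = Nm q₂`. -/
theorem stmt_0 {F H : Type*} [Field F] [DivisionRing H] [Algebra F H] [StarRing H]
    (hrank : Module.finrank F H = 4)
    (hcenter : ∀ z : H, z ∈ Subring.center H ↔ ∃ a : F, z = algebraMap F H a)
    (hstarF : ∀ a : F, star (algebraMap F H a) = algebraMap F H a)
    (tr Nm : H → F)
    (htr : ∀ h : H, algebraMap F H (tr h) = h + star h)
    (hNm : ∀ h : H, algebraMap F H (Nm h) = h * star h)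
    (q₁ q₂ : H) :
    (∃ h : H, h ≠ 0 ∧ q₂ = h⁻¹ * q₁ * h) ↔ (tr q₁ = tr q₂ ∧ Nm q₁ = Nm q₂) := by
  have hs : ∀ h : H, star h = algebraMap F H (tr h) - h := fun h => by rw [htr]; abel
  have hsq : ∀ h : H, h * h = h * algebraMap F H (tr h) - algebraMap F H (Nm h) := fun h => by
    rw [htr, hNm]; noncomm_ring
  have hinj : Function.Injective (algebraMap F H) := (algebraMap F H).injective
  constructor
  · rintro ⟨h, h0, rfl⟩
    have hst : star h = h⁻¹ * algebraMap F H (Nm h) := by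
      rw [hNm, inv_mul_cancel_left₀ h0]
    have hs0 : star h ≠ 0 := by simpa using h0
    have hN0 : algebraMap F H (Nm h) ≠ 0 := by
      rw [hNm]; exact mul_ne_zero h0 hs0
    have hh : h * star h = star h * h := by
      rw [hs]
      rw [mul_sub, sub_mul, Algebra.commutes]
    have key : star (h⁻¹ * q₁ * h) = h⁻¹ * star q₁ * h := by
      have e1 : star h * star h⁻¹ = 1 := by
        rw [← star_mul, inv_mul_cancel₀ h0, star_one]
      have e2 : star h⁻¹ = (algebraMap F H (Nm h))⁻¹ * h := by
        apply mul_left_cancel₀ hs0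
        rw [e1, hst, mul_assoc, mul_inv_cancel_left₀ hN0, inv_mul_cancel₀ h0]
      rw [star_mul, star_mul, e2, hst]
      calc h⁻¹ * algebraMap F H (Nm h) * (star q₁ * ((algebraMap F H (Nm h))⁻¹ * h))
          = h⁻¹ * (algebraMap F H (Nm h) * star q₁) * ((algebraMap F H (Nm h))⁻¹ * h) := by
            simp only [mul_assoc]
        _ = h⁻¹ * (star q₁ * algebraMap F H (Nm h)) * ((algebraMap F H (Nm h))⁻¹ * h) := by
            rw [Algebra.commutes]
        _ = h⁻¹ * star q₁ * h := by
            simp only [mul_assoc]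
            rw [mul_inv_cancel_left₀ hN0]
    have conj : ∀ a : F, h⁻¹ * algebraMap F H a * h = algebraMap F H a := fun a => by
      rw [mul_assoc, Algebra.commutes, inv_mul_cancel_left₀ h0]
    constructor
    · apply hinj
      rw [htr (h⁻¹ * q₁ * h), key, ← conj (tr q₁), htr]
      noncomm_ring
    · apply hinj
      rw [hNm (h⁻¹ * q₁ * h), key, ← conj (Nm q₁), hNm]
      simp only [mul_assoc]
      rw [mul_inv_cancel_left₀ h0]
  · rintro ⟨ht, hn⟩
    have key : ∀ x : H, q₁ * (q₁ * x - x * star q₂) = (q₁ * x - x * star q₂) * q₂ := fun x => by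
      have h1 := hsq q₁
      have h2 := hsq q₂
      rw [hs, ← ht]
      rw [← ht, ← hn] at h2
      have c1 := Algebra.commutes (tr q₁) x
      have c2 := Algebra.commutes (Nm q₁) x
      have c3 := Algebra.commutes (tr q₁) q₂
      generalize algebraMap F H (tr q₁) = T at *
      generalize algebraMap F H (Nm q₁) = N at *
      calc q₁ * (q₁ * x - x * (T - q₂))
          = (q₁ * q₁) * x - q₁ * (x * T) + q₁ * x * q₂ := by noncomm_ring
        _ = q₁ * x * q₂ - x * N := by rw [h1, ← c1, ← c2]; noncomm_ring
        _ = q₁ * x * q₂ - x * (T * q₂) + x * (q₂ * q₂) := by rw [h2, c3]; noncomm_ring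
        _ = _ := by noncomm_ring
    by_cases hx : ∃ x : H, q₁ * x - x * star q₂ ≠ 0
    · obtain ⟨x, hx⟩ := hx
      refine ⟨_, hx, ?_⟩
      rw [mul_assoc, key, inv_mul_cancel_left₀ hx]
    · push Not at hx
      have h1 : q₁ = star q₂ := by simpa [sub_eq_zero] using hx 1
      have hc : q₁ ∈ Subring.center H := by
        rw [Subring.mem_center_iff]
        intro g
        have := hx g
        rw [← h1, sub_eq_zero] at this
        exact this.symm
      obtain ⟨a, ha⟩ := (hcenter q₁).1 hc
      refine ⟨1, one_ne_zero, ?_⟩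
      have h2 : star q₁ = q₂ := by rw [h1, star_star]
      rw [← h2, ha, hstarF]
      simp
end

section
/- Let H be a quaternion skew field with centre F and let q ∈ H∖{0} satisfy tr(q) ≠ 0. Define the quadratic form ω_q : H → F by ω_q(x) = tr(q)²·N(x) − N(q)·tr(x)². Then for every p ∈ H∖{0}: ω_q(p) = 0 if and only if there exist c ∈ F∖{0} and h ∈ H∖{0} with p = c·(h⁻¹·q·h). (Equivalently: the orbit of the projective point F·q under the group of inner automorphisms of H is exactly the set of points F·p with ω_q(p) = 0.) -/
lemma conj_aux {H : Type*} [DivisionRing H] [StarRing H] (x y T N : H)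
    (hT : ∀ z, T * z = z * T) (hN : ∀ z, N * z = z * N)
    (hx : x + star x = T) (hy : y + star y = T) (hxN : x * star x = N) (hyN : y * star y = N)
    (hc : (∀ z, x * z = z * x) → star x = x) : ∃ h : H, h ≠ 0 ∧ x * h = h * y := by
  have ex : star x = T - x := eq_sub_of_add_eq' hx
  have ey : star y = T - y := eq_sub_of_add_eq' hy
  have key : ∀ z, x * (x * z - z * star y) = (x * z - z * star y) * y := by
    intro z
    have e1 : x * x = x * T - N := by rw [← hxN, ex]; noncomm_ring
    have e2 : y * y = T * y - N := by rw [← hyN, ey, hT y]; noncomm_ring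
    have e3 : x * (x * z - z * star y) = (x * x) * z - x * (z * T) + x * z * y := by
      rw [ey]; noncomm_ring
    have e4 : (x * z - z * star y) * y = x * z * y - z * (T * y) + z * (y * y) := by
      rw [ey]; noncomm_ring
    rw [e3, e4, e1, e2, ← hT z, sub_mul, hN z]
    noncomm_ring
  by_cases hz : ∃ z, x * z - z * star y ≠ 0
  · obtain ⟨z, hz⟩ := hz
    exact ⟨_, hz, key z⟩
  · push Not at hz
    have h1 : x = star y := by simpa [sub_eq_zero] using hz 1
    have h2 : star x = x := hc fun z => by
      have := sub_eq_zero.1 (hz z)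
      rwa [← h1] at this
    refine ⟨1, one_ne_zero, ?_⟩
    have : star x = y := by rw [h1, star_star]
    rw [mul_one, one_mul, ← this, h2]

/-- Let `H` be a quaternion skew field with centre `F`, and let
`q ∈ H∖{0}` with `tr q ≠ 0`.  With `ω_q x = (tr q)^2 * Nm x - Nm q * (tr x)^2`,
for every `p ∈ H∖{0}` one has `ω_q p = 0` iff there are `c ∈ F∖{0}` and
`h ∈ H∖{0}` with `p = c • (h⁻¹ * q * h)`; i.e. the orbit of the projective
point `F·q` under the group of inner automorphisms of `H` is exactly the quadric
`ω_q = 0`. -/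
theorem stmt_1 {F H : Type*} [Field F] [DivisionRing H] [Algebra F H] [StarRing H]
    (hrank : Module.finrank F H = 4)
    (hcenter : ∀ z : H, z ∈ Subring.center H ↔ ∃ a : F, z = algebraMap F H a)
    (hstarF : ∀ a : F, star (algebraMap F H a) = algebraMap F H a)
    (tr Nm : H → F)
    (htr : ∀ h : H, algebraMap F H (tr h) = h + star h)
    (hNm : ∀ h : H, algebraMap F H (Nm h) = h * star h)
    (q : H) (hq : q ≠ 0) (htrq : tr q ≠ 0) :
    ∀ p : H, p ≠ 0 →
      ((tr q) ^ 2 * Nm p - Nm q * (tr p) ^ 2 = 0 ↔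
        ∃ c : F, c ≠ 0 ∧ ∃ h : H, h ≠ 0 ∧ p = algebraMap F H c * (h⁻¹ * q * h)) := by
  intro p hp
  have inj : Function.Injective (algebraMap F H) := (algebraMap F H).injective
  have cm : ∀ (a : F) (z : H), algebraMap F H a * z = z * algebraMap F H a := Algebra.commutes
  constructor
  · intro h0
    have hNp : Nm p ≠ 0 := by
      intro h
      have := hNm p
      rw [h, map_zero] at this
      rcases mul_eq_zero.1 this.symm with h | h
      · exact hp h
      · exact hp (star_eq_zero.1 h)
    have htp : tr p ≠ 0 := by
      intro h
      rw [h] at h0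
      simp [hNp, htrq] at h0
    set c : F := tr p / tr q with hcdef
    have hc : c ≠ 0 := div_ne_zero htp htrq
    have e1 : c * tr q = tr p := by rw [hcdef]; field_simp
    have e2 : c * c * Nm q = Nm p := by
      rw [hcdef]; field_simp; linear_combination -h0
    have sx : star (algebraMap F H c * q) = algebraMap F H c * star q := by
      rw [star_mul, hstarF, cm]
    obtain ⟨h, hh, e⟩ := conj_aux (algebraMap F H c * q) p (algebraMap F H (tr p))
      (algebraMap F H (Nm p)) (cm _) (cm _)
      (by rw [sx, ← mul_add, ← htr, ← map_mul, e1]) (htr p).symm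
      (by rw [sx, ← e2, map_mul, map_mul, hNm, mul_assoc, ← mul_assoc q, ← cm c q]
          simp only [mul_assoc]) (hNm p).symm
      (fun hz => by
        obtain ⟨a, ha⟩ := (hcenter (algebraMap F H c * q)).1
          (Subring.mem_center_iff.2 fun z => (hz z).symm)
        rw [ha, hstarF])
    refine ⟨c, hc, h, hh, ?_⟩
    have : p = h⁻¹ * (algebraMap F H c * q * h) := by
      rw [e, inv_mul_cancel_left₀ hh]
    rw [this, mul_assoc, ← mul_assoc h⁻¹, ← cm c h⁻¹]
    simp only [mul_assoc]
  · rintro ⟨c, hc, h, hh, e⟩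
    have sh : star h = algebraMap F H (Nm h) * h⁻¹ := by
      rw [cm, hNm, inv_mul_cancel_left₀ hh]
    have hsh : star h ≠ 0 := star_ne_zero.2 hh
    have hn : algebraMap F H (Nm h) ≠ 0 := by rw [hNm]; exact mul_ne_zero hh hsh
    have shi : star h⁻¹ = h * (algebraMap F H (Nm h))⁻¹ := by
      rw [star_inv₀, sh, mul_inv_rev, inv_inv]
    have sp : star p = algebraMap F H c * (h⁻¹ * star q * h) := by
      rw [e, star_mul, star_mul, star_mul, hstarF, ← cm, shi, sh]
      congr 1
      rw [cm, mul_assoc, ← map_inv₀, ← cm _ h, ← mul_assoc (star q), ← cm _ (star q)]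
      rw [map_inv₀]
      simp only [mul_assoc]
      rw [mul_inv_cancel_left₀ hn]
    have e1 : tr p = c * tr q := by
      apply inj
      rw [htr, sp, map_mul]
      conv_lhs => rw [e]
      rw [← mul_add, ← add_mul, ← mul_add, ← htr, ← cm, mul_assoc, inv_mul_cancel₀ hh, mul_one]
    have e2 : Nm p = c * c * Nm q := by
      apply inj
      rw [hNm, sp, map_mul, map_mul]
      conv_lhs => rw [e]
      have : h⁻¹ * q * h * (h⁻¹ * star q * h) = algebraMap F H (Nm q) := by
        calc _ = h⁻¹ * (q * star q) * h := by
              simp only [mul_assoc]; rw [mul_inv_cancel_left₀ hh]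
          _ = _ := by rw [← hNm, ← cm, mul_assoc, inv_mul_cancel₀ hh, mul_one]
      rw [← this, cm c (h⁻¹ * star q * h)]
      rw [← mul_assoc, mul_assoc (algebraMap F H c) (h⁻¹ * q * h), ← cm, mul_assoc]
      simp only [mul_assoc]
    rw [e1, e2]; ring
end

section
/- Let H be a quaternion skew field with centre F and let q = f·1 with f ∈ F∖{0} and tr(q) = 2f ≠ 0. With ω_q(x) = tr(q)²·N(x) − N(q)·tr(x)², for every p ∈ H∖{0} one has ω_q(p) = 0 if and only if p ∈ F·1; that is, the quadric ω_q = 0 consists of the single projective point F·1. -/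
/-- Let `H` be a quaternion skew field with centre `F` and let
`q = f·1` with `f ∈ F∖{0}` and `tr q = 2·f ≠ 0`.  With
`ω_q x = (tr q)^2 * Nm x - Nm q * (tr x)^2`, for every `p ∈ H∖{0}` one has
`ω_q p = 0` iff `p ∈ F·1`; that is, the quadric `ω_q = 0` consists of the single
projective point `F·1`. -/
theorem stmt_2 {F H : Type*} [Field F] [DivisionRing H] [Algebra F H] [StarRing H]
    (hrank : Module.finrank F H = 4)
    (hcenter : ∀ z : H, z ∈ Subring.center H ↔ ∃ a : F, z = algebraMap F H a)
    (hstarF : ∀ a : F, star (algebraMap F H a) = algebraMap F H a)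
    (tr Nm : H → F)
    (htr : ∀ h : H, algebraMap F H (tr h) = h + star h)
    (hNm : ∀ h : H, algebraMap F H (Nm h) = h * star h)
    (f : F) (hf : f ≠ 0)
    (htrf : tr (algebraMap F H f) = 2 * f) (h2f : 2 * f ≠ 0) :
    ∀ p : H, p ≠ 0 →
      ((tr (algebraMap F H f)) ^ 2 * Nm p - Nm (algebraMap F H f) * (tr p) ^ 2 = 0 ↔
        ∃ a : F, p = algebraMap F H a) := by
  have inj := (algebraMap F H).injective
  have h2 : (2 : F) ≠ 0 := left_ne_zero_of_mul h2f
  have hNf : Nm (algebraMap F H f) = f ^ 2 := by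
    apply inj
    rw [hNm, hstarF, map_pow, sq]
  intro p _
  rw [htrf, hNf]
  have key : algebraMap F H (4 * Nm p - tr p ^ 2) =
      -(2 * p - algebraMap F H (tr p)) ^ 2 := by
    have hs : star p = algebraMap F H (tr p) - p := by rw [htr]; abel
    have hc : algebraMap F H (tr p) * p = p * algebraMap F H (tr p) :=
      Algebra.commutes _ _
    rw [map_sub, map_mul, map_pow, hNm, hs, map_ofNat]
    generalize algebraMap F H (tr p) = T at hc
    have e : -(2 * p - T) ^ 2 = 2 * (p * T) + 2 * (T * p) - 4 * (p * p) - T ^ 2 := by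
      noncomm_ring
    rw [e, hc]
    noncomm_ring
  have hfac : (2 * f) ^ 2 * Nm p - f ^ 2 * tr p ^ 2 = f ^ 2 * (4 * Nm p - tr p ^ 2) := by
    ring
  rw [hfac]
  constructor
  · intro h
    have h0 : 4 * Nm p - tr p ^ 2 = 0 :=
      (mul_eq_zero.mp h).resolve_left (pow_ne_zero 2 hf)
    rw [h0, map_zero, eq_comm, neg_eq_zero] at key
    have h1 : 2 * p = algebraMap F H (tr p) := sub_eq_zero.mp (pow_eq_zero_iff two_ne_zero |>.mp key)
    refine ⟨2⁻¹ * tr p, ?_⟩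
    rw [map_mul, ← h1, ← mul_assoc, ← map_ofNat (algebraMap F H) 2, ← map_mul,
      inv_mul_cancel₀ h2, map_one, one_mul]
  · rintro ⟨a, rfl⟩
    have h0 : 4 * Nm (algebraMap F H a) - tr (algebraMap F H a) ^ 2 = 0 := by
      apply inj
      rw [key, htr, hstarF, two_mul, sub_self, map_zero]
      simp
    rw [h0, mul_zero]
end

section
/- Let H be a quaternion skew field with centre F and let q ∈ H∖(F·1) satisfy tr(q) ≠ 0. Then the polar form of the quadratic form ω_q(x) = tr(q)²·N(x) − N(q)·tr(x)², namely the symmetric bilinear form B(x,y) = tr(q)²·tr(x·ȳ) − 2·N(q)·tr(x)·tr(y) on the F-vector space H, is non-degenerate: if x ∈ H satisfies B(x,y) = 0 for all y ∈ H, then x = 0. -/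
/-- Let `H` be a quaternion skew field with centre `F` and let
`q ∈ H∖(F·1)` with `tr q ≠ 0`.  Then the polar form of the quadratic form
`ω_q x = (tr q)^2 * Nm x - Nm q * (tr x)^2`, namely the symmetric bilinear form
`B x y = (tr q)^2 * tr (x * star y) - 2 * Nm q * tr x * tr y` on the `F`-vector
space `H`, is non-degenerate: if `B x y = 0` for all `y`, then `x = 0`. -/
theorem stmt_4 {F H : Type*} [Field F] [DivisionRing H] [Algebra F H] [StarRing H]
    (hrank : Module.finrank F H = 4)
    (hcenter : ∀ z : H, z ∈ Subring.center H ↔ ∃ a : F, z = algebraMap F H a)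
    (hstarF : ∀ a : F, star (algebraMap F H a) = algebraMap F H a)
    (tr Nm : H → F)
    (htr : ∀ h : H, algebraMap F H (tr h) = h + star h)
    (hNm : ∀ h : H, algebraMap F H (Nm h) = h * star h)
    (q : H) (hqF : ∀ a : F, q ≠ algebraMap F H a) (htrq : tr q ≠ 0) :
    ∀ x : H,
      (∀ y : H, (tr q) ^ 2 * tr (x * star y) - 2 * Nm q * tr x * tr y = 0) →
      x = 0 := by
  intro x hx
  have inj : Function.Injective (algebraMap F H) := (algebraMap F H).injective
  have trsub : ∀ a b : H, tr (a - b) = tr a - tr b := by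
    intro a b
    apply inj
    rw [map_sub, htr, htr, htr, star_sub]
    abel
  have trsmul : ∀ (c : F) (a : H), tr (c • a) = c * tr a := by
    intro c a
    apply inj
    rw [map_mul, htr, htr, Algebra.smul_def, star_mul, hstarF, mul_add,
      Algebra.commutes c (star a)]
  have trstar : ∀ a : H, tr (star a) = tr a := by
    intro a
    apply inj
    rw [htr, htr, star_star, add_comm]
  have hz : (tr q) ^ 2 • x - (2 * Nm q * tr x) • (1 : H) = 0 := by
    by_contra hne
    apply htrq
    have key : ∀ y : H,
        tr (((tr q) ^ 2 • x - (2 * Nm q * tr x) • (1 : H)) * star y) = 0 := by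
      intro y
      rw [sub_mul, smul_mul_assoc, smul_mul_assoc, one_mul, trsub, trsmul, trsmul, trstar]
      exact hx y
    have h := key (star ((((tr q) ^ 2 • x - (2 * Nm q * tr x) • (1 : H)))⁻¹ * q))
    rwa [star_star, mul_inv_cancel_left₀ hne] at h
  have ht2 : (tr q) ^ 2 ≠ 0 := pow_ne_zero 2 htrq
  obtain ⟨a, ha⟩ : ∃ a : F, x = algebraMap F H a := by
    refine ⟨((tr q) ^ 2)⁻¹ * (2 * Nm q * tr x), ?_⟩
    rw [Algebra.algebraMap_eq_smul_one, mul_smul, ← sub_eq_zero.mp hz, smul_smul,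
      inv_mul_cancel₀ ht2, one_smul]
  have htx : tr x = 2 * a := by
    apply inj
    rw [htr, ha, hstarF, two_mul, map_add]
  have hza : (tr q) ^ 2 * a = 2 * Nm q * (2 * a) := by
    apply inj
    rw [← htx, map_mul, ← ha, ← Algebra.smul_def, sub_eq_zero.mp hz,
      Algebra.algebraMap_eq_smul_one]
  by_cases ha0 : a = 0
  · rw [ha, ha0, map_zero]
  exfalso
  have h4 : (tr q) ^ 2 = 4 * Nm q := by
    apply mul_right_cancel₀ ha0
    rw [hza]
    ring
  have hsq : (q - star q) * (q - star q) = 0 := by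
    have hs : star q = algebraMap F H (tr q) - q := by rw [htr]; abel
    have hc : algebraMap F H (tr q) * q = q * algebraMap F H (tr q) :=
      Algebra.commutes _ _
    have h5 := congrArg (algebraMap F H) h4
    have h6 := hNm q
    rw [map_pow, map_mul, h6, hs, map_ofNat] at h5
    rw [hs]
    have e : (q - (algebraMap F H (tr q) - q)) * (q - (algebraMap F H (tr q) - q))
        = algebraMap F H (tr q) ^ 2 - 4 * (q * (algebraMap F H (tr q) - q))
          - 2 * (algebraMap F H (tr q) * q - q * algebraMap F H (tr q)) := by
      noncomm_ring
    rw [e, hc, ← h5]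
    simp
  have hqs : q = star q := sub_eq_zero.mp (mul_self_eq_zero.mp hsq)
  have h2q : algebraMap F H (tr q) = algebraMap F H 2 * q := by
    rw [htr, ← hqs, map_ofNat, two_mul]
  by_cases h2 : (2 : F) = 0
  · apply htrq
    apply inj
    rw [h2q, h2, map_zero, zero_mul]
  · apply hqF (2⁻¹ * tr q)
    rw [map_mul, h2q, ← mul_assoc, ← map_mul, inv_mul_cancel₀ h2, map_one, one_mul]
end

section
/- Let H be a quaternion skew field with centre F and let q ∈ H∖(F·1) satisfy tr(q) ≠ 0. If p ∈ H∖{0} satisfies ω_q(p) = 0, where ω_q(x) = tr(q)²·N(x) − N(q)·tr(x)², then also ω_q(p̄) = 0, tr(p) ≠ 0, and p̄ ∉ F·p. Since p̄ = tr(p)·1 − p lies in the F-span of {1, p}, the line spanned by 1 and p meets the quadric ω_q = 0 in the two distinct points F·p and F·p̄; in particular no line through the point F·1 is tangent to this quadric. -/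
/-- Let `H` be a quaternion skew field with centre `F` and let
`q ∈ H∖(F·1)` with `tr q ≠ 0`.  If `p ∈ H∖{0}` satisfies `ω_q p = 0`, where
`ω_q x = (tr q)^2 * Nm x - Nm q * (tr x)^2`, then also `ω_q (star p) = 0`,
`tr p ≠ 0`, `star p` lies in the `F`-span of `{1, p}` (indeed
`star p = tr p · 1 - p`), and `star p ∉ F·p`; hence the line spanned by `1` and
`p` meets the quadric `ω_q = 0` in the two distinct points `F·p` and
`F·(star p)`, and no line through `F·1` is tangent to this quadric. -/
theorem stmt_5 {F H : Type*} [Field F] [DivisionRing H] [Algebra F H] [StarRing H]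
    (hrank : Module.finrank F H = 4)
    (hcenter : ∀ z : H, z ∈ Subring.center H ↔ ∃ a : F, z = algebraMap F H a)
    (hstarF : ∀ a : F, star (algebraMap F H a) = algebraMap F H a)
    (tr Nm : H → F)
    (htr : ∀ h : H, algebraMap F H (tr h) = h + star h)
    (hNm : ∀ h : H, algebraMap F H (Nm h) = h * star h)
    (q : H) (hqF : ∀ a : F, q ≠ algebraMap F H a) (htrq : tr q ≠ 0)
    (p : H) (hp : p ≠ 0)
    (hωp : (tr q) ^ 2 * Nm p - Nm q * (tr p) ^ 2 = 0) :
    ((tr q) ^ 2 * Nm (star p) - Nm q * (tr (star p)) ^ 2 = 0) ∧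
    tr p ≠ 0 ∧
    star p ∈ Submodule.span F ({1, p} : Set H) ∧
    (∀ a : F, star p ≠ algebraMap F H a * p) := by
  have inj : Function.Injective (algebraMap F H) := (algebraMap F H).injective
  have hst : ∀ h : H, star h = algebraMap F H (tr h) - h := fun h => by
    rw [htr]; abel
  have htrp : tr p ≠ 0 := by
    intro h0
    rw [h0] at hωp
    have h1 : Nm p = 0 := by
      have h2 : (tr q) ^ 2 * Nm p = 0 := by linear_combination hωp
      exact (mul_eq_zero.mp h2).resolve_left (pow_ne_zero 2 htrq)
    have h3 := hNm p
    rw [h1, map_zero] at h3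
    rcases mul_eq_zero.mp h3.symm with h | h
    · exact hp h
    · exact hp (star_eq_zero.mp h)
  refine ⟨?_, htrp, ?_, ?_⟩
  · have h1 : tr (star p) = tr p := inj (by rw [htr, htr, star_star, add_comm])
    have h2 : Nm (star p) = Nm p := inj (by
      rw [hNm, hNm, star_star, hst p, sub_mul, mul_sub, Algebra.commutes])
    rw [h1, h2]; exact hωp
  · rw [hst p, Algebra.algebraMap_eq_smul_one]
    exact Submodule.sub_mem _
      (Submodule.smul_mem _ _ (Submodule.subset_span (by simp)))
      (Submodule.subset_span (by simp))
  · intro a ha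
    have h1 : algebraMap F H (tr p) = algebraMap F H (1 + a) * p := by
      rw [htr, ha, map_add, map_one, add_mul, one_mul]
    have ha1 : (1 + a) ≠ 0 := by
      intro h
      rw [h, map_zero, zero_mul] at h1
      exact htrp (inj (by rw [h1, map_zero]))
    obtain ⟨c, hc⟩ : ∃ c : F, p = algebraMap F H c := by
      refine ⟨(1 + a)⁻¹ * tr p, ?_⟩
      rw [map_mul, h1, ← mul_assoc, ← map_mul, inv_mul_cancel₀ ha1, map_one, one_mul]
    have hT : tr p = 2 * c := inj (by
      rw [htr, hc, hstarF, two_mul, map_add])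
    have hN : Nm p = c * c := inj (by
      rw [hNm, hc, hstarF, map_mul])
    have hc0 : c ≠ 0 := by
      rintro rfl
      exact hp (by rw [hc, map_zero])
    have h20 : (2 : F) ≠ 0 := by
      intro h
      exact htrp (by rw [hT, h, zero_mul])
    rw [hT, hN] at hωp
    have hD : (tr q) ^ 2 = 4 * Nm q := by
      apply mul_left_cancel₀ (pow_ne_zero 2 hc0)
      linear_combination hωp
    have hq : ((q - algebraMap F H (tr q / 2)) * (q - algebraMap F H (tr q / 2))) = 0 := by
      have hn := hNm q
      rw [hst q, mul_sub, ← Algebra.commutes] at hn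
      have e1 : Nm q = tr q / 2 * (tr q / 2) := by
        field_simp
        linear_combination -hD
      have e2 : tr q = tr q / 2 + tr q / 2 := by field_simp; ring
      rw [e1, map_mul] at hn
      have hn2 : q * q = algebraMap F H (tr q) * q
          - algebraMap F H (tr q / 2) * algebraMap F H (tr q / 2) := by
        rw [hn]; abel
      have e3 : algebraMap F H (tr q) = algebraMap F H (tr q / 2) + algebraMap F H (tr q / 2) := by
        rw [← map_add, ← e2]
      rw [sub_mul, mul_sub, mul_sub, hn2, ← Algebra.commutes (tr q / 2) q, e3, add_mul]
      abel
    have := mul_self_eq_zero.mp hq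
    exact hqF _ (sub_eq_zero.mp this)
end

section
/- Let H be a quaternion skew field with centre F and let L be a 2-dimensional F-subspace of H with 1 ∈ L that is not contained in (F1)^⊥ (i.e. some x ∈ L has tr(x) ≠ 0). Then for every h₀ ∈ H∖{0} and every 3-dimensional F-subspace E of H with h₀⁻¹·L·h₀ ⊆ E, the set of 2-dimensional subspaces { h⁻¹·L·h : h ∈ H∖{0} } ∩ { N : N ⊆ E } is infinite; in other words, every plane through an arbitrary line in the orbit of L under inner automorphisms of H contains infinitely many lines of this orbit. -/
theorem aux_norm {F H : Type*} [Field F] [DivisionRing H] [Algebra F H] [StarRing H]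
    (hcenter : ∀ z : H, z ∈ Subring.center H ↔ ∃ a : F, z = algebraMap F H a)
    (tr : H → F)
    (htr : ∀ h : H, algebraMap F H (tr h) = h + star h) (x : H) :
    ∃ n : F, x * star x = algebraMap F H n := by
  rw [← hcenter, Subring.mem_center_iff]
  intro y
  have hsx : star x = algebraMap F H (tr x) - x := by rw [htr]; abel
  have hsy : star y = algebraMap F H (tr y) - y := by rw [htr]; abel
  have cx : ∀ z, algebraMap F H (tr x) * z = z * algebraMap F H (tr x) :=
    fun z => Algebra.commutes _ _
  have cy : ∀ z, algebraMap F H (tr y) * z = z * algebraMap F H (tr y) :=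
    fun z => Algebra.commutes _ _
  have h1 : star x * y + star y * x = algebraMap F H (tr (star x * y)) := by
    rw [htr]; simp
  have h2 : y * star x + x * star y = algebraMap F H (tr (y * star x)) := by
    rw [htr]; simp
  have h3 : y * star x + x * star y = star x * y + star y * x := by
    rw [hsx, hsy]
    simp only [sub_mul, mul_sub, cx, cy]
    abel
  have hc : star x * x = x * star x := by
    rw [hsx]; simp only [sub_mul, mul_sub, cx]
  have c1 := Algebra.commutes (tr (star x * y)) x
  rw [← h1] at c1
  have e1 : y * (x * star x) = (y * star x + x * star y) * x - x * star y * x := by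
    rw [← hc]; noncomm_ring
  have e2 : x * star x * y = x * (star x * y + star y * x) - x * star y * x := by
    noncomm_ring
  rw [e1, e2, h3, c1]

theorem aux_infinite {F H : Type*} [Field F] [DivisionRing H] [Algebra F H]
    (hrank : Module.finrank F H = 4)
    (hcenter : ∀ z : H, z ∈ Subring.center H ↔ ∃ a : F, z = algebraMap F H a)
    (u : H) (hu : ∀ a : F, u ≠ algebraMap F H a) : Infinite F := by
  by_contra hF
  rw [not_infinite_iff_finite] at hF
  haveI : Module.Finite F H := Module.finite_of_finrank_pos (by omega)
  haveI : Finite H := Module.finite_of_finite F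
  letI := littleWedderburn H
  obtain ⟨a, ha⟩ := (hcenter u).1 (by
    rw [Subring.mem_center_iff]
    intro g
    exact (littleWedderburn H).mul_comm g u)
  exact hu a ha

theorem aux_core {F H : Type*} [Field F] [DivisionRing H] [Algebra F H] [StarRing H]
    (hrank : Module.finrank F H = 4)
    (hcenter : ∀ z : H, z ∈ Subring.center H ↔ ∃ a : F, z = algebraMap F H a)
    (hstarF : ∀ a : F, star (algebraMap F H a) = algebraMap F H a)
    (tr : H → F)
    (htr : ∀ h : H, algebraMap F H (tr h) = h + star h)
    (u : H) (hu : ∀ a : F, u ≠ algebraMap F H a) (hut : tr u ≠ 0)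
    (E : Submodule F H) (hE : Module.finrank F E = 3) (h1 : (1 : H) ∈ E) (huE : u ∈ E) :
    {v : H | v ∈ E ∧ ∃ h : H, h ≠ 0 ∧ v = h⁻¹ * u * h}.Infinite := by
  haveI := aux_infinite hrank hcenter u hu
  have hinj : Function.Injective (algebraMap F H) := (algebraMap F H).injective
  have starsmul : ∀ (a : F) (x : H), star (a • x) = a • star x := by
    intro a x
    rw [Algebra.smul_def, star_mul, hstarF, Algebra.smul_def, Algebra.commutes]
  have hA : ∀ a : F, algebraMap F H a = a • 1 := fun a => Algebra.algebraMap_eq_smul_one a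
  have hsu : star u = algebraMap F H (tr u) - u := by rw [htr]; abel
  -- p
  obtain ⟨w, hwE, hw⟩ : ∃ w ∈ E, w ∉ Submodule.span F {(1:H), u} := by
    by_contra hcon
    push Not at hcon
    haveI : Module.Finite F (Submodule.span F {(1:H), u}) :=
      Module.Finite.span_of_finite F (Set.toFinite _)
    have hle := Submodule.finrank_mono (show E ≤ Submodule.span F {(1:H), u} from hcon)
    classical
    have h2 := finrank_span_finset_le_card (R := F) ({1, u} : Finset H)
    have h3 : ({1, u} : Finset H).card ≤ 2 := Finset.card_le_two
    simp only [Finset.coe_insert, Finset.coe_singleton] at h2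
    rw [Set.finrank] at h2
    omega
  have huL : u ∈ Submodule.span F {(1:H), u} := Submodule.subset_span (by simp)
  have h1L : (1:H) ∈ Submodule.span F {(1:H), u} := Submodule.subset_span (by simp)
  generalize hLdef : Submodule.span F {(1:H), u} = L at *
  obtain ⟨p, hpE, hpL, hsp⟩ : ∃ p ∈ E, p ∉ L ∧ star p = -p := by
    refine ⟨w - (tr w / tr u) • u, E.sub_mem hwE (E.smul_mem _ huE), ?_, ?_⟩
    · intro h
      apply hw
      have := L.add_mem h (L.smul_mem (tr w / tr u) huL)
      simpa using this
    · have hsw : star w = algebraMap F H (tr w) - w := by rw [htr]; abel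
      rw [star_sub, starsmul, hsw, hsu, smul_sub, hA, hA, smul_smul, div_mul_cancel₀ _ hut]
      abel
  -- q
  obtain ⟨q, hq⟩ : ∃ q, q = u - star u := ⟨_, rfl⟩
  have hqL : q ∈ L := by
    rw [hq, hsu, hA]
    exact L.sub_mem huL (L.sub_mem (L.smul_mem _ h1L) huL)
  have hsuE : star u ∈ E := by
    rw [hsu, hA]
    exact E.sub_mem (E.smul_mem _ h1) huE
  have hqE : q ∈ E := by
    rw [hq]
    exact E.sub_mem huE hsuE
  have hsq : star q = -q := by rw [hq]; simp
  have hq0 : q ≠ 0 := by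
    intro h0
    have e : u = star u := sub_eq_zero.1 (hq ▸ h0)
    have h2u : algebraMap F H (tr u) = (2 : F) • u := by
      rw [htr, ← e, two_smul]
    by_cases h2 : (2 : F) = 0
    · rw [h2, zero_smul] at h2u
      exact hut (hinj (by simpa using h2u))
    · apply hu ((2:F)⁻¹ * tr u)
      rw [map_mul, h2u, ← Algebra.smul_def, smul_smul, inv_mul_cancel₀ h2, one_smul]
  have huc : u * star u = star u * u := by
    rw [hsu, sub_mul, mul_sub, Algebra.commutes]
  obtain ⟨a, ha⟩ : ∃ a, algebraMap F H a = p * u - star u * p :=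
    ⟨tr (p * u), by rw [htr, star_mul, hsp]; noncomm_ring⟩
  obtain ⟨b, hb⟩ : ∃ b, algebraMap F H b = q * u - star u * q :=
    ⟨tr (q * u), by rw [htr, star_mul, hsq]; noncomm_ring⟩
  have hb0 : b ≠ 0 := by
    rintro rfl
    rw [map_zero] at hb
    have : q * q = 0 := by
      rw [hb]
      have : q * u = u * q := by rw [hq, sub_mul, mul_sub, huc]
      rw [this, ← sub_mul, ← hq]
    exact hq0 (mul_self_eq_zero.1 this)
  have hh0 : ∀ c : F, p + c • q ≠ 0 := by
    intro c h
    apply hpL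
    rw [eq_neg_of_add_eq_zero_left h]
    exact L.neg_mem (L.smul_mem _ hqL)
  have hm : ∀ c : F, ∃ m : F, m ≠ 0 ∧ (p + c • q) * (p + c • q) = algebraMap F H m := by
    intro c
    obtain ⟨n, hn⟩ := aux_norm hcenter tr htr (p + c • q)
    have hs : star (p + c • q) = -(p + c • q) := by
      rw [star_add, starsmul, hsp, hsq, smul_neg, neg_add]
    rw [hs, mul_neg] at hn
    refine ⟨-n, ?_, ?_⟩
    · intro h
      rw [neg_eq_zero.1 h, map_zero, neg_eq_zero] at hn
      exact hh0 c (mul_self_eq_zero.1 hn)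
    · rw [map_neg, ← hn, neg_neg]
  choose m hm0 hm using hm
  have key : ∀ c : F, (p + c • q) * u - star u * (p + c • q) = algebraMap F H (a + c * b) := by
    intro c
    rw [map_add, map_mul, ha, hb, ← Algebra.smul_def]
    simp only [add_mul, mul_add, smul_mul_assoc, mul_smul_comm, smul_sub]
    abel
  refine Set.infinite_of_injOn_mapsTo (s := {-a / b}ᶜ)
    (f := fun c : F => star u + ((a + c * b) / m c) • (p + c • q)) ?_ ?_
    (Set.Finite.infinite_compl (Set.finite_singleton _))
  · intro c hc d hd hcd
    have hs : a + c * b ≠ 0 := by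
      intro h
      apply hc
      rw [Set.mem_singleton_iff, eq_div_iff hb0]
      linear_combination h
    simp only [add_right_inj] at hcd
    generalize hk : (a + c * b) / m c = k at hcd
    generalize (a + d * b) / m d = l at hcd
    have hk0 : k ≠ 0 := by rw [← hk]; exact div_ne_zero hs (hm0 c)
    have e : (k - l) • p = (l * d - k * c) • q := by
      rw [smul_add, smul_add, smul_smul, smul_smul] at hcd
      rw [sub_smul, sub_smul, sub_eq_sub_iff_add_eq_add, hcd]
      abel
    have hkl : k = l := by
      by_contra hne
      apply hpL
      have : p = (k - l)⁻¹ • ((l * d - k * c) • q) := by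
        rw [← e, smul_smul, inv_mul_cancel₀ (sub_ne_zero.2 hne), one_smul]
      rw [this]
      exact L.smul_mem _ (L.smul_mem _ hqL)
    subst hkl
    rw [sub_self, zero_smul] at e
    rcases smul_eq_zero.1 e.symm with h | h
    · rw [← mul_sub] at h
      rcases mul_eq_zero.1 h with h | h
      · exact absurd h hk0
      · exact (sub_eq_zero.1 h).symm
    · exact absurd h hq0
  · intro c _
    refine ⟨E.add_mem hsuE (E.smul_mem _ (E.add_mem hpE (E.smul_mem _ hqE))), _, hh0 c, ?_⟩
    have hk := key c
    have hmm := hm c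
    have hne := hh0 c
    have hmc := hm0 c
    show star u + ((a + c * b) / m c) • (p + c • q) = _
    generalize p + c • q = h at *
    rw [mul_assoc, eq_inv_mul_iff_mul_eq₀ hne, mul_add, mul_smul_comm, hmm, hA, smul_smul,
      div_mul_cancel₀ _ hmc, ← hA, ← hk, hsu, mul_sub, sub_mul, Algebra.commutes]
    abel

/-- Let `H` be a quaternion skew field with centre `F` and let
`L` be a line through the point `F·1` of the projective space `P(H_F)` (a
`2`-dimensional `F`-subspace of `H` containing `1`) that is not contained in the
plane `(F1)^⊥ = {x : tr x = 0}`.  Then for every `h₀ ∈ H∖{0}` and every plane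
(`3`-dimensional `F`-subspace) `E` of `H` containing the line `h₀⁻¹·L·h₀`, the
set of lines of the orbit `{h⁻¹·L·h : h ∈ H∖{0}}` of `L` under inner
automorphisms of `H` that are contained in `E` is infinite. -/
theorem stmt_6 {F H : Type*} [Field F] [DivisionRing H] [Algebra F H] [StarRing H]
    (hrank : Module.finrank F H = 4)
    (hcenter : ∀ z : H, z ∈ Subring.center H ↔ ∃ a : F, z = algebraMap F H a)
    (hstarF : ∀ a : F, star (algebraMap F H a) = algebraMap F H a)
    (tr : H → F)
    (htr : ∀ h : H, algebraMap F H (tr h) = h + star h)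
    (L : Submodule F H) (hL : Module.finrank F L = 2) (h1L : (1 : H) ∈ L)
    (hLperp : ∃ x ∈ L, tr x ≠ 0) :
    ∀ h₀ : H, h₀ ≠ 0 →
      ∀ E : Submodule F H, Module.finrank F E = 3 →
        (fun x => h₀⁻¹ * x * h₀) '' (L : Set H) ⊆ (E : Set H) →
        {N : Submodule F H |
          (∃ h : H, h ≠ 0 ∧ (N : Set H) = (fun x => h⁻¹ * x * h) '' (L : Set H)) ∧
          (N : Set H) ⊆ (E : Set H)}.Infinite := by
  have hinj : Function.Injective (algebraMap F H) := (algebraMap F H).injective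
  intro h₀ hh₀ E hE hLE
  have h1E : (1 : H) ∈ E := hLE ⟨1, h1L, by simp [hh₀]⟩
  have hfinL : Module.Finite F L := Module.finite_of_finrank_pos (by omega)
  have tradd : ∀ x y, tr (x + y) = tr x + tr y := by
    intro x y
    apply hinj
    rw [map_add, htr, htr, htr, star_add]
    abel
  obtain ⟨u, huL, hu, hut⟩ : ∃ u ∈ L, (∀ a : F, u ≠ algebraMap F H a) ∧ tr u ≠ 0 := by
    obtain ⟨y, hyL, hy⟩ : ∃ y ∈ L, ∀ a : F, y ≠ algebraMap F H a := by
      by_contra hcon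
      push Not at hcon
      have hle : L ≤ Submodule.span F {(1 : H)} := by
        intro y hy
        obtain ⟨a, rfl⟩ := hcon y hy
        rw [Algebra.algebraMap_eq_smul_one]
        exact Submodule.smul_mem _ _ (Submodule.mem_span_singleton_self _)
      have := Submodule.finrank_mono hle
      rw [finrank_span_singleton one_ne_zero] at this
      omega
    obtain ⟨x, hxL, hx⟩ := hLperp
    by_cases hty : tr y = 0
    · by_cases hxF : ∃ a, x = algebraMap F H a
      · obtain ⟨a, rfl⟩ := hxF
        refine ⟨y + algebraMap F H a, L.add_mem hyL hxL, ?_, ?_⟩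
        · intro b hb
          apply hy (b - a)
          rw [map_sub, ← hb, add_sub_cancel_right]
        · rwa [tradd, hty, zero_add]
      · push Not at hxF
        exact ⟨x, hxL, hxF, hx⟩
    · exact ⟨y, hyL, hy, hty⟩
  have hLspan : ∀ x ∈ L, ∃ a b : F, x = a • (1 : H) + b • u := by
    have hli : LinearIndependent F ![(1 : H), u] := by
      rw [LinearIndependent.pair_iff' one_ne_zero]
      intro a h
      exact hu a (by rw [← h, Algebra.algebraMap_eq_smul_one])
    have hfr := finrank_span_eq_card hli
    have hle : Submodule.span F (Set.range ![(1 : H), u]) ≤ L := by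
      rw [Submodule.span_le]
      rintro _ ⟨i, rfl⟩
      fin_cases i
      · exact h1L
      · exact huL
    have heq := Submodule.eq_of_le_of_finrank_eq hle (by rw [hfr, hL]; simp)
    intro x hx
    rw [← heq] at hx
    simp only [Matrix.range_cons, Matrix.range_empty, Set.union_empty, Set.singleton_union] at hx
    obtain ⟨a, b, h⟩ := Submodule.mem_span_pair.1 hx
    exact ⟨a, b, h.symm⟩
  obtain ⟨n, hn⟩ := aux_norm hcenter tr htr u
  have hsu : star u = algebraMap F H (tr u) - u := by rw [htr]; abel
  have hconjA : ∀ (h : H), h ≠ 0 → ∀ a : F,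
      h⁻¹ * algebraMap F H a * h = algebraMap F H a := by
    intro h hh a
    rw [mul_assoc, Algebra.commutes, inv_mul_cancel_left₀ hh]
  have hquad : ∀ h : H, h ≠ 0 → (h⁻¹ * u * h) * (algebraMap F H (tr u) - h⁻¹ * u * h)
      = algebraMap F H n := by
    intro h hh
    have e3 := hconjA h hh (tr u)
    rw [← hconjA h hh n, ← hn, hsu]
    have e : h * h⁻¹ = 1 := mul_inv_cancel₀ hh
    calc h⁻¹ * u * h * (algebraMap F H (tr u) - h⁻¹ * u * h)
        = h⁻¹ * u * h * (h⁻¹ * algebraMap F H (tr u) * h - h⁻¹ * u * h) := by rw [e3]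
      _ = h⁻¹ * u * (h * h⁻¹) * (algebraMap F H (tr u) - u) * h := by noncomm_ring
      _ = h⁻¹ * (u * (algebraMap F H (tr u) - u)) * h := by rw [e]; noncomm_ring
  -- the conjugate
  have hu0E : h₀⁻¹ * u * h₀ ∈ E := hLE ⟨u, huL, rfl⟩
  have hu0 : ∀ a : F, h₀⁻¹ * u * h₀ ≠ algebraMap F H a := by
    intro a h
    apply hu a
    have : h₀ * (h₀⁻¹ * u * h₀) * h₀⁻¹ = u := by
      rw [mul_assoc, mul_assoc, mul_assoc, mul_inv_cancel₀ hh₀, mul_one,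
        mul_inv_cancel_left₀ hh₀]
    rw [← this, h, ← Algebra.commutes, mul_assoc, mul_inv_cancel₀ hh₀, mul_one]
  have hut0 : tr (h₀⁻¹ * u * h₀) ≠ 0 := by
    intro h0
    -- both `v` and its conjugate satisfy quadratic equations; subtract
    obtain ⟨n', hn'⟩ := aux_norm hcenter tr htr (h₀⁻¹ * u * h₀)
    have hsv : star (h₀⁻¹ * u * h₀) = - (h₀⁻¹ * u * h₀) := by
      have := htr (h₀⁻¹ * u * h₀)
      rw [h0, map_zero] at this
      exact (neg_eq_of_add_eq_zero_right this.symm).symm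
    have h2 := hquad h₀ hh₀
    rw [hsv] at hn'
    generalize h₀⁻¹ * u * h₀ = v at *
    have h3 : v * algebraMap F H (tr u) = algebraMap F H (n - n') := by
      rw [map_sub, ← h2, ← hn']
      noncomm_ring
    apply hu0 ((n - n') / tr u)
    rw [div_eq_mul_inv, map_mul, ← h3, mul_assoc, ← map_mul, mul_inv_cancel₀ hut, map_one, mul_one]
  have hT := aux_core hrank hcenter hstarF tr htr _ hu0 hut0 E hE h1E hu0E
  intro hfin
  apply hT
  have hfin2 : (⋃ N ∈ {N : Submodule F H |
          (∃ h : H, h ≠ 0 ∧ (N : Set H) = (fun x => h⁻¹ * x * h) '' (L : Set H)) ∧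
          (N : Set H) ⊆ (E : Set H)},
      {v : H | v ∈ N ∧ ∃ h : H, h ≠ 0 ∧ v = h⁻¹ * u * h}).Finite := by
    refine hfin.biUnion ?_
    rintro N ⟨⟨g, hg, hN⟩, -⟩
    have hcomm : ∀ x ∈ N, ∀ y ∈ N, x * y = y * x := by
      intro x hx y hy
      rw [← SetLike.mem_coe, hN] at hx hy
      obtain ⟨x, hx, rfl⟩ := hx
      obtain ⟨y, hy, rfl⟩ := hy
      have hxy : x * y = y * x := by
        obtain ⟨a, b, rfl⟩ := hLspan x hx
        obtain ⟨c, d, rfl⟩ := hLspan y hy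
        simp only [add_mul, mul_add, smul_mul_assoc, mul_smul_comm, one_mul, mul_one,
          smul_add, smul_smul]
        rw [mul_comm c a, mul_comm c b, mul_comm d a, mul_comm d b]
        abel
      have e : g * g⁻¹ = 1 := mul_inv_cancel₀ hg
      calc g⁻¹ * x * g * (g⁻¹ * y * g) = g⁻¹ * x * (g * g⁻¹) * y * g := by noncomm_ring
        _ = g⁻¹ * (x * y) * g := by rw [e]; noncomm_ring
        _ = g⁻¹ * y * (g * g⁻¹) * x * g := by rw [hxy, e]; noncomm_ring
        _ = _ := by noncomm_ring
    by_cases hne : ∃ v, v ∈ N ∧ ∃ h : H, h ≠ 0 ∧ v = h⁻¹ * u * h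
    · obtain ⟨v, hvN, h, hh, hv⟩ := hne
      refine (Set.toFinite {v, algebraMap F H (tr u) - v}).subset ?_
      rintro v' ⟨hv'N, h', hh', hv'⟩
      have q1 := hquad h hh
      have q2 := hquad h' hh'
      rw [← hv] at q1
      rw [← hv'] at q2
      have hc := hcomm v hvN v' hv'N
      have ha := Algebra.commutes (tr u) v
      have : (v' - v) * (v' - (algebraMap F H (tr u) - v)) = 0 := by
        have e : (v' - v) * (v' - (algebraMap F H (tr u) - v)) =
          v * (algebraMap F H (tr u) - v) - v' * (algebraMap F H (tr u) - v')
            + (v' * v - v * v') := by noncomm_ring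
        rw [e, q1, q2, hc, sub_self, sub_self, add_zero]
      rcases mul_eq_zero.1 this with h | h
      · left; exact sub_eq_zero.1 h
      · right; exact sub_eq_zero.1 h
    · refine Set.finite_empty.subset ?_
      intro v hv
      exact hne ⟨v, hv⟩
  refine hfin2.subset ?_
  rintro v ⟨hvE, h, hh, hv⟩
  have hv2 : v = (h₀ * h)⁻¹ * u * (h₀ * h) := by
    rw [hv, mul_inv_rev]; noncomm_ring
  have hg : h₀ * h ≠ 0 := mul_ne_zero hh₀ hh
  generalize h₀ * h = g at hv2 hg
  let φ : H →ₗ[F] H := (LinearMap.mulRight F g).comp (LinearMap.mulLeft F g⁻¹)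
  have hφ : ((L.map φ : Submodule F H) : Set H) = (fun x => g⁻¹ * x * g) '' (L : Set H) := by
    rw [Submodule.map_coe]
    rfl
  simp only [Set.mem_iUnion]
  refine ⟨L.map φ, ⟨⟨g, hg, hφ⟩, ?_⟩, ?_, g, hg, hv2⟩
  · rw [hφ]
    rintro _ ⟨x, hx, rfl⟩
    obtain ⟨a, b, rfl⟩ := hLspan x hx
    have : g⁻¹ * (a • (1 : H) + b • u) * g = a • (1 : H) + b • v := by
      rw [hv2]
      simp only [mul_add, add_mul, smul_mul_assoc, mul_smul_comm, mul_one, inv_mul_cancel₀ hg]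
    show g⁻¹ * (a • (1 : H) + b • u) * g ∈ E
    rw [this]
    exact E.add_mem (E.smul_mem _ h1E) (E.smul_mem _ hvE)
  · rw [← SetLike.mem_coe, hφ]
    exact ⟨u, huL, hv2.symm⟩
end

section
/- Let H be a quaternion skew field with centre F, let M be a 2-dimensional F-subspace of H, and let d ∈ H∖{0} be such that 1 ∈ M·d. Then an additive map φ : H → H satisfies φ(M·c) ⊆ M·c for every c ∈ H∖{0} if and only if φ = λ_g (left multiplication x ↦ g·x) for some g ∈ M·d. In other words, the kernel of the spread {M·c : c ∈ H∖{0}} (the right parallel class of M) consists precisely of the left multiplications by elements of the unique line of this class through the point F·1. -/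
theorem exists_centralizer_line {F H : Type*} [Field F] [DivisionRing H] [Algebra F H]
    (hrank : Module.finrank F H = 4)
    (hcenter : ∀ z : H, z ∈ Subring.center H ↔ ∃ a : F, z = algebraMap F H a)
    (L : Submodule F H) (hL : Module.finrank F L = 2) (h1 : (1 : H) ∈ L) :
    ∃ u : H, ∀ x : H, x ∈ L ↔ Commute x u := by
  haveI : FiniteDimensional F H := FiniteDimensional.of_finrank_eq_succ hrank
  have hlt : ∃ u ∈ L, u ∉ Submodule.span F {(1 : H)} := by
    by_contra hcon
    push Not at hcon
    have h := Submodule.finrank_mono (show L ≤ Submodule.span F {(1 : H)} from hcon)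
    rw [hL, finrank_span_singleton (one_ne_zero)] at h
    omega
  obtain ⟨u, huL, hu⟩ := hlt
  have hspan : L = Submodule.span F {(1 : H), u} := by
    symm
    apply Submodule.eq_of_le_of_finrank_le
    · rw [Submodule.span_le]
      rintro x (rfl | rfl)
      · exact h1
      · exact huL
    · have hle : Submodule.span F {(1 : H)} < Submodule.span F {(1 : H), u} := by
        refine lt_of_le_of_ne (Submodule.span_mono (by simp)) ?_
        intro h
        exact hu (h ▸ Submodule.subset_span (by simp))
      have h := Submodule.finrank_lt_finrank_of_lt hle
      rw [finrank_span_singleton (one_ne_zero)] at h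
      omega
  let C : Submodule F H := Subalgebra.toSubmodule (Subalgebra.centralizer F {u})
  have hC : ∀ x, x ∈ C ↔ Commute x u := by
    intro x
    simp only [C, Subalgebra.mem_toSubmodule, Subalgebra.mem_centralizer_iff,
      Set.mem_singleton_iff, forall_eq]
    exact ⟨fun h => h.symm, fun h => h.symm⟩
  have hLC : L ≤ C := by
    rw [hspan, Submodule.span_le]
    rintro x (rfl | rfl)
    · exact (hC _).2 (Commute.one_left _)
    · exact (hC _).2 (Commute.refl _)
  have hC2 : Module.finrank F C ≤ 2 := by
    by_contra hgt
    apply hu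
    have hcen : u ∈ Subring.center H := by
      rw [Subring.mem_center_iff]
      intro v
      by_cases hv : v = 0
      · simp [hv]
      have hinj : Function.Injective (LinearMap.mulRight F v) :=
        mul_left_injective₀ hv
      have hD := LinearEquiv.finrank_eq (Submodule.equivMapOfInjective _ hinj C)
      have hsum := Submodule.finrank_sup_add_finrank_inf_eq C (C.map (LinearMap.mulRight F v))
      have htop := Submodule.finrank_le (C ⊔ C.map (LinearMap.mulRight F v))
      have hne : C ⊓ C.map (LinearMap.mulRight F v) ≠ ⊥ := by
        intro h
        rw [h, finrank_bot] at hsum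
        omega
      obtain ⟨b, ⟨hb, a, ha, hab⟩, hb0⟩ := Submodule.exists_mem_ne_zero_of_ne_bot hne
      have hab' : a * v = b := hab
      have ha0 : a ≠ 0 := by
        rintro rfl
        exact hb0 (by rw [← hab', zero_mul])
      have hv' : v = a⁻¹ * b := by rw [← hab', inv_mul_cancel_left₀ ha0]
      rw [hv']
      exact (((hC a).1 ha).inv_left₀).mul_left ((hC b).1 hb)
    obtain ⟨a, rfl⟩ := (hcenter u).1 hcen
    rw [Submodule.mem_span_singleton]
    exact ⟨a, by rw [Algebra.algebraMap_eq_smul_one]⟩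
  have hEq : L = C := Submodule.eq_of_le_of_finrank_le hLC (by omega)
  exact ⟨u, fun x => by rw [hEq]; exact hC x⟩

/-- Let `H` be a quaternion skew field with centre `F`, let `M`
be a line of `P(H_F)` (a `2`-dimensional `F`-subspace of `H`), and let
`d ∈ H∖{0}` be such that `1 ∈ M·d`.  Then an additive map `φ : H → H` satisfies
`φ(M·c) ⊆ M·c` for every `c ∈ H∖{0}` if and only if `φ` is left multiplication
by some `g ∈ M·d`: the kernel of the right parallel class `{M·c : c ≠ 0}` of `M`
consists precisely of the left translations by elements of the line `M·d` of
this class through the point `F·1`. -/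
theorem stmt_7 {F H : Type*} [Field F] [DivisionRing H] [Algebra F H]
    (hrank : Module.finrank F H = 4)
    (hcenter : ∀ z : H, z ∈ Subring.center H ↔ ∃ a : F, z = algebraMap F H a)
    (M : Submodule F H) (hM : Module.finrank F M = 2)
    (d : H) (hd : d ≠ 0) (h1 : (1 : H) ∈ (fun x => x * d) '' (M : Set H))
    (φ : H →+ H) :
    (∀ c : H, c ≠ 0 →
        ∀ y ∈ (fun x => x * c) '' (M : Set H), φ y ∈ (fun x => x * c) '' (M : Set H)) ↔
      ∃ g ∈ (fun x => x * d) '' (M : Set H), ∀ x : H, φ x = g * x := by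
  let L : Submodule F H := M.map (LinearMap.mulRight F d)
  have hLdef : ∀ x, x ∈ L ↔ x ∈ (fun x => x * d) '' (M : Set H) := fun x => Iff.rfl
  have hL : Module.finrank F L = 2 := by
    rw [← hM]
    exact (LinearEquiv.finrank_eq (Submodule.equivMapOfInjective (LinearMap.mulRight F d)
      (mul_left_injective₀ hd) M)).symm
  obtain ⟨u, hu⟩ := exists_centralizer_line hrank hcenter L hL h1
  have hMc : ∀ c y : H, y ∈ (fun x => x * c) '' (M : Set H) ↔
      ∃ l ∈ L, l * (d⁻¹ * c) = y := by
    intro c y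
    constructor
    · rintro ⟨m, hm, rfl⟩
      exact ⟨m * d, ⟨m, hm, rfl⟩, by simp [mul_assoc, hd]⟩
    · rintro ⟨l, ⟨m, hm, rfl⟩, rfl⟩
      exact ⟨m, hm, by simp [mul_assoc, hd]⟩
  constructor
  · intro h
    have key : ∀ x : H, ∃ g ∈ L, φ x = g * x := by
      intro x
      by_cases hx : x = 0
      · exact ⟨0, L.zero_mem, by simp [hx]⟩
      have h2 := h (d * x) (mul_ne_zero hd hx) x
        ((hMc _ _).2 ⟨1, h1, by simp [hd]⟩)
      obtain ⟨l, hl, hl'⟩ := (hMc _ _).1 h2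
      exact ⟨l, hl, by rw [← hl']; simp [hd]⟩
    obtain ⟨g, hg, hg1⟩ := key 1
    have hout : ∀ x, x ∉ L → φ x = g * x := by
      intro x hx
      obtain ⟨k, hk, hkx⟩ := key x
      obtain ⟨e, he, hex⟩ := key (1 + x)
      rw [map_add, hg1, hkx] at hex
      have h3 : (k - e) * x = e - g := by
        have : k * x - e * x = e - g := by
          rw [mul_add, mul_one, mul_one] at hex
          rw [sub_eq_sub_iff_add_eq_add, add_comm, hex]
        rw [sub_mul, this]
      by_cases hke : k - e = 0
      · rw [hke, zero_mul] at h3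
        rw [hkx, sub_eq_zero.1 hke, sub_eq_zero.1 h3.symm]
      · exfalso
        apply hx
        have hx' : x = (k - e)⁻¹ * (e - g) := by rw [← h3, inv_mul_cancel_left₀ hke]
        rw [hx', hu]
        exact (((hu _).1 (L.sub_mem hk he)).inv_left₀).mul_left ((hu _).1 (L.sub_mem he hg))
    have hex : ∃ y, y ∉ L := by
      by_contra hcon
      push Not at hcon
      have : L = ⊤ := Submodule.eq_top_iff'.2 hcon
      rw [this, finrank_top] at hL
      omega
    obtain ⟨y, hy⟩ := hex
    refine ⟨g, hg, fun x => ?_⟩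
    by_cases hx : x ∈ L
    · have hxy : x + y ∉ L := fun h => hy ((L.add_mem_iff_right hx).1 h)
      have h4 := hout _ hxy
      rw [map_add, hout y hy, mul_add] at h4
      exact add_right_cancel h4
    · exact hout x hx
  · rintro ⟨g, hg, hφ⟩ c hc y hy
    obtain ⟨l, hl, rfl⟩ := (hMc _ _).1 hy
    refine (hMc _ _).2 ⟨g * l, ?_, ?_⟩
    · exact (hu _).2 (((hu _).1 hg).mul_left ((hu _).1 hl))
    · rw [hφ, mul_assoc]
end

section
/- Let H be a quaternion skew field with centre F. Let σ be a field automorphism of F and let β : H → H be an additive bijection with β(a·x) = σ(a)·β(x) for all a ∈ F, x ∈ H, such that β preserves right parallelism: for all 2-dimensional F-subspaces M, N of H, if N = M·c for some c ∈ H∖{0} then β(N) = β(M)·c' for some c' ∈ H∖{0}. Then φ := λ_{β(1)}⁻¹ ∘ β (where λ_{β(1)} is left multiplication by β(1)) is a ring automorphism of H mapping F·1 onto itself; hence β = λ_{β(1)} ∘ φ with φ ∈ Aut(H/F). Conversely, for every g ∈ H∖{0} and every ring automorphism φ of H with φ(F·1) = F·1, the map λ_g ∘ φ is such a semilinear bijection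 preserving right parallelism. (Thus the automorphism group of the right parallelism is Γ_r = λ(H*) ⋊ Aut(H/F).) -/
/-- A map `β : H → H` preserves the right parallelism of `P(H_F)`: whenever the
lines (`2`-dimensional `F`-subspaces) `M`, `N` satisfy `N = M·c` for some
`c ∈ H∖{0}`, then `β(N) = β(M)·c'` for some `c' ∈ H∖{0}`. -/
def PreservesRightParallelism (F : Type*) {H : Type*} [Field F] [DivisionRing H]
    [Algebra F H] (β : H → H) : Prop :=
  ∀ M N : Submodule F H, Module.finrank F M = 2 → Module.finrank F N = 2 →
    (∃ c : H, c ≠ 0 ∧ (N : Set H) = (fun x => x * c) '' (M : Set H)) →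
    ∃ c' : H, c' ≠ 0 ∧ β '' (N : Set H) = (fun x => x * c') '' (β '' (M : Set H))

theorem key_mul {H : Type*} [DivisionRing H] (A : H →+ H) (p : H)
    (hp : p ∉ Subring.center H) (h1 : A 1 = p)
    (hA : ∀ x, ∃ m, m * p = p * m ∧ A x = m * x) (x : H) : A x = p * x := by
  have main : ∀ x : H, x * p ≠ p * x → A x = p * x := by
    intro x hx
    obtain ⟨m, hm, hmx⟩ := hA (1 + x)
    obtain ⟨n, hn, hnx⟩ := hA x
    rw [map_add, h1, hnx] at hmx
    have e : (n - m) * x = m - p := by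
      have : p + n * x = m + m * x := by rw [hmx]; noncomm_ring
      rw [sub_mul, sub_eq_sub_iff_add_eq_add, add_comm, this, add_comm]
    by_cases hnm : n - m = 0
    · rw [hnm, zero_mul] at e
      rw [hnx, sub_eq_zero.1 hnm, sub_eq_zero.1 e.symm]
    · exfalso
      apply hx
      have hx' : x = (n - m)⁻¹ * (m - p) := by
        rw [← e, inv_mul_cancel_left₀ hnm]
      have c1 : Commute (n - m) p := (Commute.sub_left (show Commute n p from hn) hm)
      have c2 : Commute (m - p) p := Commute.sub_left (show Commute m p from hm) (Commute.refl p)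
      rw [hx']
      exact (Commute.mul_left c1.inv_left₀ c2)
  by_cases hx : x * p = p * x
  · obtain ⟨y, hy⟩ : ∃ y, y * p ≠ p * y := by
      by_contra! h
      exact hp (Subring.mem_center_iff.2 h)
    have h2 : (x + y) * p ≠ p * (x + y) := by
      rw [add_mul, mul_add, hx]
      intro h
      exact hy (add_left_cancel h)
    have h3 := main _ h2
    rw [map_add, main y hy, mul_add] at h3
    exact add_right_cancel h3
  · exact main x hx

theorem finrank_pair {F H : Type*} [Field F] [DivisionRing H] [Algebra F H] (q c : H)
    (hq : ∀ a : F, q ≠ algebraMap F H a) (hc : c ≠ 0) :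
    Module.finrank F (Submodule.span F {c, q * c}) = 2 := by
  have hli : LinearIndependent F ![c, q * c] := by
    rw [LinearIndependent.pair_iff]
    intro s t h
    have h' : (s • (1 : H) + t • q) * c = 0 := by
      rw [add_mul, smul_mul_assoc, smul_mul_assoc, one_mul, h]
    have h2 := (mul_eq_zero.1 h').resolve_right hc
    have ht : t = 0 := by
      by_contra ht
      apply hq (-(t⁻¹ * s))
      have h3 : t • q = -(s • (1 : H)) := eq_neg_of_add_eq_zero_right h2
      rw [← inv_smul_smul₀ ht q, h3, Algebra.algebraMap_eq_smul_one, neg_smul, mul_smul, smul_neg]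
    subst ht
    rw [zero_smul, add_zero] at h2
    exact ⟨(smul_eq_zero.1 h2).resolve_right one_ne_zero, rfl⟩
  have := finrank_span_eq_card hli
  rw [Matrix.range_cons_cons_empty] at this
  simpa using this

/-- Let `H` be a quaternion skew field with centre `F`.
(1) If `σ` is a field automorphism of `F` and `β : H → H` is an additive
bijection with `β (a • x) = σ a • β x` preserving right parallelism, then
`φ := λ_{β 1}⁻¹ ∘ β` is a ring automorphism of `H` mapping `F·1` onto itself
(so `β = λ_{β 1} ∘ φ` with `φ ∈ Aut(H/F)`).
(2) Conversely, for every `g ∈ H∖{0}` and every ring automorphism `φ` of `H`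
with `φ(F·1) = F·1`, the map `λ_g ∘ φ` is a semilinear bijection preserving
right parallelism.  (Thus `Γᵣ = λ(H*) ⋊ Aut(H/F)`.) -/
theorem stmt_8 {F H : Type*} [Field F] [DivisionRing H] [Algebra F H]
    (hrank : Module.finrank F H = 4)
    (hcenter : ∀ z : H, z ∈ Subring.center H ↔ ∃ a : F, z = algebraMap F H a) :
    ((∀ (σ : F ≃+* F) (β : H ≃+ H),
        (∀ (a : F) (x : H), β (a • x) = σ a • β x) →
        PreservesRightParallelism F (fun x => β x) →
        Function.Bijective (fun x : H => (β 1)⁻¹ * β x) ∧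
        (∀ x y : H, (β 1)⁻¹ * β (x * y) = ((β 1)⁻¹ * β x) * ((β 1)⁻¹ * β y)) ∧
        (fun x : H => (β 1)⁻¹ * β x) '' Set.range (algebraMap F H) =
          Set.range (algebraMap F H)) ∧
     (∀ g : H, g ≠ 0 → ∀ φ : H ≃+* H,
        (fun x : H => φ x) '' Set.range (algebraMap F H) = Set.range (algebraMap F H) →
        ∃ σ : F ≃+* F,
          (∀ (a : F) (x : H), g * φ (a • x) = σ a • (g * φ x)) ∧
          Function.Bijective (fun x : H => g * φ x) ∧
          PreservesRightParallelism F (fun x : H => g * φ x))) := by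
  constructor
  · intro σ β hσ hβ
    have hg : β 1 ≠ 0 := by simp
    have hF : ∀ a : F, (β 1)⁻¹ * β (algebraMap F H a) = algebraMap F H (σ a) := by
      intro a
      rw [Algebra.algebraMap_eq_smul_one, hσ, mul_smul_comm, inv_mul_cancel₀ hg,
        Algebra.algebraMap_eq_smul_one]
    refine ⟨?_, ?_, ?_⟩
    · exact (mulLeft_bijective₀ _ (inv_ne_zero hg)).comp β.bijective
    · intro q
      by_cases hq : ∃ a : F, q = algebraMap F H a
      · obtain ⟨a, rfl⟩ := hq
        intro y
        rw [hF, ← Algebra.smul_def, ← Algebra.smul_def, hσ, mul_smul_comm]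
      push Not at hq
      have hp : (β 1)⁻¹ * β q ∉ Subring.center H := by
        rw [hcenter]
        rintro ⟨a, ha⟩
        obtain ⟨b, rfl⟩ := σ.surjective a
        rw [← hF] at ha
        exact hq b (β.injective (mul_left_cancel₀ (inv_ne_zero hg) ha))
      intro c
      let A : H →+ H := (AddMonoidHom.mulLeft (β 1)⁻¹).comp (β.toAddMonoidHom.comp
        ((AddMonoidHom.mulLeft q).comp (β.symm.toAddMonoidHom.comp (AddMonoidHom.mulLeft (β 1)))))
      have hAv : ∀ x, A x = (β 1)⁻¹ * β (q * β.symm (β 1 * x)) := fun x => rfl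
      have hA := key_mul A ((β 1)⁻¹ * β q) hp (by rw [hAv]; simp) ?_ ((β 1)⁻¹ * β c)
      · rw [hAv, mul_inv_cancel_left₀ hg, β.symm_apply_apply] at hA
        exact hA
      · intro x
        obtain ⟨d, rfl⟩ : ∃ d, (β 1)⁻¹ * β d = x :=
          ⟨β.symm (β 1 * x), by simp [hg]⟩
        rw [hAv, mul_inv_cancel_left₀ hg, β.symm_apply_apply]
        by_cases hd : d = 0
        · exact ⟨0, by simp, by simp [hd]⟩
        have hL := finrank_pair (F := F) q 1 hq one_ne_zero
        have hN := finrank_pair (F := F) q d hq hd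
        obtain ⟨c', hc', he⟩ := hβ _ _ hL hN ⟨d, hd, by
          have : Submodule.span F {d, q * d} =
              (Submodule.span F {1, q * 1}).map (LinearMap.mulRight F d) := by
            rw [Submodule.map_span, Set.image_pair]; simp
          rw [this]; rfl⟩
        have key : ∀ z ∈ Submodule.span F {d, q * d}, ∃ m, Commute m ((β 1)⁻¹ * β q) ∧
            (β 1)⁻¹ * β z = m * c' := by
          intro z hz
          have : β z ∈ (fun x => β x) '' ((Submodule.span F {d, q * d} : Submodule F H) : Set H) :=
            ⟨z, hz, rfl⟩
          rw [he] at this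
          obtain ⟨_, ⟨l, hl, rfl⟩, hlz⟩ := this
          obtain ⟨a, b, rfl⟩ := Submodule.mem_span_pair.1 hl
          refine ⟨(β 1)⁻¹ * β (a • 1 + b • (q * 1)), ?_, ?_⟩
          · rw [map_add, hσ, hσ, mul_one, mul_add, mul_smul_comm, mul_smul_comm,
              inv_mul_cancel₀ hg]
            exact ((Commute.one_left _).smul_left _).add_left ((Commute.refl _).smul_left _)
          · rw [← hlz, mul_assoc]
        obtain ⟨m, hm, hmd⟩ := key d (Submodule.subset_span (by simp))
        obtain ⟨n, hn, hnd⟩ := key (q * d) (Submodule.subset_span (by simp))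
        have hm0 : m ≠ 0 := by
          rintro rfl
          rw [zero_mul] at hmd
          simp [hg, hd] at hmd
        refine ⟨n * m⁻¹, hn.mul_left hm.inv_left₀, ?_⟩
        rw [hnd, hmd, mul_assoc, inv_mul_cancel_left₀ hm0]
    · ext z
      constructor
      · rintro ⟨_, ⟨a, rfl⟩, rfl⟩
        exact ⟨σ a, (hF a).symm⟩
      · rintro ⟨a, rfl⟩
        refine ⟨_, ⟨σ.symm a, rfl⟩, ?_⟩
        simp only [hF, RingEquiv.apply_symm_apply]
  · intro g hg φ hφ
    have hinj : Function.Injective (algebraMap F H) := (algebraMap F H).injective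
    have h1 : ∀ a : F, ∃ b : F, algebraMap F H b = φ (algebraMap F H a) := by
      intro a
      have : φ (algebraMap F H a) ∈ Set.range (algebraMap F H) := by
        rw [← hφ]; exact ⟨_, ⟨a, rfl⟩, rfl⟩
      exact this
    choose s hs using h1
    let S : F →+* F :=
      { toFun := s
        map_one' := hinj (by simp [hs])
        map_mul' := fun a b => hinj (by simp [hs])
        map_zero' := hinj (by simp [hs])
        map_add' := fun a b => hinj (by simp [hs]) }
    have hS : Function.Bijective S := by
      refine ⟨S.injective, fun b => ?_⟩
      have : algebraMap F H b ∈ Set.range (algebraMap F H) := ⟨b, rfl⟩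
      rw [← hφ] at this
      obtain ⟨_, ⟨a, rfl⟩, h⟩ := this
      exact ⟨a, hinj ((hs a).trans h)⟩
    refine ⟨RingEquiv.ofBijective S hS, ?_, ?_, ?_⟩
    · intro a x
      have : (RingEquiv.ofBijective S hS) a = s a := rfl
      rw [this, Algebra.smul_def a x, map_mul, ← hs, ← Algebra.smul_def, mul_smul_comm]
    · exact (mulLeft_bijective₀ _ hg).comp φ.bijective
    · rintro M N - - ⟨c, hc, h⟩
      refine ⟨φ c, by simpa using hc, ?_⟩
      rw [h, Set.image_image, Set.image_image]
      simp only [map_mul, mul_assoc]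
end

section
/- Let H be a quaternion skew field with centre F and let ∥ be a Clifford-like parallelism of (P(H_F), ∥ₗ, ∥ᵣ). Then the following are equivalent: (a) ∥ = ∥ₗ or ∥ = ∥ᵣ (i.e. ∥ is a Clifford parallelism); (b) there exists an automorphism β of ∥ (a bijective additive map H → H, semilinear with respect to some field automorphism of F, mapping ∥-parallel lines to ∥-parallel lines) such that β(M) ∥ M for every line M (β stabilises all parallel classes of ∥) and β acts as a non-identical collineation on P(H_F), i.e. there is x ∈ H∖{0} with β(x) ∉ F·x. -/
namespace CL

section
variable {F H : Type*} [Field F] [DivisionRing H] [Algebra F H]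

/-- `x · L` -/
def lm (x : H) (L : Submodule F H) : Submodule F H := L.map (LinearMap.mulLeft F x)
/-- `L · x` -/
def rm (x : H) (L : Submodule F H) : Submodule F H := L.map (LinearMap.mulRight F x)

theorem coe_lm (x : H) (L : Submodule F H) :
    (lm x L : Set H) = (fun y => x * y) '' (L : Set H) := rfl
theorem coe_rm (x : H) (L : Submodule F H) :
    (rm x L : Set H) = (fun y => y * x) '' (L : Set H) := rfl

theorem mem_lm {x : H} (hx : x ≠ 0) {L : Submodule F H} {y : H} :
    y ∈ lm x L ↔ x⁻¹ * y ∈ L := by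
  constructor
  · rintro ⟨l, hl, rfl⟩
    simpa [inv_mul_cancel_left₀ hx] using hl
  · intro h
    exact ⟨_, h, by simp [mul_inv_cancel_left₀ hx]⟩

theorem mem_rm {x : H} (hx : x ≠ 0) {L : Submodule F H} {y : H} :
    y ∈ rm x L ↔ y * x⁻¹ ∈ L := by
  constructor
  · rintro ⟨l, hl, rfl⟩
    simpa [mul_inv_cancel_right₀ hx] using hl
  · intro h
    exact ⟨_, h, by simp [inv_mul_cancel_right₀ hx]⟩

theorem finrank_lm {x : H} (hx : x ≠ 0) (L : Submodule F H) :
    Module.finrank F (lm x L) = Module.finrank F L :=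
  (LinearEquiv.finrank_eq (Submodule.equivMapOfInjective (LinearMap.mulLeft F x)
    (by intro a b h; exact mul_left_cancel₀ hx h) L)).symm

theorem finrank_rm {x : H} (hx : x ≠ 0) (L : Submodule F H) :
    Module.finrank F (rm x L) = Module.finrank F L :=
  (LinearEquiv.finrank_eq (Submodule.equivMapOfInjective (LinearMap.mulRight F x)
    (by intro a b h; exact mul_right_cancel₀ hx h) L)).symm

/-- scalar elements -/
def IsF (F : Type*) {H : Type*} [Field F] [DivisionRing H] [Algebra F H] (z : H) : Prop :=
  ∃ a : F, z = algebraMap F H a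

/-- the standing assumptions -/
structure Q (F H : Type*) [Field F] [DivisionRing H] [Algebra F H] : Prop where
  rank : Module.finrank F H = 4
  center : ∀ z : H, (∀ y, y * z = z * y) → IsF F z

theorem Q.fd (q : Q F H) : FiniteDimensional F H :=
  FiniteDimensional.of_finrank_pos (by rw [q.rank]; norm_num)

theorem IsF.comm {z : H} (h : IsF F z) (y : H) : y * z = z * y := by
  obtain ⟨a, rfl⟩ := h
  exact (Algebra.commutes a y).symm

theorem disj (Z : Submodule F H) (hZ : ∀ a ∈ Z, ∀ b ∈ Z, a⁻¹ * b ∈ Z) {f : H} (hf : f ∉ Z) :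
    Disjoint Z (rm f Z) := by
  rw [Submodule.disjoint_def]
  rintro x hx ⟨b, hb, rfl⟩
  by_contra h
  have hb0 : b ≠ 0 := by rintro rfl; simp at h
  apply hf
  have := hZ b hb _ hx
  simpa [inv_mul_cancel_left₀ hb0] using this

theorem rk_sup (q : Q F H) (Z : Submodule F H) (hZ : ∀ a ∈ Z, ∀ b ∈ Z, a⁻¹ * b ∈ Z) {f : H}
    (hf : f ∉ Z) : Module.finrank F (Z ⊔ rm f Z : Submodule F H) = 2 * Module.finrank F Z := by
  have := q.fd
  have h0 : f ≠ 0 := by rintro rfl; exact hf Z.zero_mem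
  have h := Submodule.finrank_sup_add_finrank_inf_eq Z (rm f Z)
  rw [(disj Z hZ hf).eq_bot, finrank_rm h0] at h
  simp at h
  omega

theorem decomp (q : Q F H) (Z : Submodule F H) (hZ : ∀ a ∈ Z, ∀ b ∈ Z, a⁻¹ * b ∈ Z) {f : H}
    (hf : f ∉ Z) (h2 : Module.finrank F Z = 2) (x : H) :
    ∃ a ∈ Z, ∃ b ∈ Z, x = a + b * f := by
  have := q.fd
  have h := rk_sup q Z hZ hf
  rw [h2] at h
  have ht : Z ⊔ rm f Z = ⊤ := Submodule.eq_top_of_finrank_eq (by rw [h, q.rank])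
  have hx : x ∈ Z ⊔ rm f Z := by rw [ht]; trivial
  rw [Submodule.mem_sup] at hx
  obtain ⟨a, ha, _, ⟨b, hb, rfl⟩, rfl⟩ := hx
  exact ⟨a, ha, b, hb, rfl⟩

theorem hli_pair {e : H} (heF : ¬ IsF F e) : LinearIndependent F ![(1 : H), e] := by
  rw [LinearIndependent.pair_iff]
  intro s t hst
  have ht : t = 0 := by
    by_contra ht
    apply heF
    refine ⟨-(t⁻¹ * s), ?_⟩
    have : e = t⁻¹ • (t • e) := by rw [smul_smul, inv_mul_cancel₀ ht, one_smul]
    rw [this, eq_neg_of_add_eq_zero_right hst, Algebra.algebraMap_eq_smul_one, smul_neg, smul_smul,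
      neg_smul]
  subst ht
  simpa using hst

theorem mem_line (q : Q F H) {L : Submodule F H} (h2 : Module.finrank F L = 2) (h1 : (1 : H) ∈ L)
    {e : H} (he : e ∈ L) (heF : ¬ IsF F e) (x : H) : x ∈ L ↔ x * e = e * x := by
  have := q.fd
  let Z : Submodule F H := Subalgebra.toSubmodule (Subalgebra.centralizer F {e})
  have memZ : ∀ x, x ∈ Z ↔ e * x = x * e := by
    intro x
    simp [Z, Subalgebra.mem_centralizer_iff]
  have hZ : ∀ a ∈ Z, ∀ b ∈ Z, a⁻¹ * b ∈ Z := by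
    intro a ha b hb
    rw [memZ] at *
    have : Commute e (a⁻¹ * b) :=
      Commute.mul_right (Commute.inv_right₀ (show Commute e a from ha)) (show Commute e b from hb)
    exact this
  obtain ⟨f, hf⟩ : ∃ f, f ∉ Z := by
    by_contra! h
    exact heF (q.center e fun y => ((memZ y).1 (h y)).symm)
  have hr := rk_sup q Z hZ hf
  have hle := Submodule.finrank_le (Z ⊔ rm f Z)
  rw [q.rank] at hle
  let S : Submodule F H := Submodule.span F (Set.range ![(1 : H), e])
  have hli := hli_pair (F := F) heF
  have hS : Module.finrank F S = 2 := by
    have := finrank_span_eq_card hli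
    simpa using this
  have hSL : S ≤ L := by
    apply Submodule.span_le.2
    rintro _ ⟨i, rfl⟩
    fin_cases i <;> simpa
  have hSZ : S ≤ Z := by
    apply Submodule.span_le.2
    rintro _ ⟨i, rfl⟩
    fin_cases i
    · exact (memZ _).2 (by simp)
    · exact (memZ _).2 (by simp)
  have e1 : S = L := Submodule.eq_of_le_of_finrank_le hSL (by omega)
  have e2 : S = Z := Submodule.eq_of_le_of_finrank_le hSZ (by omega)
  rw [← e1, e2, memZ]
  exact eq_comm

theorem isF_mem {L : Submodule F H} (h1 : (1 : H) ∈ L) {z : H} (h : IsF F z) : z ∈ L := by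
  obtain ⟨a, rfl⟩ := h
  rw [Algebra.algebraMap_eq_smul_one]
  exact L.smul_mem _ h1

theorem exists_gen (q : Q F H) {L : Submodule F H} (h2 : Module.finrank F L = 2) :
    ∃ e ∈ L, ¬ IsF F e := by
  have := q.fd
  by_contra! h
  have hle : L ≤ Submodule.span F {(1 : H)} := by
    intro x hx
    obtain ⟨a, rfl⟩ := h x hx
    rw [Submodule.mem_span_singleton]
    exact ⟨a, by rw [Algebra.algebraMap_eq_smul_one]⟩
  have h3 := Submodule.finrank_mono hle
  have h4 : Module.finrank F (Submodule.span F {(1 : H)}) = 1 := finrank_span_singleton one_ne_zero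
  omega

/-- line through 1 -/
structure Ln (L : Submodule F H) : Prop where
  rk : Module.finrank F L = 2
  one : (1 : H) ∈ L

theorem Ln.comm (q : Q F H) {L : Submodule F H} (hL : Ln L) {x y : H} (hx : x ∈ L) (hy : y ∈ L) :
    x * y = y * x := by
  by_cases h : IsF F y
  · exact h.comm x
  · exact (mem_line q hL.rk hL.one hy h x).1 hx

theorem Ln.mul (q : Q F H) {L : Submodule F H} (hL : Ln L) {x y : H} (hx : x ∈ L) (hy : y ∈ L) :
    x * y ∈ L := by
  obtain ⟨e, he, heF⟩ := exists_gen q hL.rk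
  have hm := mem_line q hL.rk hL.one he heF
  rw [hm] at hx hy ⊢
  rw [mul_assoc, hy, ← mul_assoc, hx, mul_assoc]

theorem Ln.inv (q : Q F H) {L : Submodule F H} (hL : Ln L) {x : H} (hx : x ∈ L) :
    x⁻¹ ∈ L := by
  obtain ⟨e, he, heF⟩ := exists_gen q hL.rk
  have hm := mem_line q hL.rk hL.one he heF
  rw [hm] at hx ⊢
  exact (Commute.inv_left₀ (show Commute x e from hx))

theorem Ln.invmul (q : Q F H) {L : Submodule F H} (hL : Ln L) :
    ∀ a ∈ L, ∀ b ∈ L, a⁻¹ * b ∈ L := fun _ ha _ hb => hL.mul q (hL.inv q ha) hb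

theorem Ln.decomp (q : Q F H) {L : Submodule F H} (hL : Ln L) {f : H} (hf : f ∉ L) (x : H) :
    ∃ a ∈ L, ∃ b ∈ L, x = a + b * f := CL.decomp q L (hL.invmul q) hf hL.rk x

theorem Ln.indep (q : Q F H) {L : Submodule F H} (hL : Ln L) {f : H} (hf : f ∉ L) {a b c d : H}
    (ha : a ∈ L) (hb : b ∈ L) (hc : c ∈ L) (hd : d ∈ L) (h : a + b * f = c + d * f) :
    a = c ∧ b = d := by
  have h1 : (d - b) * f = a - c := by
    rw [sub_mul, sub_eq_sub_iff_add_eq_add, add_comm, ← h, add_comm]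
  have h2 : a - c = 0 := by
    have := Submodule.disjoint_def.1 (disj L (hL.invmul q) hf) (a - c) (L.sub_mem ha hc)
    exact this ⟨d - b, L.sub_mem hd hb, h1⟩
  have hf0 : f ≠ 0 := by rintro rfl; exact hf L.zero_mem
  rw [h2] at h1
  have := (mul_eq_zero.1 h1).resolve_right hf0
  exact ⟨sub_eq_zero.1 h2, (sub_eq_zero.1 this).symm⟩

theorem exists_notMem (q : Q F H) {L : Submodule F H} (h2 : Module.finrank F L = 2) :
    ∃ f, f ∉ L := by
  by_contra! h
  have : L = ⊤ := by ext x; simp [h x]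
  rw [this, finrank_top, q.rank] at h2
  omega

/-- no line through 1 is normal -/
theorem not_normal (q : Q F H) {L : Submodule F H} (hL : Ln L)
    (h : ∀ g : H, g ≠ 0 → ∀ l ∈ L, g * l * g⁻¹ ∈ L) : False := by
  obtain ⟨e, he, heF⟩ := exists_gen q hL.rk
  obtain ⟨f, hf⟩ := exists_notMem q hL.rk
  have hf0 : f ≠ 0 := by rintro rfl; exact hf L.zero_mem
  have hf1 : 1 + f ≠ 0 := by
    intro h0
    apply hf
    rw [eq_neg_of_add_eq_zero_right h0]
    exact L.neg_mem hL.one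
  have a1 := h f hf0 e he
  have a2 := h (1 + f) hf1 e he
  have e1 : f * e = (f * e * f⁻¹) * f := by rw [inv_mul_cancel_right₀ hf0]
  have e2 : (1 + f) * e = ((1 + f) * e * (1 + f)⁻¹) * (1 + f) := by rw [inv_mul_cancel_right₀ hf1]
  generalize f * e * f⁻¹ = e' at *
  generalize (1 + f) * e * (1 + f)⁻¹ = e'' at *
  rw [add_mul, one_mul, e1, mul_add, mul_one] at e2
  obtain ⟨h3, h4⟩ := hL.indep q hf he a1 a2 a2 e2
  apply hf
  rw [mem_line q hL.rk hL.one he heF, e1, h4, ← h3]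

theorem infinite (q : Q F H) : Infinite F := by
  by_contra hfin
  rw [not_infinite_iff_finite] at hfin
  have := q.fd
  have : Finite H := Module.finite_of_finite F
  have hc : ∀ x y : H, x * y = y * x := by
    let _ := littleWedderburn H
    intro x y
    exact mul_comm (G := H) x y
  have h4 : Module.finrank F (⊤ : Submodule F H) ≤ 1 := by
    have hle : (⊤ : Submodule F H) ≤ Submodule.span F {(1 : H)} := by
      intro x _
      obtain ⟨a, rfl⟩ := q.center x (fun y => hc _ _)
      rw [Submodule.mem_span_singleton]
      exact ⟨a, by rw [Algebra.algebraMap_eq_smul_one]⟩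
    have h3 := Submodule.finrank_mono hle
    rwa [finrank_span_singleton one_ne_zero] at h3
  rw [finrank_top, q.rank] at h4
  omega

theorem indep2 {e : H} (heF : ¬ IsF F e) {a b : F}
    (h : algebraMap F H a + algebraMap F H b * e = 0) : a = 0 ∧ b = 0 := by
  have h1 := hli_pair (F := F) heF
  rw [LinearIndependent.pair_iff] at h1
  refine h1 a b ?_
  rw [← h, Algebra.algebraMap_eq_smul_one, Algebra.smul_def b e]

theorem coords (q : Q F H) {L : Submodule F H} (hL : Ln L) {e : H} (he : e ∈ L)
    (heF : ¬ IsF F e) {x : H} (hx : x ∈ L) :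
    ∃ a b : F, x = algebraMap F H a + algebraMap F H b * e := by
  have := q.fd
  have hS : Module.finrank F (Submodule.span F (Set.range ![(1 : H), e])) = 2 := by
    have := finrank_span_eq_card (hli_pair heF)
    simpa using this
  have hSL : Submodule.span F (Set.range ![(1 : H), e]) ≤ L := by
    apply Submodule.span_le.2
    rintro _ ⟨i, rfl⟩
    fin_cases i
    · simpa using hL.one
    · simpa using he
  have e1 := Submodule.eq_of_le_of_finrank_le hSL (by rw [hS, hL.rk])
  rw [← e1] at hx
  rw [Submodule.mem_span_range_iff_exists_fun] at hx
  obtain ⟨c, rfl⟩ := hx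
  refine ⟨c 0, c 1, ?_⟩
  simp [Fin.sum_univ_two, Algebra.algebraMap_eq_smul_one]

theorem quad (q : Q F H) {L : Submodule F H} (hL : Ln L) {e : H} (he : e ∈ L)
    (heF : ¬ IsF F e) :
    ∃ t n : F, n ≠ 0 ∧ e * e = algebraMap F H t * e - algebraMap F H n := by
  obtain ⟨a, b, h⟩ := coords q hL he heF (hL.mul q he he)
  refine ⟨b, -a, ?_, by rw [h, map_neg]; abel⟩
  intro h0
  have ha : a = 0 := by simpa using h0
  subst ha
  rw [map_zero, zero_add] at h
  have he0 : e ≠ 0 := by rintro rfl; exact heF ⟨0, by simp⟩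
  exact heF ⟨b, mul_right_cancel₀ he0 h⟩

/-- `k` normalises `L` -/
def Nm (L : Submodule F H) (k : H) : Prop := ∀ x, x ∈ L ↔ k * x * k⁻¹ ∈ L

/-- `k` normalises all conjugates of `L` -/
def KK (L : Submodule F H) (k : H) : Prop := k ≠ 0 ∧ ∀ h : H, h ≠ 0 → Nm L (h⁻¹ * k * h)

theorem Nm.mul {L : Submodule F H} {k l : H} (hk : Nm L k) (hl : Nm L l) : Nm L (k * l) := by
  intro x
  rw [hl x, hk, mul_inv_rev]
  simp only [mul_assoc]

theorem Nm.inv {L : Submodule F H} {k : H} (h0 : k ≠ 0) (hk : Nm L k) : Nm L k⁻¹ := by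
  intro x
  rw [hk (k⁻¹ * x * k⁻¹⁻¹), inv_inv]
  simp only [mul_assoc, mul_inv_cancel₀ h0, mul_one, mul_inv_cancel_left₀ h0]

theorem KK.mul {L : Submodule F H} {k l : H} (hk : KK L k) (hl : KK L l) : KK L (k * l) := by
  refine ⟨mul_ne_zero hk.1 hl.1, fun h h0 => ?_⟩
  have := (hk.2 h h0).mul (hl.2 h h0)
  convert this using 1
  simp only [mul_assoc, mul_inv_cancel_left₀ h0]

theorem KK.inv {L : Submodule F H} {k : H} (hk : KK L k) : KK L k⁻¹ := by
  refine ⟨inv_ne_zero hk.1, fun h h0 => ?_⟩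
  have := (hk.2 h h0).inv (mul_ne_zero (mul_ne_zero (inv_ne_zero h0) hk.1) h0)
  convert this using 1
  simp only [mul_inv_rev, inv_inv, mul_assoc]

theorem KK.conj {L : Submodule F H} {k g : H} (hk : KK L k) (g0 : g ≠ 0) : KK L (g * k * g⁻¹) := by
  refine ⟨mul_ne_zero (mul_ne_zero g0 hk.1) (inv_ne_zero g0), fun h h0 => ?_⟩
  have := hk.2 (g⁻¹ * h) (mul_ne_zero (inv_ne_zero g0) h0)
  convert this using 1
  simp only [mul_inv_rev, inv_inv, mul_assoc]

theorem KK.nm {L : Submodule F H} {k : H} (hk : KK L k) : Nm L k := by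
  simpa using hk.2 1 one_ne_zero

theorem isF_conj {k g : H} (g0 : g ≠ 0) (h : IsF F (g * k * g⁻¹)) : IsF F k := by
  have h1 := h.comm g
  have : k = g * k * g⁻¹ := by
    rw [mul_assoc g k, mul_assoc g, mul_assoc k, inv_mul_cancel₀ g0, mul_one] at h1
    have := mul_left_cancel₀ g0 h1
    rw [mul_assoc, this]
  rw [this]; exact h

theorem exists_conj (q : Q F H) {L : Submodule F H} (hL : Ln L) {k : H} (hk : ¬ IsF F k) :
    ∃ g : H, g ≠ 0 ∧ g * k * g⁻¹ ∉ L := by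
  by_contra! h
  have hkL : k ∈ L := by simpa using h 1 one_ne_zero
  apply not_normal q hL
  intro g g0 l hl
  rw [mem_line q hL.rk hL.one (h g g0) (fun h' => hk (isF_conj g0 h'))]
  have := hL.comm q hl hkL
  simp only [mul_assoc, inv_mul_cancel_left₀ g0]
  rw [← mul_assoc l, this, mul_assoc]

theorem sq_isF (q : Q F H) {L : Submodule F H} (hL : Ln L) {u : H} (hu : u ∈ L)
    (hk : KK L u) : IsF F (u * u) := by
  by_cases huF : IsF F u
  · obtain ⟨a, rfl⟩ := huF
    exact ⟨a * a, by simp⟩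
  obtain ⟨h, h0, hv⟩ := exists_conj q hL huF
  have hkv := hk.conj h0
  have hvL : ∀ x, x ∈ L → h * x * h⁻¹ * (h * u * h⁻¹) = (h * u * h⁻¹) * (h * x * h⁻¹) := by
    intro x hx
    simp only [mul_assoc, inv_mul_cancel_left₀ h0]
    rw [← mul_assoc x, hL.comm q hx hu, mul_assoc]
  have hNu := hk.2 h h0
  have hw1' : h⁻¹ * u * h * u * (h⁻¹ * u * h)⁻¹ * u⁻¹ ∈ L :=
    hL.mul q ((hNu u).1 hu) (hL.inv q hu)
  set v := h * u * h⁻¹ with hvdef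
  have hv0 : v ≠ 0 := hkv.1
  have hu0 := hk.1
  set w := u * v * u⁻¹ * v⁻¹ with hw
  have hwL : w ∈ L := by
    have := hL.mul q hu ((hkv.nm u⁻¹).1 (hL.inv q hu))
    convert this using 1
    simp only [hw, mul_assoc]
  have hwv : w * v = v * w := by
    have := hvL _ hw1'
    convert this using 2 <;>
    simp only [hw, hvdef, mul_assoc, mul_inv_rev, inv_inv, mul_inv_cancel_left₀ h0]
  have hwF : IsF F w := by
    by_contra hwF
    exact hv ((mem_line q hL.rk hL.one hwL hwF v).2 hwv.symm)
  have huv : u * v = w * v * u := by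
    rw [hw, inv_mul_cancel_right₀ hv0, inv_mul_cancel_right₀ hu0]
  have hne : w ≠ 1 := by
    intro h1
    rw [h1, one_mul] at huv
    exact hv ((mem_line q hL.rk hL.one hu huF v).2 huv.symm)
  obtain ⟨t, n, hn, ht⟩ := quad q hL hu huF
  obtain ⟨ω, hω⟩ := hwF
  clear_value w v
  subst hω
  have c1 : ∀ (a : F) (x : H), algebraMap F H a * x = x * algebraMap F H a :=
    fun a x => Algebra.commutes a x
  have k1 : u * u * v = v * (algebraMap F H (ω * ω) * (u * u)) := by
    calc u * u * v = u * (u * v) := mul_assoc _ _ _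
      _ = u * (algebraMap F H ω * v * u) := by rw [huv]
      _ = algebraMap F H ω * (u * v) * u := by
        rw [← mul_assoc, ← mul_assoc, ← c1]; simp only [mul_assoc]
      _ = algebraMap F H ω * (algebraMap F H ω * v * u) * u := by rw [huv]
      _ = algebraMap F H (ω * ω) * (v * (u * u)) := by rw [map_mul]; simp only [mul_assoc]
      _ = _ := by rw [← mul_assoc, c1, mul_assoc]
  have k2 : u * u * v = v * (algebraMap F H (t * ω) * u - algebraMap F H n) := by
    rw [ht, sub_mul, mul_assoc, huv, mul_sub, c1 n, mul_assoc, ← mul_assoc, ← map_mul, ← mul_assoc,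
      c1, mul_assoc]
  have k3 := mul_left_cancel₀ hv0 (k1.symm.trans k2)
  rw [ht] at k3
  have k4 : algebraMap F H (n - ω * ω * n) + algebraMap F H (ω * ω * t - t * ω) * u = 0 := by
    have e1 : algebraMap F H (ω * ω) * (algebraMap F H t * u - algebraMap F H n)
      - (algebraMap F H (t * ω) * u - algebraMap F H n) = 0 := by rw [k3, sub_self]
    rw [← e1]
    simp only [map_sub, map_mul, mul_sub, sub_mul, mul_assoc]
    abel
  obtain ⟨k5, k6⟩ := indep2 huF k4
  have k7 : ω * ω = 1 := by
    have : (1 - ω * ω) * n = 0 := by rw [sub_mul, one_mul, k5]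
    exact (sub_eq_zero.1 ((mul_eq_zero.1 this).resolve_right hn)).symm
  have hω1 : ω ≠ 1 := by rintro rfl; simp at hne
  have ht0 : t = 0 := by
    have : t * (1 - ω) = 0 := by rw [mul_sub, mul_one, ← k6, k7]; ring
    exact (mul_eq_zero.1 this).resolve_right (sub_ne_zero.2 hω1.symm)
  refine ⟨-n, ?_⟩
  rw [ht, ht0]; simp

theorem KK_isF (q : Q F H) {L : Submodule F H} (hL : Ln L) {k : H} (hk : KK L k) : IsF F k := by
  by_contra hkF
  obtain ⟨g, g0, hg⟩ := exists_conj q hL hkF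
  replace hk := hk.conj g0
  replace hkF : ¬ IsF F (g * k * g⁻¹) := fun h => hkF (isF_conj g0 h)
  generalize g * k * g⁻¹ = k at *
  have := infinite q
  obtain ⟨e, he, heF⟩ := exists_gen q hL.rk
  have hk0 := hk.1
  have c1 : ∀ (a : F) (x : H), algebraMap F H a * x = x * algebraMap F H a :=
    fun a x => Algebra.commutes a x
  obtain ⟨e', he'⟩ : ∃ e', e' = k⁻¹ * e * k := ⟨_, rfl⟩
  have he'L : e' ∈ L := by
    have := (hk.inv.nm e).1 he
    rwa [inv_inv, ← he'] at this
  have hne : e' ≠ e := by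
    intro h
    apply hg
    rw [mem_line q hL.rk hL.one he heF]
    rw [he', mul_assoc] at h
    nth_rewrite 1 [← h]
    rw [mul_inv_cancel_left₀ hk0]
  obtain ⟨t, n, hn, ht⟩ := quad q hL he heF
  have ht' : e' * e' = algebraMap F H t * e' - algebraMap F H n := by
    have : e' * e' = k⁻¹ * (e * e) * k := by
      rw [he']; simp only [mul_assoc, mul_inv_cancel_left₀ hk0]
    rw [this, ht, he', mul_sub, sub_mul, ← mul_assoc, ← c1, ← c1]
    simp only [mul_assoc, inv_mul_cancel₀ hk0, mul_one]
  have hbar : e' = algebraMap F H t - e := by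
    have h0 : (e' - e) * (e' + e - algebraMap F H t) = 0 := by
      rw [mul_sub, mul_add, sub_mul, sub_mul, ht, ht', hL.comm q he'L he, ← c1, mul_sub]
      abel
    have := (mul_eq_zero.1 h0).resolve_left (sub_ne_zero.2 hne)
    rw [← eq_sub_of_add_eq (sub_eq_zero.1 this)]
  have key : ∀ s : F, 2 * s + t ≠ 0 → (s + t) ^ 2 + s ^ 2 = 2 * n := by
    intro s hs
    have hgL : algebraMap F H s + e ∈ L := L.add_mem (isF_mem hL.one ⟨s, rfl⟩) he
    have hgL' : algebraMap F H s + e' ∈ L := L.add_mem (isF_mem hL.one ⟨s, rfl⟩) he'L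
    have hgn : algebraMap F H s + e ≠ 0 := by
      intro h
      apply heF
      exact ⟨-s, by rw [map_neg]; exact eq_neg_of_add_eq_zero_right h⟩
    have hK : KK L (k⁻¹ * ((algebraMap F H s + e) * k * (algebraMap F H s + e)⁻¹)) :=
      hk.inv.mul (hk.conj hgn)
    have heq : k⁻¹ * ((algebraMap F H s + e) * k * (algebraMap F H s + e)⁻¹)
        = (algebraMap F H s + e') * (algebraMap F H s + e)⁻¹ := by
      rw [← mul_assoc, ← mul_assoc, mul_add, add_mul, ← he', ← c1, mul_assoc _ k⁻¹ k,
        inv_mul_cancel₀ hk0, mul_one]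
    rw [heq] at hK
    obtain ⟨p, hp⟩ := sq_isF q hL (hL.mul q hgL' (hL.inv q hgL)) hK
    have h1 : (algebraMap F H s + e') * (algebraMap F H s + e') =
        algebraMap F H p * ((algebraMap F H s + e) * (algebraMap F H s + e)) := by
      rw [← hp]
      have := hL.comm q hgL' (hL.inv q hgL)
      have h2 : (algebraMap F H s + e') * (algebraMap F H s + e)⁻¹ * ((algebraMap F H s + e') * (algebraMap F H s + e)⁻¹) = (algebraMap F H s + e') * (algebraMap F H s + e') * (algebraMap F H s + e)⁻¹ * (algebraMap F H s + e)⁻¹ := by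
        generalize (algebraMap F H s + e)⁻¹ = b at this ⊢
        generalize algebraMap F H s + e' = a at this ⊢
        rw [mul_assoc a b, ← mul_assoc b a b, ← this]
        simp only [mul_assoc]
      rw [h2, ← mul_assoc, inv_mul_cancel_right₀ hgn, inv_mul_cancel_right₀ hgn]
    open Polynomial in
    have h3 : (C (s + t) - X) ^ 2 - C p * (C s + X) ^ 2 =
        (C ((s + t) ^ 2 - n - p * (s ^ 2 - n)) + C (-(2 * s + t) - p * (2 * s + t)) * X)
          + C (1 - p) * (X * X - (C t * X - C n)) := by
      simp only [map_sub, map_add, map_mul, map_pow, map_neg, map_one, map_ofNat]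
      ring
    have h4 := congrArg (Polynomial.aeval e) h3
    simp only [map_sub, map_add, map_mul, map_pow, Polynomial.aeval_X, Polynomial.aeval_C] at h4
    rw [ht, sub_self, mul_zero, add_zero] at h4
    have h5 : (algebraMap F H s + algebraMap F H t - e) ^ 2 = 
        algebraMap F H p * (algebraMap F H s + e) ^ 2 := by
      rw [sq, sq, ← h1, hbar, add_sub_assoc]
    rw [h5, sub_self] at h4
    obtain ⟨h6, h7⟩ := indep2 heF (a := ((s + t) ^ 2 - n - p * (s ^ 2 - n)))
      (b := (-(2 * s + t) - p * (2 * s + t))) (by rw [h4]; simp only [map_sub, map_add, map_mul, map_pow])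
    have hp1 : p = -1 := by
      have : (p + 1) * (2 * s + t) = 0 := by linear_combination -h7
      exact eq_neg_of_add_eq_zero_left ((mul_eq_zero.1 this).resolve_right hs)
    subst hp1
    linear_combination h6
  by_cases h2 : (2 : F) = 0
  · have ht0 : t ≠ 0 := by
      rintro rfl
      apply hne
      have h22 : (2 : H) = 0 := by rw [← map_ofNat (algebraMap F H) 2, h2, map_zero]
      have : e + e = 0 := by rw [← two_mul, h22, zero_mul]
      rw [hbar, map_zero, zero_sub]
      exact (eq_neg_of_add_eq_zero_left this).symm
    have := key 0 (by simpa using ht0)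
    rw [h2] at this
    simp at this
    exact ht0 this
  · obtain ⟨s, hs⟩ := Infinite.exists_notMem_finset ({-t / 2} : Finset F)
    classical
    obtain ⟨r, hr⟩ := Infinite.exists_notMem_finset ({-t / 2, s, -s - t} : Finset F)
    simp only [Finset.mem_singleton, Finset.mem_insert, not_or] at hs hr
    have k1 := key s (fun h => hs (by field_simp; linear_combination h))
    have k2 := key r (fun h => hr.1 (by field_simp; linear_combination h))
    have k3 : 2 * ((r - s) * (r + s + t)) = 0 := by linear_combination k2 - k1
    rcases mul_eq_zero.1 ((mul_eq_zero.1 k3).resolve_left h2) with h | h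
    · exact hr.2.1 (sub_eq_zero.1 h)
    · exact hr.2.2 (by linear_combination h)

/-- Clifford-like parallelisms -/
structure Par (P : Submodule F H → Submodule F H → Prop) : Prop where
  lines : ∀ M N, P M N → Module.finrank F M = 2 ∧ Module.finrank F N = 2
  refl : ∀ M : Submodule F H, Module.finrank F M = 2 → P M M
  symm : ∀ M N, P M N → P N M
  trans : ∀ M N K, P M N → P N K → P M K
  par : ∀ x : H, x ≠ 0 → ∀ M : Submodule F H, Module.finrank F M = 2 →
      ∃! N : Submodule F H, x ∈ N ∧ P N M
  cl : ∀ M N, P M N → (∃ c : H, c ≠ 0 ∧ N = lm c M) ∨ (∃ c : H, c ≠ 0 ∧ N = rm c M)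

theorem Par.uniq {P : Submodule F H → Submodule F H → Prop} (hP : Par P) {x : H} (hx : x ≠ 0)
    {N N' L : Submodule F H} (h1 : x ∈ N) (h2 : x ∈ N') (h3 : P N L) (h4 : P N' L) : N = N' :=
  (hP.par x hx L (hP.lines _ _ h3).2).unique ⟨h1, h3⟩ ⟨h2, h4⟩

theorem lm_lm (a b : H) (L : Submodule F H) : lm a (lm b L) = lm (a * b) L := by
  apply SetLike.coe_injective
  simp only [coe_lm, Set.image_image, mul_assoc]

theorem rm_rm (a b : H) (L : Submodule F H) : rm a (rm b L) = rm (b * a) L := by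
  apply SetLike.coe_injective
  simp only [coe_rm, Set.image_image, mul_assoc]

theorem lm_rm (a b : H) (L : Submodule F H) : lm a (rm b L) = rm b (lm a L) := by
  apply SetLike.coe_injective
  simp only [coe_rm, coe_lm, Set.image_image, mul_assoc]

theorem lm_one (L : Submodule F H) : lm 1 L = L := by
  apply SetLike.coe_injective
  simp [coe_lm]

theorem rm_one (L : Submodule F H) : rm 1 L = L := by
  apply SetLike.coe_injective
  simp [coe_rm]

theorem lm_eq (q : Q F H) {L : Submodule F H} (hL : Ln L) {c x : H} (hc : c ≠ 0) (hx : x ≠ 0)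
    (h : x ∈ lm c L) : lm c L = lm x L := by
  rw [mem_lm hc] at h
  ext y
  rw [mem_lm hc, mem_lm hx]
  constructor
  · intro hy
    have := hL.mul q (hL.inv q h) hy
    simpa [mul_inv_rev, mul_assoc, mul_inv_cancel_left₀ hc] using this
  · intro hy
    have := hL.mul q h hy
    simpa [mul_assoc, mul_inv_cancel_left₀ hx] using this

theorem rm_eq (q : Q F H) {L : Submodule F H} (hL : Ln L) {c x : H} (hc : c ≠ 0) (hx : x ≠ 0)
    (h : x ∈ rm c L) : rm c L = rm x L := by
  rw [mem_rm hc] at h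
  ext y
  rw [mem_rm hc, mem_rm hx]
  constructor
  · intro hy
    have := hL.mul q hy (hL.inv q h)
    simpa [mul_inv_rev, mul_assoc, inv_mul_cancel_left₀ hc] using this
  · intro hy
    have := hL.mul q hy h
    simpa [mul_assoc, inv_mul_cancel_left₀ hx] using this

theorem self_lm {L : Submodule F H} (hL : Ln L) (x : H) : x ∈ lm x L :=
  ⟨1, hL.one, by simp⟩

theorem self_rm {L : Submodule F H} (hL : Ln L) (x : H) : x ∈ rm x L :=
  ⟨1, hL.one, by simp⟩

/-- the class of `L` is its left class -/
def LeftL (P : Submodule F H → Submodule F H → Prop) (L : Submodule F H) : Prop :=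
  ∀ x : H, x ≠ 0 → P (lm x L) L
/-- the class of `L` is its right class -/
def RightL (P : Submodule F H → Submodule F H → Prop) (L : Submodule F H) : Prop :=
  ∀ x : H, x ≠ 0 → P (rm x L) L

variable {P : Submodule F H → Submodule F H → Prop}

theorem dich0 (q : Q F H) (hP : Par P) {L : Submodule F H} (hL : Ln L) {x : H} (hx : x ≠ 0) :
    P (lm x L) L ∨ P (rm x L) L := by
  obtain ⟨N, ⟨h1, h2⟩, -⟩ := hP.par x hx L hL.rk
  rcases hP.cl _ _ (hP.symm _ _ h2) with ⟨c, hc, rfl⟩ | ⟨c, hc, rfl⟩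
  · left; rwa [← lm_eq q hL hc hx h1]
  · right; rwa [← rm_eq q hL hc hx h1]

theorem dich (q : Q F H) (hP : Par P) {L : Submodule F H} (hL : Ln L) :
    LeftL P L ∨ RightL P L := by
  by_contra! h
  unfold LeftL RightL at h
  push Not at h
  obtain ⟨⟨a, ha, hPa⟩, ⟨b, hb, hPb⟩⟩ := h
  have h1 := (dich0 q hP hL ha).resolve_left hPa
  have h2 := (dich0 q hP hL hb).resolve_right hPb
  rcases hP.cl _ _ (hP.trans _ _ _ h1 (hP.symm _ _ h2)) with ⟨d, hd, h3⟩ | ⟨d, hd, h3⟩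
  · have h4 : d * a ∈ lm b L := by
      rw [h3]; exact ⟨a, self_rm hL a, rfl⟩
    have h5 := lm_eq q hL hb (mul_ne_zero hd ha) h4
    rw [h3, ← lm_lm] at h5
    have h6 := congrArg (lm d⁻¹) h5
    rw [lm_lm, lm_lm, inv_mul_cancel₀ hd, lm_one, lm_one] at h6
    rw [h6] at h1
    exact hPa h1
  · rw [rm_rm] at h3
    have h4 := self_lm hL b
    rw [h3] at h4
    have h5 := rm_eq q hL (mul_ne_zero ha hd) hb h4
    rw [h3, h5] at h2
    exact hPb h2

/-- conjugate line -/
def cj (h : H) (L : Submodule F H) : Submodule F H := lm h (rm h⁻¹ L)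

theorem mem_cj {h : H} (h0 : h ≠ 0) {L : Submodule F H} {x : H} :
    x ∈ cj h L ↔ h⁻¹ * x * h ∈ L := by
  unfold cj
  rw [mem_lm h0, mem_rm (inv_ne_zero h0), inv_inv]

theorem Ln.cj {L : Submodule F H} (hL : Ln L) {h : H} (h0 : h ≠ 0) : Ln (cj h L) :=
  ⟨by unfold CL.cj; rw [finrank_lm h0, finrank_rm (inv_ne_zero h0), hL.rk],
   by rw [mem_cj h0, mul_one, inv_mul_cancel₀ h0]; exact hL.one⟩

theorem cj_left (q : Q F H) (hP : Par P) {L : Submodule F H} (hL : Ln L) (hl : LeftL P L)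
    {h : H} (h0 : h ≠ 0) : LeftL P (cj h L) := by
  rcases dich q hP (hL.cj h0) with hd | hd
  · exact hd
  · have h1 := hd h h0
    have h2 := hl h h0
    have h3 : rm h (cj h L) = lm h L := by
      unfold cj
      rw [← lm_rm, rm_rm, inv_mul_cancel₀ h0, rm_one]
    rw [h3] at h1
    have h4 := hP.uniq one_ne_zero (hL.cj h0).one hL.one
      (hP.trans _ _ _ (hP.symm _ _ h1) h2) (hP.refl _ hL.rk)
    rwa [h4]

theorem cj_right (q : Q F H) (hP : Par P) {L : Submodule F H} (hL : Ln L) (hl : RightL P L)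
    {h : H} (h0 : h ≠ 0) : RightL P (cj h L) := by
  rcases dich q hP (hL.cj h0) with hd | hd
  · have h1 := hd h⁻¹ (inv_ne_zero h0)
    have h2 := hl h⁻¹ (inv_ne_zero h0)
    have h3 : lm h⁻¹ (cj h L) = rm h⁻¹ L := by
      unfold cj
      rw [lm_lm, inv_mul_cancel₀ h0, lm_one]
    rw [h3] at h1
    have h4 := hP.uniq one_ne_zero (hL.cj h0).one hL.one
      (hP.trans _ _ _ (hP.symm _ _ h1) h2) (hP.refl _ hL.rk)
    rwa [h4]
  · exact hd

theorem all_left (q : Q F H) (hP : Par P) (h : ∀ L : Submodule F H, Ln L → LeftL P L)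
    (M N : Submodule F H) (hM : Module.finrank F M = 2) :
    P M N ↔ ∃ c : H, c ≠ 0 ∧ N = lm c M := by
  obtain ⟨L, ⟨h1, h2⟩, -⟩ := hP.par 1 one_ne_zero M hM
  have hL : Ln L := ⟨(hP.lines _ _ h2).1, h1⟩
  have hh := h L hL
  have key : ∀ K, P K L → ∃ x, x ≠ 0 ∧ K = lm x L := by
    intro K hK
    obtain ⟨x, hx, hxF⟩ := exists_gen q (hP.lines _ _ hK).1
    have x0 : x ≠ 0 := by rintro rfl; exact hxF ⟨0, by simp⟩
    exact ⟨x, x0, hP.uniq x0 hx (self_lm hL x) hK (hh x x0)⟩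
  obtain ⟨x, x0, rfl⟩ := key M (hP.symm _ _ h2)
  constructor
  · intro hMN
    obtain ⟨y, y0, rfl⟩ := key N (hP.trans _ _ _ (hP.symm _ _ hMN) (hP.symm _ _ h2))
    exact ⟨y * x⁻¹, mul_ne_zero y0 (inv_ne_zero x0), by rw [lm_lm, inv_mul_cancel_right₀ x0]⟩
  · rintro ⟨c, hc, rfl⟩
    rw [lm_lm]
    exact hP.trans _ _ _ (hh x x0) (hP.symm _ _ (hh (c * x) (mul_ne_zero hc x0)))

theorem all_right (q : Q F H) (hP : Par P) (h : ∀ L : Submodule F H, Ln L → RightL P L)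
    (M N : Submodule F H) (hM : Module.finrank F M = 2) :
    P M N ↔ ∃ c : H, c ≠ 0 ∧ N = rm c M := by
  obtain ⟨L, ⟨h1, h2⟩, -⟩ := hP.par 1 one_ne_zero M hM
  have hL : Ln L := ⟨(hP.lines _ _ h2).1, h1⟩
  have hh := h L hL
  have key : ∀ K, P K L → ∃ x, x ≠ 0 ∧ K = rm x L := by
    intro K hK
    obtain ⟨x, hx, hxF⟩ := exists_gen q (hP.lines _ _ hK).1
    have x0 : x ≠ 0 := by rintro rfl; exact hxF ⟨0, by simp⟩
    exact ⟨x, x0, hP.uniq x0 hx (self_rm hL x) hK (hh x x0)⟩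
  obtain ⟨x, x0, rfl⟩ := key M (hP.symm _ _ h2)
  constructor
  · intro hMN
    obtain ⟨y, y0, rfl⟩ := key N (hP.trans _ _ _ (hP.symm _ _ hMN) (hP.symm _ _ h2))
    exact ⟨x⁻¹ * y, mul_ne_zero (inv_ne_zero x0) y0, by rw [rm_rm, mul_inv_cancel_left₀ x0]⟩
  · rintro ⟨c, hc, rfl⟩
    rw [rm_rm]
    exact hP.trans _ _ _ (hh x x0) (hP.symm _ _ (hh (x * c) (mul_ne_zero x0 hc)))

/-- a bijection preserving the left spread of `L` is multiplicative on `L` -/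
theorem mult (q : Q F H) {L : Submodule F H} (hL : Ln L) (γ : H → H)
    (hadd : ∀ x y, γ (x + y) = γ x + γ y) (hinj : Function.Injective γ)
    (hsurj : Function.Surjective γ) (h1 : γ 1 = 1)
    (hs : ∀ x, x ≠ 0 → ∀ l ∈ L, ∃ l' ∈ L, γ (x * l) = γ x * l') (x : H) (e : H) (he : e ∈ L) :
    γ (x * e) = γ x * γ e := by
  have g0 : γ 0 = 0 := by have := hadd 0 0; simpa using this
  have gne : ∀ x, x ≠ 0 → γ x ≠ 0 := fun x hx h => hx (hinj (h.trans g0.symm))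
  have claim : ∀ x y p r, x ≠ 0 → y ≠ 0 → (γ x)⁻¹ * γ y ∉ L → p ∈ L → r ∈ L →
      γ (x * e) = γ x * p → γ (y * e) = γ y * r → p = r := by
    intro x y p r hx hy hn hp hr h2 h3
    have hxy : x + y ≠ 0 := by
      intro h
      apply hn
      have h4 := hadd x y
      rw [h, g0] at h4
      rw [eq_neg_of_add_eq_zero_right h4.symm, mul_neg, inv_mul_cancel₀ (gne x hx)]
      exact L.neg_mem hL.one
    obtain ⟨l, hl, h5⟩ := hs (x + y) hxy e he
    rw [add_mul, hadd, hadd, h2, h3, add_mul] at h5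
    have h6 : γ x * (p - l) = γ y * (l - r) := by
      rw [mul_sub, mul_sub, sub_eq_sub_iff_add_eq_add, h5, add_comm]
    have h7 : l - r = 0 := by
      by_contra h7
      apply hn
      have := hL.mul q (L.sub_mem hp hl) (hL.inv q (L.sub_mem hl hr))
      have h8 : p - l = (γ x)⁻¹ * γ y * (l - r) := by
        rw [mul_assoc, ← h6, inv_mul_cancel_left₀ (gne x hx)]
      rwa [h8, mul_inv_cancel_right₀ h7] at this
    rw [h7, mul_zero] at h6
    have h8 := (mul_eq_zero.1 h6).resolve_left (gne x hx)
    rw [sub_eq_zero] at h7 h8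
    rw [h8, h7]
  have heL : γ e ∈ L := by
    obtain ⟨l, hl, h⟩ := hs 1 one_ne_zero e he
    rw [one_mul, h1, one_mul] at h
    rwa [h]
  have base : γ (1 * e) = γ 1 * γ e := by rw [h1, one_mul, one_mul]
  have out : ∀ x, γ x ∉ L → γ (x * e) = γ x * γ e := by
    intro x hx
    have hx0 : x ≠ 0 := by rintro rfl; exact hx (by rw [g0]; exact L.zero_mem)
    obtain ⟨l, hl, h⟩ := hs x hx0 e he
    rw [claim 1 x (γ e) l one_ne_zero hx0 (by simpa [h1] using hx) heL hl base h, h]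
  by_cases hx : γ x ∈ L
  · by_cases hx0 : x = 0
    · subst hx0; simp [g0]
    obtain ⟨z, hz⟩ := exists_notMem q hL.rk
    obtain ⟨w, rfl⟩ := hsurj z
    have hw0 : w ≠ 0 := by rintro rfl; exact hz (by rw [g0]; exact L.zero_mem)
    obtain ⟨l, hl, h⟩ := hs x hx0 e he
    rw [h, claim x w l (γ e) hx0 hw0 ?_ hl heL h (out w hz)]
    intro hn
    apply hz
    have := hL.mul q hx hn
    rwa [mul_inv_cancel_left₀ (gne x hx0)] at this
  · exact out x hx

theorem gamma_scalar (q : Q F H) {L : Submodule F H} (hL : Ln L) (γ : H → H)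
    (hadd : ∀ x y, γ (x + y) = γ x + γ y) (hinj : Function.Injective γ)
    (hsurj : Function.Surjective γ) (h1 : γ 1 = 1)
    (hs : ∀ g, g ≠ 0 → ∀ x, x ≠ 0 → ∀ l, l ∈ cj g L ↔ (γ x)⁻¹ * γ (x * l) ∈ cj g L) (h : H)
    (h0 : h ≠ 0) : IsF F (h⁻¹ * γ h) := by
  have g0 : γ 0 = 0 := by have := hadd 0 0; simpa using this
  have gne : ∀ x, x ≠ 0 → γ x ≠ 0 := fun x hx h => hx (hinj (h.trans g0.symm))
  have hm : ∀ g, g ≠ 0 → ∀ x e, e ∈ cj g L → γ (x * e) = γ x * γ e := by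
    intro g hg x e he
    refine mult q (hL.cj hg) γ hadd hinj hsurj h1 ?_ x e he
    intro x hx l hl
    exact ⟨_, (hs g hg x hx l).1 hl, by rw [mul_inv_cancel_left₀ (gne x hx)]⟩
  have hm1 : ∀ x e, e ∈ L → γ (x * e) = γ x * γ e := by
    intro x e he
    exact hm 1 one_ne_zero x e (by rw [mem_cj one_ne_zero]; simpa using he)
  obtain ⟨e, he, heF⟩ := exists_gen q hL.rk
  obtain ⟨g, hg, hf⟩ := exists_conj q hL heF
  have hfm : ∀ x, γ (x * (g * e * g⁻¹)) = γ x * γ (g * e * g⁻¹) := by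
    intro x
    apply hm g hg
    rw [mem_cj hg]
    simpa [mul_assoc, inv_mul_cancel_left₀ hg, inv_mul_cancel₀ hg] using he
  generalize g * e * g⁻¹ = f at hf hfm
  have hmul : ∀ x y, γ (x * y) = γ x * γ y := by
    intro x y
    obtain ⟨a, ha, b, hb, rfl⟩ := hL.decomp q hf y
    rw [mul_add, hadd, ← mul_assoc, hfm, hm1 x a ha, hm1 x b hb, hadd, hfm, mul_add, mul_assoc]
  have hfix : ∀ g, g ≠ 0 → ∀ x, g⁻¹ * x * g ∈ L ↔ g⁻¹ * γ x * g ∈ L := by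
    intro g hg x
    have := hs g hg 1 one_ne_zero x
    rw [h1, inv_one, one_mul, one_mul, mem_cj hg, mem_cj hg] at this
    exact this
  have hinv : ∀ x, x ≠ 0 → γ x⁻¹ = (γ x)⁻¹ := by
    intro x hx
    apply eq_inv_of_mul_eq_one_left
    rw [← hmul, inv_mul_cancel₀ hx, h1]
  apply KK_isF q hL
  refine ⟨mul_ne_zero (inv_ne_zero h0) (gne h h0), ?_⟩
  intro g hg x
  obtain ⟨y, hy⟩ := hsurj (g * x * g⁻¹)
  have a1 := hfix g hg y
  have a2 := hfix (h * g) (mul_ne_zero h0 hg) (h * y * h⁻¹)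
  rw [hmul, hmul, hinv h h0, hy] at a2
  rw [hy] at a1
  simp only [mul_inv_rev, mul_assoc, inv_mul_cancel_left₀ hg, inv_mul_cancel_left₀ h0,
    inv_mul_cancel₀ hg, mul_one, inv_inv] at a1 a2 ⊢
  rw [← a1, a2]

theorem main_ba (q : Q F H) (hP : Par P) (σ : F ≃+* F) (β : H ≃+ H)
    (hsemi : ∀ (a : F) (x : H), β (a • x) = σ a • β x)
    (hst : ∀ M : Submodule F H, Module.finrank F M = 2 → ∃ M' : Submodule F H,
        (M' : Set H) = ⇑β '' (M : Set H) ∧ P M' M)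
    {L R : Submodule F H} (hL : Ln L) (hR : Ln R) (hl : LeftL P L) (hr : RightL P R) (x : H) :
    ∃ a : F, β x = a • x := by
  have bne : ∀ x, x ≠ 0 → β x ≠ 0 := fun x hx => by simpa using hx
  have hc0 := bne 1 one_ne_zero
  have hleft : ∀ g, g ≠ 0 → ∀ x, x ≠ 0 → ∀ l, l ∈ cj g L ↔ (β x)⁻¹ * β (x * l) ∈ cj g L := by
    intro g hg x hx l
    have hLg := hL.cj hg
    have hlg := cj_left q hP hL hl hg
    obtain ⟨M, hM, hPM⟩ := hst (lm x (cj g L)) (by rw [finrank_lm hx, hLg.rk])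
    have memM : ∀ y, β y ∈ M ↔ y ∈ lm x (cj g L) := by
      intro y
      rw [← SetLike.mem_coe, hM, β.injective.mem_set_image, SetLike.mem_coe]
    have hMe : M = lm (β x) (cj g L) :=
      hP.uniq (bne x hx) ((memM x).2 (self_lm hLg x)) (self_lm hLg _)
        (hP.trans _ _ _ hPM (hlg x hx)) (hlg _ (bne x hx))
    have := memM (x * l)
    rw [mem_lm hx, inv_mul_cancel_left₀ hx, hMe, mem_lm (bne x hx)] at this
    exact this.symm
  have hsc : ∀ h, h ≠ 0 → IsF F (h⁻¹ * ((β 1)⁻¹ * β h)) := by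
    intro h h0
    refine gamma_scalar q hL (fun x => (β 1)⁻¹ * β x) ?_ ?_ ?_ ?_ ?_ h h0
    · intro x y; simp [mul_add]
    · intro x y hxy
      exact β.injective (mul_left_cancel₀ (inv_ne_zero hc0) hxy)
    · intro y
      obtain ⟨x, hx⟩ := β.surjective (β 1 * y)
      exact ⟨x, by simp [hx, inv_mul_cancel_left₀ hc0]⟩
    · simp [inv_mul_cancel₀ hc0]
    · intro g hg x hx l
      rw [hleft g hg x hx l]
      simp only [mul_inv_rev, inv_inv, mul_assoc, mul_inv_cancel_left₀ hc0]
  have hb : ∀ h, h ≠ 0 → ∃ a : F, a ≠ 0 ∧ β h = a • (β 1 * h) := by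
    intro h h0
    obtain ⟨a, ha⟩ := hsc h h0
    have e1 : β h = a • (β 1 * h) := by
      rw [Algebra.smul_def, Algebra.commutes, ← ha]
      simp only [mul_assoc, mul_inv_cancel_left₀ h0, mul_inv_cancel_left₀ hc0]
    refine ⟨a, ?_, e1⟩
    rintro rfl
    rw [zero_smul] at e1
    exact bne h h0 e1
  have hcF : IsF F (β 1) := by
    apply KK_isF q hR
    refine ⟨hc0, fun g hg x => ?_⟩
    by_cases hx0 : x = 0
    · subst hx0; simp
    have hRg := hR.cj hg
    have hrg := cj_right q hP hR hr hg
    obtain ⟨M, hM, hPM⟩ := hst (cj g R) hRg.rk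
    have memM : ∀ y, β y ∈ M ↔ y ∈ cj g R := by
      intro y
      rw [← SetLike.mem_coe, hM, β.injective.mem_set_image, SetLike.mem_coe]
    have hMe : M = rm (β 1) (cj g R) :=
      hP.uniq hc0 ((memM 1).2 hRg.one) (self_rm hRg _) hPM (hrg _ hc0)
    have h3 := memM (g * x * g⁻¹)
    have hz : g * x * g⁻¹ ≠ 0 := mul_ne_zero (mul_ne_zero hg hx0) (inv_ne_zero hg)
    obtain ⟨a, ha, h4⟩ := hb _ hz
    rw [h4, hMe, mem_rm hc0, smul_mul_assoc, Submodule.smul_mem_iff _ ha, mem_cj hg, mem_cj hg] at h3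
    simp only [mul_inv_rev, mul_assoc, inv_mul_cancel_left₀ hg, 
      inv_mul_cancel₀ hg, mul_one, inv_inv] at h3 ⊢
    exact h3.symm
  obtain ⟨b, hb'⟩ := hcF
  by_cases hx : x = 0
  · exact ⟨0, by simp [hx]⟩
  obtain ⟨a, -, h⟩ := hb x hx
  exact ⟨a * b, by rw [h, hb', ← Algebra.smul_def, smul_smul]⟩

theorem exists_notF (q : Q F H) : ∃ c : H, ¬ IsF F c := by
  by_contra! h
  have hle : (⊤ : Submodule F H) ≤ Submodule.span F {(1 : H)} := by
    intro x _
    obtain ⟨a, rfl⟩ := h x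
    rw [Submodule.mem_span_singleton]
    exact ⟨a, by rw [Algebra.algebraMap_eq_smul_one]⟩
  have := q.fd
  have h3 := Submodule.finrank_mono hle
  rw [finrank_span_singleton one_ne_zero, finrank_top, q.rank] at h3
  omega

end
end CL

/-- Let `H` be a quaternion skew field with centre `F` and let
`P` be a Clifford-like parallelism of the projective double space
`(P(H_F), ∥ₗ, ∥ᵣ)` (an equivalence relation on lines, i.e. `2`-dimensional
`F`-subspaces of `H`, such that through every point there is a unique line of
each parallel class, and parallel lines are always left or right parallel).
Then the following are equivalent:
(a) `P` coincides with the left or with the right Clifford parallelism;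
(b) `P` admits an automorphism `β` (an additive bijection of `H`, semilinear
with respect to some automorphism `σ` of `F`, mapping `P`-parallel lines to
`P`-parallel lines) which stabilises every parallel class of `P` (`β(M) ∥ M`
for each line `M`) and acts as a non-identical collineation on `P(H_F)`
(some `x ≠ 0` has `β x ∉ F·x`). -/
theorem stmt_12 {F H : Type*} [Field F] [DivisionRing H] [Algebra F H]
    (hrank : Module.finrank F H = 4)
    (hcenter : ∀ z : H, z ∈ Subring.center H ↔ ∃ a : F, z = algebraMap F H a)
    (P : Submodule F H → Submodule F H → Prop)
    (hlines : ∀ M N, P M N → Module.finrank F M = 2 ∧ Module.finrank F N = 2)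
    (hrefl : ∀ M : Submodule F H, Module.finrank F M = 2 → P M M)
    (hsymm : ∀ M N, P M N → P N M)
    (htrans : ∀ M N K, P M N → P N K → P M K)
    (hpar : ∀ x : H, x ≠ 0 → ∀ M : Submodule F H, Module.finrank F M = 2 →
      ∃! N : Submodule F H, x ∈ N ∧ P N M)
    (hCL : ∀ M N, P M N →
      (∃ c : H, c ≠ 0 ∧ (N : Set H) = (fun y => c * y) '' (M : Set H)) ∨
      (∃ c : H, c ≠ 0 ∧ (N : Set H) = (fun y => y * c) '' (M : Set H))) :
    ((∀ M N : Submodule F H, Module.finrank F M = 2 → Module.finrank F N = 2 →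
        (P M N ↔ ∃ c : H, c ≠ 0 ∧ (N : Set H) = (fun y => c * y) '' (M : Set H))) ∨
     (∀ M N : Submodule F H, Module.finrank F M = 2 → Module.finrank F N = 2 →
        (P M N ↔ ∃ c : H, c ≠ 0 ∧ (N : Set H) = (fun y => y * c) '' (M : Set H))))
    ↔
    (∃ (σ : F ≃+* F) (β : H ≃+ H),
      (∀ (a : F) (x : H), β (a • x) = σ a • β x) ∧
      (∀ M N : Submodule F H, P M N → ∃ M' N' : Submodule F H,
        (M' : Set H) = ⇑β '' (M : Set H) ∧ (N' : Set H) = ⇑β '' (N : Set H) ∧ P M' N') ∧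
      (∀ M : Submodule F H, Module.finrank F M = 2 → ∃ M' : Submodule F H,
        (M' : Set H) = ⇑β '' (M : Set H) ∧ P M' M) ∧
      (∃ x : H, x ≠ 0 ∧ ∀ a : F, β x ≠ a • x)) := by
  have q : CL.Q F H := ⟨hrank, fun z hz => (hcenter z).1 (Subring.mem_center_iff.2 hz)⟩
  have eL : ∀ (M N : Submodule F H) (c : H),
      (N : Set H) = (fun y => c * y) '' (M : Set H) ↔ N = CL.lm c M := by
    intro M N c
    rw [← CL.coe_lm, SetLike.coe_set_eq]
  have eR : ∀ (M N : Submodule F H) (c : H),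
      (N : Set H) = (fun y => y * c) '' (M : Set H) ↔ N = CL.rm c M := by
    intro M N c
    rw [← CL.coe_rm, SetLike.coe_set_eq]
  simp only [eL, eR] at hCL ⊢
  have hP : CL.Par P := ⟨hlines, hrefl, hsymm, htrans, hpar, hCL⟩
  constructor
  · obtain ⟨c, hc⟩ := CL.exists_notF q
    have c0 : c ≠ 0 := by rintro rfl; exact hc ⟨0, by simp⟩
    rintro (h | h)
    · let β : H ≃+ H :=
        { toFun := fun x => c * x
          invFun := fun x => c⁻¹ * x
          left_inv := fun x => inv_mul_cancel_left₀ c0 x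
          right_inv := fun x => mul_inv_cancel_left₀ c0 x
          map_add' := fun x y => mul_add c x y }
      have hβ : ∀ x, β x = c * x := fun _ => rfl
      refine ⟨RingEquiv.refl F, β, ?_, ?_, ?_, 1, one_ne_zero, ?_⟩
      · intro a x
        simp [hβ]
      · intro M N hMN
        refine ⟨CL.lm c M, CL.lm c N, rfl, rfl, ?_⟩
        obtain ⟨r1, r2⟩ := hlines _ _ hMN
        obtain ⟨d, d0, rfl⟩ := (h M N r1 r2).1 hMN
        rw [h _ _ (by rw [CL.finrank_lm c0, r1]) (by rw [CL.finrank_lm c0, r2])]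
        refine ⟨c * d * c⁻¹, mul_ne_zero (mul_ne_zero c0 d0) (inv_ne_zero c0), ?_⟩
        rw [CL.lm_lm, CL.lm_lm, inv_mul_cancel_right₀ c0]
      · intro M hM
        refine ⟨CL.lm c M, rfl, hsymm _ _ ?_⟩
        rw [h _ _ hM (by rw [CL.finrank_lm c0, hM])]
        exact ⟨c, c0, rfl⟩
      · intro a ha
        rw [hβ, mul_one] at ha
        exact hc ⟨a, by rw [ha, Algebra.algebraMap_eq_smul_one]⟩
    · let β : H ≃+ H :=
        { toFun := fun x => x * c
          invFun := fun x => x * c⁻¹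
          left_inv := fun x => mul_inv_cancel_right₀ c0 x
          right_inv := fun x => inv_mul_cancel_right₀ c0 x
          map_add' := fun x y => add_mul x y c }
      have hβ : ∀ x, β x = x * c := fun _ => rfl
      refine ⟨RingEquiv.refl F, β, ?_, ?_, ?_, 1, one_ne_zero, ?_⟩
      · intro a x
        simp [hβ]
      · intro M N hMN
        refine ⟨CL.rm c M, CL.rm c N, rfl, rfl, ?_⟩
        obtain ⟨r1, r2⟩ := hlines _ _ hMN
        obtain ⟨d, d0, rfl⟩ := (h M N r1 r2).1 hMN
        rw [h _ _ (by rw [CL.finrank_rm c0, r1]) (by rw [CL.finrank_rm c0, r2])]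
        refine ⟨c⁻¹ * d * c, mul_ne_zero (mul_ne_zero (inv_ne_zero c0) d0) c0, ?_⟩
        rw [CL.rm_rm, CL.rm_rm, mul_assoc c⁻¹, mul_inv_cancel_left₀ c0]
      · intro M hM
        refine ⟨CL.rm c M, rfl, hsymm _ _ ?_⟩
        rw [h _ _ hM (by rw [CL.finrank_rm c0, hM])]
        exact ⟨c, c0, rfl⟩
      · intro a ha
        rw [hβ, one_mul] at ha
        exact hc ⟨a, by rw [ha, Algebra.algebraMap_eq_smul_one]⟩
  · rintro ⟨σ, β, hsemi, -, hst, x, -, hx⟩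
    by_cases h1 : ∀ L : Submodule F H, CL.Ln L → CL.LeftL P L
    · left
      intro M N hM _
      exact CL.all_left q hP h1 M N hM
    by_cases h2 : ∀ L : Submodule F H, CL.Ln L → CL.RightL P L
    · right
      intro M N hM _
      exact CL.all_right q hP h2 M N hM
    exfalso
    push Not at h1 h2
    obtain ⟨R, hR, hR'⟩ := h1
    obtain ⟨L, hL, hL'⟩ := h2
    obtain ⟨a, ha⟩ := CL.main_ba q hP σ β hsemi hst hL hR ((CL.dich q hP hL).resolve_right hL')
      ((CL.dich q hP hR).resolve_left hR') x
    exact hx a ha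
end

section
/- Let H be a quaternion skew field with centre F (so that ∥ₗ ≠ ∥ᵣ) and let ∥ be a Clifford-like parallelism of (P(H_F), ∥ₗ, ∥ᵣ). Then the following are equivalent: (a) ∥ = ∥ₗ or ∥ = ∥ᵣ (i.e. ∥ is a Clifford parallelism); (b) there exists an automorphism β of ∥ that stabilises exactly one parallel class of ∥ and fixes all lines of that class: there is a line L with β(N) = N for every line N ∥ L, while for every line M with ¬(M ∥ L) the class S(M) = {N : N ∥ M} is not stabilised by β (i.e. β(N) is not ∥-parallel to M for some N ∥ M). -/
section Aux
variable {F H : Type*} [Field F] [DivisionRing H] [Algebra F H]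

def LPar (M N : Submodule F H) : Prop :=
  ∃ c : H, c ≠ 0 ∧ (N : Set H) = (fun y => c * y) '' (M : Set H)

def RPar (M N : Submodule F H) : Prop :=
  ∃ c : H, c ≠ 0 ∧ (N : Set H) = (fun y => y * c) '' (M : Set H)

theorem LPar.mem {M N : Submodule F H} (h : LPar M N) :
    ∃ c : H, c ≠ 0 ∧ ∀ x, x ∈ N ↔ c⁻¹ * x ∈ M := by
  obtain ⟨c, hc, h⟩ := h
  refine ⟨c, hc, fun x => ?_⟩
  rw [← SetLike.mem_coe, h]
  constructor
  · rintro ⟨y, hy, rfl⟩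
    simpa [hc] using hy
  · intro hx
    exact ⟨_, hx, by simp [hc]⟩

theorem RPar.mem {M N : Submodule F H} (h : RPar M N) :
    ∃ c : H, c ≠ 0 ∧ ∀ x, x ∈ N ↔ x * c⁻¹ ∈ M := by
  obtain ⟨c, hc, h⟩ := h
  refine ⟨c, hc, fun x => ?_⟩
  rw [← SetLike.mem_coe, h]
  constructor
  · rintro ⟨y, hy, rfl⟩
    simpa [hc] using hy
  · intro hx
    exact ⟨_, hx, by simp [hc]⟩

theorem LPar.of_mem {M N : Submodule F H} {c : H} (hc : c ≠ 0)
    (h : ∀ x, x ∈ N ↔ c⁻¹ * x ∈ M) : LPar M N := by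
  refine ⟨c, hc, ?_⟩
  ext x
  rw [SetLike.mem_coe, h]
  constructor
  · intro hx
    exact ⟨_, hx, by simp [hc]⟩
  · rintro ⟨y, hy, rfl⟩
    simpa [hc] using hy

theorem RPar.of_mem {M N : Submodule F H} {c : H} (hc : c ≠ 0)
    (h : ∀ x, x ∈ N ↔ x * c⁻¹ ∈ M) : RPar M N := by
  refine ⟨c, hc, ?_⟩
  ext x
  rw [SetLike.mem_coe, h]
  constructor
  · intro hx
    exact ⟨_, hx, by simp [hc]⟩
  · rintro ⟨y, hy, rfl⟩
    simpa [hc] using hy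

theorem LPar.symm {M N : Submodule F H} (h : LPar M N) : LPar N M := by
  obtain ⟨c, hc, h⟩ := h.mem
  exact LPar.of_mem (inv_ne_zero hc) fun x => by rw [h]; simp [hc]

theorem RPar.symm {M N : Submodule F H} (h : RPar M N) : RPar N M := by
  obtain ⟨c, hc, h⟩ := h.mem
  exact RPar.of_mem (inv_ne_zero hc) fun x => by rw [h]; simp [hc]

theorem LPar.trans {M N K : Submodule F H} (h : LPar M N) (h' : LPar N K) : LPar M K := by
  obtain ⟨c, hc, h⟩ := h.mem
  obtain ⟨d, hd, h'⟩ := h'.mem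
  exact LPar.of_mem (mul_ne_zero hd hc) fun x => by rw [h', h]; simp [mul_assoc]

theorem RPar.trans {M N K : Submodule F H} (h : RPar M N) (h' : RPar N K) : RPar M K := by
  obtain ⟨c, hc, h⟩ := h.mem
  obtain ⟨d, hd, h'⟩ := h'.mem
  exact RPar.of_mem (mul_ne_zero hc hd) fun x => by rw [h', h]; simp [mul_assoc]

/-- left translate of a subspace -/
def lt (c : H) (M : Submodule F H) : Submodule F H := M.map (LinearMap.mulLeft F c)
/-- right translate of a subspace -/
def rt (c : H) (M : Submodule F H) : Submodule F H := M.map (LinearMap.mulRight F c)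

theorem lt_coe (c : H) (M : Submodule F H) :
    (lt c M : Set H) = (fun y => c * y) '' (M : Set H) := by
  ext x; simp [lt]
theorem rt_coe (c : H) (M : Submodule F H) :
    (rt c M : Set H) = (fun y => y * c) '' (M : Set H) := by
  ext x; simp [rt]

theorem lt_lpar {c : H} (hc : c ≠ 0) (M : Submodule F H) : LPar M (lt c M) := ⟨c, hc, lt_coe c M⟩
theorem rt_rpar {c : H} (hc : c ≠ 0) (M : Submodule F H) : RPar M (rt c M) := ⟨c, hc, rt_coe c M⟩

theorem lt_finrank {c : H} (hc : c ≠ 0) (M : Submodule F H) :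
    Module.finrank F (lt c M) = Module.finrank F M :=
  (Submodule.equivMapOfInjective (LinearMap.mulLeft F c)
    (fun x y h => mul_left_cancel₀ hc (by simpa using h)) M).finrank_eq.symm
theorem rt_finrank {c : H} (hc : c ≠ 0) (M : Submodule F H) :
    Module.finrank F (rt c M) = Module.finrank F M :=
  (Submodule.equivMapOfInjective (LinearMap.mulRight F c)
    (fun x y h => mul_right_cancel₀ hc (by simpa using h)) M).finrank_eq.symm

theorem finrank_pair_s13 {e : H} (he : ∀ a : F, e ≠ algebraMap F H a) :
    Module.finrank F (Submodule.span F {1, e}) = 2 := by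
  have hli : LinearIndependent F ![(1 : H), e] := by
    rw [LinearIndependent.pair_iff]
    intro s t hst
    have ht : t = 0 := by
      by_contra ht
      apply he (-(t⁻¹ * s))
      have : e = t⁻¹ • (t • e) := by rw [smul_smul, inv_mul_cancel₀ ht, one_smul]
      rw [this, eq_neg_of_add_eq_zero_right hst, Algebra.algebraMap_eq_smul_one]
      simp [smul_smul]
    subst ht
    simpa using hst
  have := finrank_span_eq_card hli
  have hs : Set.range ![(1 : H), e] = {1, e} := by
    ext x
    simp [eq_comm, or_comm]
  rw [hs, Fintype.card_fin] at this
  exact this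

theorem cent_span (hrank : Module.finrank F H = 4)
    (hcenter : ∀ z : H, z ∈ Subring.center H ↔ ∃ a : F, z = algebraMap F H a)
    {e : H} (he : ∀ a : F, e ≠ algebraMap F H a) (x : H) :
    x ∈ Submodule.span F {1, e} ↔ x * e = e * x := by
  have : FiniteDimensional F H := Module.finite_of_finrank_pos (by omega)
  let C : Submodule F H := Subalgebra.toSubmodule (Subalgebra.centralizer F {e})
  have hC : ∀ x, x ∈ C ↔ x * e = e * x := by
    intro x
    simp [C, Subalgebra.mem_centralizer_iff, eq_comm]
  have hle : Submodule.span F {1, e} ≤ C := by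
    rw [Submodule.span_le]
    rintro y (rfl | rfl) <;> simp [hC]
  have h2 : Module.finrank F C ≤ 2 := by
    by_contra h3
    obtain ⟨y, hy⟩ : ∃ y, y * e ≠ e * y := by
      by_contra hcon
      push Not at hcon
      obtain ⟨a, ha⟩ := (hcenter e).1 (Subring.mem_center_iff.2 hcon)
      exact he a ha
    have hy0 : y ≠ 0 := by rintro rfl; simp at hy
    have hdis : ¬ Disjoint C (lt y C) := by
      intro hd
      have := Submodule.finrank_add_finrank_le_of_disjoint hd
      rw [lt_finrank hy0] at this
      omega
    apply hdis
    rw [Submodule.disjoint_def]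
    intro z hz hz'
    rw [← SetLike.mem_coe, lt_coe] at hz'
    obtain ⟨c, hc, rfl⟩ := hz'
    by_contra hne
    have hc0 : c ≠ 0 := by rintro rfl; simp at hne
    rw [SetLike.mem_coe, hC] at hc
    rw [hC] at hz
    simp only at hz
    apply hy
    apply mul_right_cancel₀ hc0
    rw [mul_assoc, ← hc, ← mul_assoc, hz, mul_assoc]
  rw [Submodule.eq_of_le_of_finrank_le hle (by rw [finrank_pair_s13 he]; exact h2), hC]

theorem line_field (hrank : Module.finrank F H = 4)
    (hcenter : ∀ z : H, z ∈ Subring.center H ↔ ∃ a : F, z = algebraMap F H a)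
    {M : Submodule F H} (hM : Module.finrank F M = 2) (h1 : (1 : H) ∈ M) :
    ∃ m : H, (∀ x, x ∈ M ↔ x * m = m * x) := by
  have : FiniteDimensional F H := Module.finite_of_finrank_pos (by omega)
  obtain ⟨m, hm, hm'⟩ : ∃ m ∈ M, m ∉ Submodule.span F {(1 : H)} := by
    by_contra hcon
    push Not at hcon
    have := Submodule.finrank_mono (R := F) (s := M) (t := Submodule.span F {(1 : H)}) hcon
    rw [finrank_span_singleton one_ne_zero] at this
    omega
  have hm2 : ∀ a : F, m ≠ algebraMap F H a := by
    rintro a rfl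
    exact hm' (Submodule.mem_span_singleton.2 ⟨a, (Algebra.algebraMap_eq_smul_one a).symm⟩)
  refine ⟨m, fun x => ?_⟩
  rw [← cent_span hrank hcenter hm2]
  have hle : Submodule.span F {1, m} ≤ M := by
    rw [Submodule.span_le]
    rintro y (rfl | rfl) <;> assumption
  rw [Submodule.eq_of_le_of_finrank_le hle (by rw [finrank_pair_s13 hm2, hM])]

theorem line_mul (hrank : Module.finrank F H = 4)
    (hcenter : ∀ z : H, z ∈ Subring.center H ↔ ∃ a : F, z = algebraMap F H a)
    {M : Submodule F H} (hM : Module.finrank F M = 2) (h1 : (1 : H) ∈ M) :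
    (∀ x ∈ M, ∀ y ∈ M, x * y ∈ M) ∧ (∀ x ∈ M, x⁻¹ ∈ M) := by
  obtain ⟨m, hm⟩ := line_field hrank hcenter hM h1
  constructor
  · intro x hx y hy
    rw [hm] at *
    rw [mul_assoc, hy, ← mul_assoc, hx, mul_assoc]
  · intro x hx
    rw [hm] at *
    exact (Commute.inv_left₀ (show Commute x m from hx))

theorem exists_sq (hrank : Module.finrank F H = 4)
    (hcenter : ∀ z : H, z ∈ Subring.center H ↔ ∃ a : F, z = algebraMap F H a) :
    ∃ e : H, (∀ a : F, e ≠ algebraMap F H a) ∧ (∀ a : F, e * e ≠ algebraMap F H a) := by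
  suffices h : ∃ e : H, (∀ a : F, e * e ≠ algebraMap F H a) by
    obtain ⟨e, he⟩ := h
    refine ⟨e, ?_, he⟩
    rintro a rfl
    exact he (a * a) (by simp)
  by_contra hcon
  push Not at hcon
  have hsq : ∀ x y : H, x * x * y = y * (x * x) := fun x y =>
    ((Subring.mem_center_iff.1 ((hcenter _).2 (hcon x))) y).symm
  have hpol : ∀ x y z : H, (x * y + y * x) * z = z * (x * y + y * x) := by
    intro x y z
    have h1 := hsq (x + y) z
    have h2 := hsq x z
    have h3 := hsq y z
    have e1 : (x + y) * (x + y) = x * x + y * y + (x * y + y * x) := by noncomm_ring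
    rw [e1, add_mul, mul_add, add_mul (x*x), mul_add z (x*x), h2, h3] at h1
    exact add_left_cancel h1
  have h2 : ∀ y z : H, (y + y) * z = z * (y + y) := by
    intro y z; simpa using hpol 1 y z
  -- the ring is commutative
  have hcomm : ∀ x y : H, x * y = y * x := by
    by_cases hc : (2 : H) = 0
    · intro x y
      by_contra hne
      have hxx : ∀ w : H, w + w = 0 := fun w => by rw [← two_mul, hc, zero_mul]
      have ht : x * y + y * x ≠ 0 := by
        intro h
        apply hne
        have := eq_neg_of_add_eq_zero_left h
        rw [this, neg_eq_iff_add_eq_zero, hxx]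
      have k1 := hpol x (x * y) y
      have k2 := hpol x y y
      have e1 : x * (x * y) + x * y * x = x * (x * y + y * x) := by noncomm_ring
      rw [e1, mul_assoc, k2, ← mul_assoc, ← mul_assoc] at k1
      exact hne (mul_right_cancel₀ ht k1)
    · intro x y
      have := h2 x y
      rw [← two_mul, mul_assoc, ← mul_assoc y, ← (Commute.ofNat_left 2 y).eq, mul_assoc] at this
      exact mul_left_cancel₀ hc this
  have htop : Module.finrank F (⊤ : Submodule F H) = 4 := by rw [finrank_top, hrank]
  have : (⊤ : Submodule F H) ≤ Submodule.span F {(1 : H)} := by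
    intro x _
    obtain ⟨a, rfl⟩ := (hcenter x).1 (Subring.mem_center_iff.2 fun y => hcomm y x)
    exact Submodule.mem_span_singleton.2 ⟨a, (Algebra.algebraMap_eq_smul_one a).symm⟩
  have := Submodule.finrank_mono (R := F) this
  rw [finrank_span_singleton one_ne_zero] at this
  omega

/-- A non-central element with non-central square normalising a maximal subfield lies in it. -/
theorem norm_mem (hrank : Module.finrank F H = 4)
    (hcenter : ∀ z : H, z ∈ Subring.center H ↔ ∃ a : F, z = algebraMap F H a)
    {M : Submodule F H} (hM : Module.finrank F M = 2) (h1 : (1 : H) ∈ M)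
    {e : H} (he : ∀ a : F, e ≠ algebraMap F H a) (he2 : ∀ a : F, e * e ≠ algebraMap F H a)
    (hn : ∀ x ∈ M, e * x * e⁻¹ ∈ M) : e ∈ M := by
  have he0 : e ≠ 0 := by rintro rfl; exact he 0 (by simp)
  obtain ⟨hmul, hinv⟩ := line_mul hrank hcenter hM h1
  obtain ⟨m, hm⟩ := line_field hrank hcenter hM h1
  have hmM : m ∈ M := (hm m).2 rfl
  by_contra hne
  have hsp : e * e ∈ Submodule.span F {1, e} :=
    (cent_span hrank hcenter he _).2 (mul_assoc _ _ _)
  obtain ⟨a, b, hab⟩ := Submodule.mem_span_pair.1 hsp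
  obtain ⟨m', hm', hk⟩ : ∃ m' ∈ M, e * m = m' * e := ⟨_, hn m hmM, by simp [he0]⟩
  obtain ⟨m'', hm'', hk'⟩ : ∃ m'' ∈ M, e * m' = m'' * e := ⟨_, hn m' hm', by simp [he0]⟩
  have hee : e * e * m = m'' * (e * e) := by
    rw [mul_assoc, hk, ← mul_assoc, hk', mul_assoc]
  have h3 : (b • m' - b • m'') * e = a • m'' - a • m := by
    rw [← hab] at hee
    simp only [add_mul, mul_add, smul_mul_assoc, mul_smul_comm, one_mul, mul_one, hk] at hee
    rw [sub_mul, smul_mul_assoc, smul_mul_assoc, sub_eq_sub_iff_add_eq_add, add_comm, hee]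
  have hcoef : b • m' - b • m'' = 0 := by
    by_contra h0
    apply hne
    have : e = (b • m' - b • m'')⁻¹ * (a • m'' - a • m) := by rw [← h3]; simp [h0]
    rw [this]
    exact hmul _ (hinv _ (M.sub_mem (M.smul_mem _ hm') (M.smul_mem _ hm''))) _
      (M.sub_mem (M.smul_mem _ hm'') (M.smul_mem _ hmM))
  have hb : b ≠ 0 := by
    rintro rfl
    apply he2 a
    rw [← hab, Algebra.algebraMap_eq_smul_one]; simp
  have ha : a ≠ 0 := by
    rintro rfl
    apply he b
    apply mul_right_cancel₀ he0
    rw [← hab, Algebra.algebraMap_eq_smul_one]; simp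
  rw [hcoef, zero_mul] at h3
  have e1 : m' = m'' := smul_right_injective H hb (sub_eq_zero.1 hcoef)
  have e2 : m'' = m := smul_right_injective H ha (sub_eq_zero.1 h3.symm)
  apply hne
  rw [hm, hk, e1, e2]

theorem beta_left {M : Submodule F H} (hMtop : ∃ y, y ∉ M)
    (hmul : ∀ x ∈ M, ∀ y ∈ M, x * y ∈ M) (hinv : ∀ x ∈ M, x⁻¹ ∈ M)
    (β : H ≃+ H) (hβ : ∀ x, ∃ k ∈ M, β x = x * k) : ∃ e, e ≠ 0 ∧ ∀ x, β x = x * e := by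
  have key : ∀ x, x ∉ M → β x = x * β 1 := by
    intro x hx
    obtain ⟨e, he, h_e⟩ := hβ 1
    obtain ⟨k, hk, h_k⟩ := hβ x
    obtain ⟨f, hf, h_f⟩ := hβ (1 + x)
    rw [map_add, h_e, h_k] at h_f
    rw [h_k, h_e]
    rw [one_mul] at *
    have h3 : x * (k - f) = f - e := by
      rw [add_mul, one_mul] at h_f
      rw [mul_sub, sub_eq_sub_iff_add_eq_add, add_comm, h_f]
    have h4 : k - f = 0 := by
      by_contra h0
      apply hx
      have : x = (f - e) * (k - f)⁻¹ := by rw [← h3]; simp [h0]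
      rw [this]
      exact hmul _ (M.sub_mem hf he) _ (hinv _ (M.sub_mem hk hf))
    rw [h4, mul_zero] at h3
    rw [sub_eq_zero.1 h4, sub_eq_zero.1 h3.symm]
  refine ⟨β 1, by simp, fun x => ?_⟩
  by_cases hx : x ∈ M
  · obtain ⟨y, hy⟩ := hMtop
    have hxy : x + y ∉ M := fun h => hy (by simpa using M.sub_mem h hx)
    have := key _ hxy
    rw [map_add, key y hy, add_mul] at this
    exact add_right_cancel this
  · exact key x hx

theorem beta_right {M : Submodule F H} (hMtop : ∃ y, y ∉ M)
    (hmul : ∀ x ∈ M, ∀ y ∈ M, x * y ∈ M) (hinv : ∀ x ∈ M, x⁻¹ ∈ M)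
    (β : H ≃+ H) (hβ : ∀ x, ∃ k ∈ M, β x = k * x) : ∃ e, e ≠ 0 ∧ ∀ x, β x = e * x := by
  have key : ∀ x, x ∉ M → β x = β 1 * x := by
    intro x hx
    obtain ⟨e, he, h_e⟩ := hβ 1
    obtain ⟨k, hk, h_k⟩ := hβ x
    obtain ⟨f, hf, h_f⟩ := hβ (1 + x)
    rw [map_add, h_e, h_k] at h_f
    rw [h_k, h_e]
    rw [mul_one] at *
    have h3 : (k - f) * x = f - e := by
      rw [mul_add, mul_one] at h_f
      rw [sub_mul, sub_eq_sub_iff_add_eq_add, add_comm, h_f]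
    have h4 : k - f = 0 := by
      by_contra h0
      apply hx
      have : x = (k - f)⁻¹ * (f - e) := by rw [← h3]; simp [h0]
      rw [this]
      exact hmul _ (hinv _ (M.sub_mem hk hf)) _ (M.sub_mem hf he)
    rw [h4, zero_mul] at h3
    rw [sub_eq_zero.1 h4, sub_eq_zero.1 h3.symm]
  refine ⟨β 1, by simp, fun x => ?_⟩
  by_cases hx : x ∈ M
  · obtain ⟨y, hy⟩ := hMtop
    have hxy : x + y ∉ M := fun h => hy (by simpa using M.sub_mem h hx)
    have := key _ hxy
    rw [map_add, key y hy, mul_add] at this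
    exact add_right_cancel this
  · exact key x hx

theorem LPar.finrank {M N : Submodule F H} (h : LPar M N) :
    Module.finrank F N = Module.finrank F M := by
  obtain ⟨c, hc, h⟩ := h
  have : N = lt c M := SetLike.coe_injective (by rw [h, lt_coe])
  rw [this, lt_finrank hc]

theorem RPar.finrank {M N : Submodule F H} (h : RPar M N) :
    Module.finrank F N = Module.finrank F M := by
  obtain ⟨c, hc, h⟩ := h
  have : N = rt c M := SetLike.coe_injective (by rw [h, rt_coe])
  rw [this, rt_finrank hc]

theorem mem_lt {c : H} (hc : c ≠ 0) (M : Submodule F H) (x : H) : x ∈ lt c M ↔ c⁻¹ * x ∈ M := by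
  rw [← SetLike.mem_coe, lt_coe]
  constructor
  · rintro ⟨y, hy, rfl⟩
    simpa [hc] using hy
  · intro hx
    exact ⟨_, hx, by simp [hc]⟩

theorem mem_rt {c : H} (hc : c ≠ 0) (M : Submodule F H) (x : H) : x ∈ rt c M ↔ x * c⁻¹ ∈ M := by
  rw [← SetLike.mem_coe, rt_coe]
  constructor
  · rintro ⟨y, hy, rfl⟩
    simpa [hc] using hy
  · intro hx
    exact ⟨_, hx, by simp [hc]⟩

theorem line_mul_iff (hrank : Module.finrank F H = 4)
    (hcenter : ∀ z : H, z ∈ Subring.center H ↔ ∃ a : F, z = algebraMap F H a)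
    {M : Submodule F H} (hM : Module.finrank F M = 2) (h1 : (1 : H) ∈ M)
    {k : H} (hk : k ∈ M) (hk0 : k ≠ 0) (y : H) :
    (k * y ∈ M ↔ y ∈ M) ∧ (y * k ∈ M ↔ y ∈ M) := by
  obtain ⟨hmul, hinv⟩ := line_mul hrank hcenter hM h1
  refine ⟨⟨fun h => ?_, fun h => hmul _ hk _ h⟩, ⟨fun h => ?_, fun h => hmul _ h _ hk⟩⟩
  · simpa [hk0] using hmul _ (hinv _ hk) _ h
  · simpa [hk0] using hmul _ h _ (hinv _ hk)

theorem LPar.unique (hrank : Module.finrank F H = 4)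
    (hcenter : ∀ z : H, z ∈ Subring.center H ↔ ∃ a : F, z = algebraMap F H a)
    {N N' : Submodule F H} (hN : Module.finrank F N = 2) (h : LPar N N')
    {x : H} (hx0 : x ≠ 0) (hx : x ∈ N) (hx' : x ∈ N') : N' = N := by
  obtain ⟨c, hc, h⟩ := h.mem
  have hm : ∀ y, y ∈ lt x⁻¹ N ↔ x * y ∈ N := fun y => by
    rw [mem_lt (inv_ne_zero hx0), inv_inv]
  have hk : x⁻¹ * c⁻¹ * x ∈ lt x⁻¹ N := by
    rw [hm]; rw [h] at hx'; simpa [hx0, mul_assoc] using hx'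
  have key := line_mul_iff hrank hcenter (by rw [lt_finrank (inv_ne_zero hx0), hN])
    (by rw [hm]; simpa using hx) hk (by simp [hx0, hc])
  ext y
  have := (key (x⁻¹ * y)).1
  rw [hm, hm] at this
  rw [h]
  simpa [hx0, mul_assoc] using this

theorem RPar.unique (hrank : Module.finrank F H = 4)
    (hcenter : ∀ z : H, z ∈ Subring.center H ↔ ∃ a : F, z = algebraMap F H a)
    {N N' : Submodule F H} (hN : Module.finrank F N = 2) (h : RPar N N')
    {x : H} (hx0 : x ≠ 0) (hx : x ∈ N) (hx' : x ∈ N') : N' = N := by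
  obtain ⟨c, hc, h⟩ := h.mem
  have hm : ∀ y, y ∈ rt x⁻¹ N ↔ y * x ∈ N := fun y => by
    rw [mem_rt (inv_ne_zero hx0), inv_inv]
  have hk : x * c⁻¹ * x⁻¹ ∈ rt x⁻¹ N := by
    rw [hm]; rw [h] at hx'; simpa [hx0, mul_assoc] using hx'
  have key := line_mul_iff hrank hcenter (by rw [rt_finrank (inv_ne_zero hx0), hN])
    (by rw [hm]; simpa using hx) hk (by simp [hx0, hc])
  ext y
  have := (key (y * x⁻¹)).2
  rw [hm, hm] at this
  rw [h]
  simpa [hx0, mul_assoc] using this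

theorem line_exists {N : Submodule F H} (hN : Module.finrank F N = 2) :
    ∃ x ∈ N, x ≠ 0 := by
  apply Submodule.exists_mem_ne_zero_of_ne_bot
  rintro rfl
  simp at hN

end Aux

/-- Let `H` be a quaternion skew field with centre `F` (so the
left and right Clifford parallelisms differ) and let `P` be a Clifford-like
parallelism of `(P(H_F), ∥ₗ, ∥ᵣ)`.  Then the following are equivalent:
(a) `P` coincides with the left or with the right Clifford parallelism;
(b) `P` admits an automorphism `β` (an additive bijection of `H`, semilinear
with respect to some automorphism `σ` of `F`, mapping `P`-parallel lines to
`P`-parallel lines) which stabilises exactly one parallel class of `P` and fixes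
all lines of that class: there is a line `L` such that `β(N) = N` for every line
`N ∥ L`, while for every line `M` with `¬(M ∥ L)` the class `S(M)` is not
stabilised by `β` (some `N ∥ M` has `β(N)` not `P`-parallel to `M`). -/
theorem stmt_13 {F H : Type*} [Field F] [DivisionRing H] [Algebra F H]
    (hrank : Module.finrank F H = 4)
    (hcenter : ∀ z : H, z ∈ Subring.center H ↔ ∃ a : F, z = algebraMap F H a)
    (P : Submodule F H → Submodule F H → Prop)
    (hlines : ∀ M N, P M N → Module.finrank F M = 2 ∧ Module.finrank F N = 2)
    (hrefl : ∀ M : Submodule F H, Module.finrank F M = 2 → P M M)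
    (hsymm : ∀ M N, P M N → P N M)
    (htrans : ∀ M N K, P M N → P N K → P M K)
    (hpar : ∀ x : H, x ≠ 0 → ∀ M : Submodule F H, Module.finrank F M = 2 →
      ∃! N : Submodule F H, x ∈ N ∧ P N M)
    (hCL : ∀ M N, P M N →
      (∃ c : H, c ≠ 0 ∧ (N : Set H) = (fun y => c * y) '' (M : Set H)) ∨
      (∃ c : H, c ≠ 0 ∧ (N : Set H) = (fun y => y * c) '' (M : Set H))) :
    ((∀ M N : Submodule F H, Module.finrank F M = 2 → Module.finrank F N = 2 →
        (P M N ↔ ∃ c : H, c ≠ 0 ∧ (N : Set H) = (fun y => c * y) '' (M : Set H))) ∨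
     (∀ M N : Submodule F H, Module.finrank F M = 2 → Module.finrank F N = 2 →
        (P M N ↔ ∃ c : H, c ≠ 0 ∧ (N : Set H) = (fun y => y * c) '' (M : Set H))))
    ↔
    (∃ (σ : F ≃+* F) (β : H ≃+ H),
      (∀ (a : F) (x : H), β (a • x) = σ a • β x) ∧
      (∀ M N : Submodule F H, P M N → ∃ M' N' : Submodule F H,
        (M' : Set H) = ⇑β '' (M : Set H) ∧ (N' : Set H) = ⇑β '' (N : Set H) ∧ P M' N') ∧
      (∃ L : Submodule F H, Module.finrank F L = 2 ∧
        (∀ N : Submodule F H, P N L → ⇑β '' (N : Set H) = (N : Set H)) ∧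
        (∀ M : Submodule F H, Module.finrank F M = 2 → ¬ P M L →
          ∃ N : Submodule F H, P N M ∧
            ¬ ∃ N' : Submodule F H, (N' : Set H) = ⇑β '' (N : Set H) ∧ P N' M))) := by
  have hcls : ∀ M : Submodule F H, Module.finrank F M = 2 →
      (∀ N, P N M ↔ LPar M N) ∨ (∀ N, P N M ↔ RPar M N) := by
    intro M hM
    have hd : (∀ N, P N M → LPar M N) ∨ (∀ N, P N M → RPar M N) := by
      by_contra hcon
      push Not at hcon
      obtain ⟨⟨A, hA, hA'⟩, ⟨B, hB, hB'⟩⟩ := hcon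
      have hAR : RPar M A := (hCL M A (hsymm _ _ hA)).resolve_left hA'
      have hBL : LPar M B := (hCL M B (hsymm _ _ hB)).resolve_right hB'
      rcases hCL A B (htrans _ _ _ hA (hsymm _ _ hB)) with h | h
      · exact hA' (hBL.trans (LPar.symm h))
      · exact hB' (hAR.trans h)
    refine hd.imp (fun h N => ⟨h N, fun hN => ?_⟩) (fun h N => ⟨h N, fun hN => ?_⟩)
    · have hN2 : Module.finrank F N = 2 := by rw [hN.finrank, hM]
      obtain ⟨x, hx, hx0⟩ := line_exists hN2
      obtain ⟨N', ⟨hxN', hP⟩, -⟩ := hpar x hx0 M hM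
      rw [← (hN.symm.trans (h N' hP)).unique hrank hcenter hN2 hx0 hx hxN']
      exact hP
    · have hN2 : Module.finrank F N = 2 := by rw [hN.finrank, hM]
      obtain ⟨x, hx, hx0⟩ := line_exists hN2
      obtain ⟨N', ⟨hxN', hP⟩, -⟩ := hpar x hx0 M hM
      rw [← (hN.symm.trans (h N' hP)).unique hrank hcenter hN2 hx0 hx hxN']
      exact hP
  obtain ⟨e, he, he2⟩ := exists_sq hrank hcenter
  have he0 : e ≠ 0 := by rintro rfl; exact he 0 (by simp)
  have hL2 := finrank_pair_s13 he
  have h1L : (1 : H) ∈ Submodule.span F {1, e} := Submodule.subset_span (by simp)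
  have heL : e ∈ Submodule.span F {1, e} := Submodule.subset_span (by simp)
  have hfd : FiniteDimensional F H := Module.finite_of_finrank_pos (by omega)
  have hLM : ∀ M : Submodule F H, Module.finrank F M = 2 → (1 : H) ∈ M → e ∈ M →
      M = Submodule.span F {1, e} := by
    intro M hM h1 h
    refine (Submodule.eq_of_le_of_finrank_le ?_ (by rw [hL2, hM])).symm
    rw [Submodule.span_le]
    rintro y (rfl | rfl) <;> assumption
  constructor
  · rintro (hP | hP)
    · let β : H ≃+ H :=
        { toFun := fun x => x * e
          invFun := fun x => x * e⁻¹
          left_inv := fun x => by simp [he0]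
          right_inv := fun x => by simp [he0]
          map_add' := fun x y => add_mul x y e }
      have hβ : ∀ N : Submodule F H, ⇑β '' (N : Set H) = rt e N := fun N => (rt_coe e N).symm
      refine ⟨RingEquiv.refl F, β, fun a x => smul_mul_assoc a x e, ?_, Submodule.span F {1, e}, hL2, ?_, ?_⟩
      · intro M N hMN
        obtain ⟨hM, hN⟩ := hlines _ _ hMN
        refine ⟨rt e M, rt e N, (hβ M).symm, (hβ N).symm, ?_⟩
        rw [hP _ _ (by rw [rt_finrank he0, hM]) (by rw [rt_finrank he0, hN])]
        obtain ⟨c, hc, h⟩ := LPar.mem ((hP M N hM hN).1 hMN)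
        refine LPar.of_mem hc fun x => ?_
        rw [mem_rt he0, mem_rt he0, h, mul_assoc]
      · intro N hN
        obtain ⟨hN2, -⟩ := hlines _ _ hN
        obtain ⟨c, hc, h⟩ := LPar.mem ((hP _ N hL2 hN2).1 (hsymm _ _ hN))
        rw [hβ]
        ext x
        rw [SetLike.mem_coe, SetLike.mem_coe, mem_rt he0, h, h, ← mul_assoc]
        have := (line_mul_iff hrank hcenter hL2 h1L heL he0 (c⁻¹ * x * e⁻¹)).2
        rw [← this]
        simp [he0]
      · intro M hM hML
        refine ⟨M, hrefl M hM, ?_⟩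
        rintro ⟨N', hN', hPN⟩
        apply hML
        rw [hβ] at hN'
        rw [SetLike.coe_injective hN'] at hPN
        obtain ⟨d, hd, hd0⟩ := line_exists hM
        have hdi := inv_ne_zero hd0
        have hM0 : Module.finrank F (lt d⁻¹ M) = 2 := by rw [lt_finrank hdi, hM]
        have h1 : (1 : H) ∈ lt d⁻¹ M := by rw [mem_lt hdi]; simpa using hd
        have hpar2 : LPar (lt e (lt d⁻¹ M)) (rt e (lt d⁻¹ M)) := by
          refine (lt_lpar he0 _).symm.trans ((lt_lpar hdi M).symm.trans ?_)
          have h2 : LPar M (rt e M) :=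
            (hP M _ hM (by rw [rt_finrank he0, hM])).1 (hsymm _ _ hPN)
          refine h2.trans (LPar.of_mem hdi fun x => ?_)
          rw [mem_rt he0, mem_rt he0, mem_lt hdi, mul_assoc]
        have heq := hpar2.unique hrank hcenter (by rw [lt_finrank he0, hM0]) he0
          (by rw [mem_lt he0]; simpa [he0] using h1) (by rw [mem_rt he0]; simpa [he0] using h1)
        have hem := norm_mem hrank hcenter hM0 h1 he he2 (fun x hx => by
          rw [← mem_rt he0, heq, mem_lt he0]; simpa [he0] using hx)
        rw [hP M _ hM hL2, ← hLM _ hM0 h1 hem]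
        exact lt_lpar hdi M
    · let β : H ≃+ H :=
        { toFun := fun x => e * x
          invFun := fun x => e⁻¹ * x
          left_inv := fun x => by simp [he0]
          right_inv := fun x => by simp [he0]
          map_add' := fun x y => mul_add e x y }
      have hβ : ∀ N : Submodule F H, ⇑β '' (N : Set H) = lt e N := fun N => (lt_coe e N).symm
      refine ⟨RingEquiv.refl F, β, fun a x => mul_smul_comm a e x, ?_, Submodule.span F {1, e}, hL2, ?_, ?_⟩
      · intro M N hMN
        obtain ⟨hM, hN⟩ := hlines _ _ hMN
        refine ⟨lt e M, lt e N, (hβ M).symm, (hβ N).symm, ?_⟩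
        rw [hP _ _ (by rw [lt_finrank he0, hM]) (by rw [lt_finrank he0, hN])]
        obtain ⟨c, hc, h⟩ := RPar.mem ((hP M N hM hN).1 hMN)
        refine RPar.of_mem hc fun x => ?_
        rw [mem_lt he0, mem_lt he0, h, mul_assoc]
      · intro N hN
        obtain ⟨hN2, -⟩ := hlines _ _ hN
        obtain ⟨c, hc, h⟩ := RPar.mem ((hP _ N hL2 hN2).1 (hsymm _ _ hN))
        rw [hβ]
        ext x
        rw [SetLike.mem_coe, SetLike.mem_coe, mem_lt he0, h, h, mul_assoc]
        have := (line_mul_iff hrank hcenter hL2 h1L heL he0 (e⁻¹ * (x * c⁻¹))).1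
        rw [← this]
        simp [he0]
      · intro M hM hML
        refine ⟨M, hrefl M hM, ?_⟩
        rintro ⟨N', hN', hPN⟩
        apply hML
        rw [hβ] at hN'
        rw [SetLike.coe_injective hN'] at hPN
        obtain ⟨d, hd, hd0⟩ := line_exists hM
        have hdi := inv_ne_zero hd0
        have hM0 : Module.finrank F (rt d⁻¹ M) = 2 := by rw [rt_finrank hdi, hM]
        have h1 : (1 : H) ∈ rt d⁻¹ M := by rw [mem_rt hdi]; simpa using hd
        have hpar2 : RPar (rt e (rt d⁻¹ M)) (lt e (rt d⁻¹ M)) := by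
          refine (rt_rpar he0 _).symm.trans ((rt_rpar hdi M).symm.trans ?_)
          have h2 : RPar M (lt e M) :=
            (hP M _ hM (by rw [lt_finrank he0, hM])).1 (hsymm _ _ hPN)
          refine h2.trans (RPar.of_mem hdi fun x => ?_)
          rw [mem_lt he0, mem_lt he0, mem_rt hdi, mul_assoc]
        have heq := hpar2.unique hrank hcenter (by rw [rt_finrank he0, hM0]) he0
          (by rw [mem_rt he0]; simpa [he0] using h1) (by rw [mem_lt he0]; simpa [he0] using h1)
        have hem := norm_mem hrank hcenter hM0 h1 he he2 (fun x hx => by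
          rw [← mem_rt he0, ← heq, mem_lt he0]; simpa [he0] using hx)
        rw [hP M _ hM hL2, ← hLM _ hM0 h1 hem]
        exact rt_rpar hdi M
  · rintro ⟨σ, β, -, -, L, hL, hfix, hmove⟩
    obtain ⟨L0, ⟨h1, hL0⟩, -⟩ := hpar 1 one_ne_zero L hL
    obtain ⟨hL02, -⟩ := hlines _ _ hL0
    obtain ⟨hmul, hinv⟩ := line_mul hrank hcenter hL02 h1
    have hntop : ∃ y, y ∉ L0 := by
      by_contra hcon
      push Not at hcon
      have : L0 = ⊤ := eq_top_iff.2 fun y _ => hcon y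
      rw [this, finrank_top] at hL02
      omega
    rcases hcls L hL with hc | hc
    · left
      obtain ⟨f, hf0, hf⟩ := beta_left hntop hmul hinv β (by
        intro x
        by_cases hx : x = 0
        · exact ⟨1, h1, by simp [hx]⟩
        have hP : P (lt x L0) L := (hc _).2 (((hc _).1 hL0).trans (lt_lpar hx L0))
        have hm : β x ∈ (lt x L0 : Set H) := by
          rw [← hfix _ hP]
          exact ⟨x, by rw [SetLike.mem_coe, mem_lt hx]; simpa [hx] using h1, rfl⟩
        rw [SetLike.mem_coe, mem_lt hx] at hm
        exact ⟨_, hm, by simp [hx]⟩)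
      have hall : ∀ M : Submodule F H, Module.finrank F M = 2 → ∀ N, P N M ↔ LPar M N := by
        intro M hM
        by_cases hML : P M L
        · intro N
          have hLM := (hc M).1 hML
          constructor
          · intro h
            exact hLM.symm.trans ((hc N).1 (htrans _ _ _ h hML))
          · intro h
            exact htrans _ _ _ ((hc N).2 (hLM.trans h)) (hsymm _ _ hML)
        · refine (hcls M hM).resolve_right fun hr => ?_
          obtain ⟨N, hN, hN'⟩ := hmove M hM hML
          apply hN'
          refine ⟨rt f N, ?_, (hr _).2 (((hr _).1 hN).trans (rt_rpar hf0 N))⟩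
          rw [rt_coe]
          exact Set.image_congr fun x _ => (hf x).symm
      intro M N hM hN
      exact ⟨fun h => (hall M hM N).1 (hsymm _ _ h), fun h => hsymm _ _ ((hall M hM N).2 h)⟩
    · right
      obtain ⟨f, hf0, hf⟩ := beta_right hntop hmul hinv β (by
        intro x
        by_cases hx : x = 0
        · exact ⟨1, h1, by simp [hx]⟩
        have hP : P (rt x L0) L := (hc _).2 (((hc _).1 hL0).trans (rt_rpar hx L0))
        have hm : β x ∈ (rt x L0 : Set H) := by
          rw [← hfix _ hP]
          exact ⟨x, by rw [SetLike.mem_coe, mem_rt hx]; simpa [hx] using h1, rfl⟩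
        rw [SetLike.mem_coe, mem_rt hx] at hm
        exact ⟨_, hm, by simp [hx]⟩)
      have hall : ∀ M : Submodule F H, Module.finrank F M = 2 → ∀ N, P N M ↔ RPar M N := by
        intro M hM
        by_cases hML : P M L
        · intro N
          have hLM := (hc M).1 hML
          constructor
          · intro h
            exact hLM.symm.trans ((hc N).1 (htrans _ _ _ h hML))
          · intro h
            exact htrans _ _ _ ((hc N).2 (hLM.trans h)) (hsymm _ _ hML)
        · refine (hcls M hM).resolve_left fun hr => ?_
          obtain ⟨N, hN, hN'⟩ := hmove M hM hML
          apply hN'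
          refine ⟨lt f N, ?_, (hr _).2 (((hr _).1 hN).trans (lt_lpar hf0 N))⟩
          rw [lt_coe]
          exact Set.image_congr fun x _ => (hf x).symm
      intro M N hM hN
      exact ⟨fun h => (hall M hM N).1 (hsymm _ _ h), fun h => hsymm _ _ ((hall M hM N).2 h)⟩
end

section
/- Let H be a quaternion skew field with centre F and let ∥ be a Clifford-like parallelism of (P(H_F), ∥ₗ, ∥ᵣ). If an automorphism β of ∥ stabilises all parallel classes of ∥ (β(M) ∥ M for every line M) and fixes all lines of at least one parallel class (there is a line L with β(N) = N for every N ∥ L), then β acts identically on the projective space P(H_F): for every x ∈ H∖{0} there is a ∈ F∖{0} with β(x) = a·x. (This is the case-(A) content of the theorem characterising '∥ Clifford with ∥ₗ = ∥ᵣ': since ∥ₗ ≠ ∥ᵣ for a quaternion skew field, no such β can act as a non-identical collineation.) -/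
theorem cl_core {H : Type*} [DivisionRing H] (m t n : H)
    (ht : ∀ x, t * x = x * t) (hn : ∀ x, n * x = x * n) (hq : m * m = n + t * m)
    (hk : ∃ k, k * m ≠ m * k)
    (hyp : ∀ h : H, h ≠ 0 → ∀ w : H, w * h = h * m →
      ∀ y, y * w = w * m → y * m = m * y) : False := by
  have hm0 : m ≠ 0 := by
    rintro rfl; obtain ⟨k, hk⟩ := hk; simp at hk
  have K : ∀ w y : H, y * w = w * m → y * m = m * y → w * m ≠ m * w →
      w * m = (t - m) * w := by
    intro w y h1 h2 h3
    have hw : w ≠ 0 := by rintro rfl; simp at h3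
    have hyy : y * y = n + t * y := by
      apply mul_right_cancel₀ hw
      calc y * y * w = y * (w * m) := by rw [mul_assoc, h1]
        _ = w * (m * m) := by rw [← mul_assoc, h1, mul_assoc]
        _ = (n + t * y) * w := by
          rw [hq, mul_add, add_mul, mul_assoc t y w, h1, ← hn, ← mul_assoc w t m, ← ht w, mul_assoc]
    have hne : y - m ≠ 0 := by
      intro h; apply h3; rw [← h1, sub_eq_zero.1 h]
    have : (y - m) * (y + m - t) = 0 := by
      have : (y - m) * (y + m - t) = y * y + (y * m - m * y) - m * m - (y * t - m * t) := by
        noncomm_ring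
      rw [this, hyy, hq, h2, ht, ht]; noncomm_ring
    rcases mul_eq_zero.1 this with h | h
    · exact absurd h hne
    · have : y = t - m := by rw [← sub_eq_zero, ← h]; abel
      rw [← h1, this]
  have step1 : ∃ a, a * m = (t - m) * a ∧ a * m ≠ m * a := by
    obtain ⟨k, hk⟩ := hk
    have hk0 : k ≠ 0 := by rintro rfl; simp at hk
    have hwk : (k * m * k⁻¹) * k = k * m := by rw [mul_assoc, inv_mul_cancel₀ hk0, mul_one]
    set w := k * m * k⁻¹ with hw
    have hw0 : w ≠ 0 := by simp [hw, hk0, hm0]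
    have hyw : (w * m * w⁻¹) * w = w * m := by rw [mul_assoc, inv_mul_cancel₀ hw0, mul_one]
    by_cases hc : w * m = m * w
    · exact ⟨k, K k w hwk hc hk, hk⟩
    · exact ⟨w, K w _ hyw (hyp k hk0 w hwk _ hyw) hc, hc⟩
  have aux : ∀ a x y : H, a * m ≠ m * a → x * m = m * x → y * m = m * y → x * a = y →
      x = 0 := by
    intro a x y h1 h2 h3 h4
    by_contra hx
    apply h1
    apply mul_left_cancel₀ hx
    rw [← mul_assoc, h4, h3, ← mul_assoc, h2, mul_assoc, h4]
  have flip : ∀ a, a * m = (t - m) * a → a * (t - m) = m * a := by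
    intro a h
    rw [mul_sub, h, sub_mul, ht]; abel
  have step2 : ∀ a, a * m = (t - m) * a → a * m ≠ m * a → a * a = -1 ∧ t - m = -m := by
    intro a h1 h2
    have h3 := flip a h1
    have htm : (t - m) * m = m * (t - m) := by rw [sub_mul, mul_sub, ht]
    generalize hc : t - m = c at *
    have ha0 : a ≠ 0 := by rintro rfl; simp at h2
    have h1a : 1 + a ≠ 0 := by
      intro h
      have : a = -1 := by rw [eq_neg_iff_add_eq_zero, add_comm]; exact h
      subst this; simp at h2
    have hcm : c ≠ m := by rintro rfl; exact h2 h1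
    have haa : a * a * m = m * (a * a) := by
      rw [mul_assoc, h1, ← mul_assoc, h3, mul_assoc]
    have huh : ((1 + a) * m * (1 + a)⁻¹) * (1 + a) = (1 + a) * m := by
      rw [mul_assoc, inv_mul_cancel₀ h1a, mul_one]
    set u := (1 + a) * m * (1 + a)⁻¹ with hu
    have hu0 : u ≠ 0 := by simp [hu, h1a, hm0]
    have hyw : (u * m * u⁻¹) * u = u * m := by rw [mul_assoc, inv_mul_cancel₀ hu0, mul_one]
    have hy := hyp _ h1a u huh _ hyw
    have hexp : u + u * a = m + c * a := by
      rw [← h1]; simpa [mul_add, add_mul] using huh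
    have key : c * (a * a) = m := by
      by_cases hum : u * m = m * u
      · exfalso
        have e : (u - c) * a = m - u := by
          rw [sub_mul, sub_eq_sub_iff_add_eq_add, add_comm, hexp]
        have := aux a (u - c) (m - u) h2 (by rw [sub_mul, mul_sub, hum, htm])
          (by rw [sub_mul, mul_sub, hum]) e
        have huc : u = c := sub_eq_zero.1 this
        rw [this, zero_mul] at e
        exact hcm (by rw [← huc]; exact (sub_eq_zero.1 e.symm).symm)
      · have hum' : u * m = c * u := by
          exact K u _ hyw hy hum
        have huc : u * c = m * u := by
          exact flip u hum'
        have hva : (u * a⁻¹) * a = u := by rw [mul_assoc, inv_mul_cancel₀ ha0, mul_one]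
        set v := u * a⁻¹ with hv
        have hvm : v * m = m * v := by
          apply mul_right_cancel₀ ha0
          rw [mul_assoc, ← h3, ← mul_assoc, hva, huc, mul_assoc, hva]
        have e : (v - c) * a = m - v * (a * a) := by
          rw [sub_mul, sub_eq_sub_iff_add_eq_add, ← mul_assoc, hva, hexp]
        have h0 := aux a (v - c) _ h2 (by rw [sub_mul, mul_sub, hvm, htm])
          (by rw [sub_mul, mul_sub, mul_assoc, haa, ← mul_assoc, hvm, mul_assoc]) e
        have hvc : v = c := sub_eq_zero.1 h0
        rw [h0, zero_mul, hvc] at e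
        exact (sub_eq_zero.1 e.symm).symm
    have hc0 : c ≠ 0 := by rintro rfl; exact hm0 (by rw [← key, zero_mul])
    have key2 : m * (a * a) = c := by
      apply mul_right_cancel₀ ha0
      rw [← h1]
      calc m * (a * a) * a = (m * a) * (a * a) := by noncomm_ring
        _ = a * (c * (a * a)) := by rw [← h3]; noncomm_ring
        _ = a * m := by rw [key]
    have hs : (a * a - 1) * (a * a + 1) = 0 := by
      apply mul_left_cancel₀ hc0
      calc c * ((a * a - 1) * (a * a + 1)) = c * (a * a) * (a * a) - c := by noncomm_ring
        _ = c * 0 := by rw [key, key2]; simp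
    rcases mul_eq_zero.1 hs with h | h
    · exfalso; rw [sub_eq_zero.1 h, mul_one] at key; exact hcm key
    · have : a * a = -1 := eq_neg_of_add_eq_zero_left h
      refine ⟨this, ?_⟩
      rw [← key2, this]; simp
  obtain ⟨a, h1, h2⟩ := step1
  obtain ⟨haa, htm⟩ := step2 a h1 h2
  rw [htm] at h1
  have ham : a * m = - (m * a) := by rw [h1]; simp
  have gen : ∀ l, l ≠ 0 → l * m = m * l → (l * a) * (l * a) = -1 := by
    intro l hl hlm
    refine (step2 (l * a) ?_ ?_).1
    · rw [htm, mul_assoc, ham]; simp only [mul_neg, neg_mul, ← mul_assoc, hlm]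
    · intro h
      apply h2
      apply mul_left_cancel₀ hl
      rw [← mul_assoc, h, ← mul_assoc, ← mul_assoc, hlm]
  have g2 := gen (1 + m) (by
    intro h
    have : m = -1 := by rw [eq_neg_iff_add_eq_zero, add_comm]; exact h
    rw [this] at h2; simp at h2) (by noncomm_ring)
  have : (1 + m) * a * ((1 + m) * a) = (1 + m) * (a * a + (a * m) * a) := by noncomm_ring
  rw [this, ham] at g2
  have : (1 + m) * (a * a + -(m * a) * a) = (1 + m) * (1 - m) * (a * a) := by noncomm_ring
  rw [this, haa] at g2
  have : m * m = 0 := by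
    have e : (1 + m) * (1 - m) * (-1) = m * m - 1 := by noncomm_ring
    rw [e] at g2
    simpa using g2
  exact hm0 (mul_self_eq_zero.1 this)

theorem cl_B {F H : Type*} [Field F] [DivisionRing H] [Algebra F H]
    (hrank : Module.finrank F H = 4) (m : H) (W : Submodule F H)
    (hW : 3 ≤ Module.finrank F W) (hc : ∀ w ∈ W, w * m = m * w) (x : H) : x * m = m * x := by
  have : Module.Finite F H := Module.finite_of_finrank_pos (by omega)
  by_cases hx : x = 0
  · simp [hx]
  have hinj : Function.Injective (LinearMap.mulRight F x) := fun a b h => mul_right_cancel₀ hx h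
  have e : Module.finrank F (W.map (LinearMap.mulRight F x)) = Module.finrank F W :=
    (Submodule.equivMapOfInjective _ hinj W).finrank_eq.symm
  have h1 := Submodule.finrank_sup_add_finrank_inf_eq W (W.map (LinearMap.mulRight F x))
  have h2 := Submodule.finrank_le (W ⊔ (W.map (LinearMap.mulRight F x)))
  have h3 : W ⊓ (W.map (LinearMap.mulRight F x)) ≠ ⊥ := by
    intro h; rw [h, finrank_bot] at h1; omega
  obtain ⟨w, hw, hw0⟩ := Submodule.exists_mem_ne_zero_of_ne_bot h3
  obtain ⟨hw1, v, hv, hvw⟩ := hw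
  have hvw : v * x = w := hvw
  have hv0 : v ≠ 0 := by rintro rfl; exact hw0 (by rw [← hvw, zero_mul])
  apply mul_left_cancel₀ hv0
  rw [← mul_assoc, hvw, hc w hw1, ← mul_assoc, hc v hv, mul_assoc, hvw]

theorem cl_C {F H : Type*} [Field F] [DivisionRing H] [Algebra F H]
    (hrank : Module.finrank F H = 4) (L : Submodule F H) (hL : Module.finrank F L = 2)
    (h1 : (1 : H) ∈ L) (m : H) (hm : m ∈ L) (hk : ∃ k, k * m ≠ m * k) :
    (∀ x, x ∈ L ↔ x * m = m * x) ∧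
    (∀ x, x ∈ L ↔ ∃ a b : F, a • (1 : H) + b • m = x) := by
  have : Module.Finite F H := Module.finite_of_finrank_pos (by omega)
  obtain ⟨k, hk⟩ := hk
  have li : LinearIndependent F ![(1 : H), m] := by
    rw [LinearIndependent.pair_iff]
    intro s t hst
    have ht : t = 0 := by
      by_contra ht
      apply hk
      have : m = (- (t⁻¹ * s)) • (1 : H) := by
        have : t • m = (-s) • (1 : H) := by
          rw [neg_smul]; exact eq_neg_of_add_eq_zero_right hst
        rw [← inv_smul_smul₀ ht m, this, smul_smul]; simp
      rw [this]; simp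
    subst ht
    simpa using hst
  have hspan : Module.finrank F (Submodule.span F {(1 : H), m}) = 2 := by
    have := finrank_span_eq_card li
    have hr : Set.range ![(1 : H), m] = {(1 : H), m} := by
      ext x; simp [eq_comm, or_comm]
    rw [hr, Fintype.card_fin] at this
    exact this
  have hle : Submodule.span F {(1 : H), m} ≤ L := by
    rw [Submodule.span_le]; rintro x (rfl | rfl) <;> assumption
  have hLs := Submodule.eq_of_le_of_finrank_eq hle (by rw [hspan, hL])
  have hmem : ∀ x, x ∈ L ↔ ∃ a b : F, a • (1 : H) + b • m = x := by
    intro x; rw [← hLs, Submodule.mem_span_pair]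
  refine ⟨?_, hmem⟩
  let C : Submodule F H := Subalgebra.toSubmodule (Subalgebra.centralizer F {m})
  have hC : ∀ x, x ∈ C ↔ x * m = m * x := by
    intro x
    change x ∈ Subalgebra.centralizer F {m} ↔ _
    rw [Subalgebra.mem_centralizer_iff]
    simp [eq_comm]
  have hLC : L ≤ C := by
    intro x hx
    obtain ⟨a, b, rfl⟩ := (hmem x).1 hx
    rw [hC]; simp [add_mul, mul_add]
  have hC2 : Module.finrank F C ≤ 2 := by
    by_contra h
    exact hk (cl_B hrank m C (by omega) (fun w hw => (hC w).1 hw) k)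
  have := Submodule.eq_of_le_of_finrank_le hLC (by rw [hL]; exact hC2)
  intro x; rw [this, hC]

theorem cl_D {F H : Type*} [Field F] [DivisionRing H] [Algebra F H]
    (P : Submodule F H → Submodule F H → Prop)
    (hsymm : ∀ M N, P M N → P N M)
    (htrans : ∀ M N K, P M N → P N K → P M K)
    (hCL : ∀ M N, P M N →
      (∃ c : H, c ≠ 0 ∧ (N : Set H) = (fun y => c * y) '' (M : Set H)) ∨
      (∃ c : H, c ≠ 0 ∧ (N : Set H) = (fun y => y * c) '' (M : Set H)))
    (M : Submodule F H) :
    (∀ N, P N M → ∃ c : H, c ≠ 0 ∧ (N : Set H) = (fun y => c * y) '' (M : Set H)) ∨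
    (∀ N, P N M → ∃ c : H, c ≠ 0 ∧ (N : Set H) = (fun y => y * c) '' (M : Set H)) := by
  by_contra hcon
  rw [not_or] at hcon
  obtain ⟨hA, hB⟩ := hcon
  push Not at hA hB
  obtain ⟨N1, hN1, hA⟩ := hA
  obtain ⟨N2, hN2, hB⟩ := hB
  obtain ⟨c, hc, h1⟩ : ∃ c : H, c ≠ 0 ∧ (N1 : Set H) = (fun y => y * c) '' (M : Set H) := by
    rcases hCL M N1 (hsymm _ _ hN1) with ⟨c, hc, h⟩ | h
    · exact absurd h (hA c hc)
    · exact h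
  obtain ⟨d, hd, h2⟩ : ∃ c : H, c ≠ 0 ∧ (N2 : Set H) = (fun y => c * y) '' (M : Set H) := by
    rcases hCL M N2 (hsymm _ _ hN2) with h | ⟨c, hc, h⟩
    · exact h
    · exact absurd h (hB c hc)
  rcases hCL N1 N2 (htrans _ _ _ hN1 (hsymm _ _ hN2)) with ⟨e, he, h⟩ | ⟨e, he, h⟩
  · apply hA (e⁻¹ * d) (mul_ne_zero (inv_ne_zero he) hd)
    have : (N1 : Set H) = (fun y => e⁻¹ * y) '' (N2 : Set H) := by
      rw [h, Set.image_image]; simp [he]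
    rw [this, h2, Set.image_image]; simp [mul_assoc]
  · apply hB (c * e) (mul_ne_zero hc he)
    rw [h, h1, Set.image_image]; simp [mul_assoc]

theorem cl_line {F H : Type*} [Field F] [DivisionRing H] [Algebra F H]
    (hrank : Module.finrank F H = 4)
    (hcenter : ∀ z : H, z ∈ Subring.center H ↔ ∃ a : F, z = algebraMap F H a)
    (M : Submodule F H) (hM : Module.finrank F M = 2) (h1 : (1 : H) ∈ M) :
    (∃ m ∈ M, ∃ k, k * m ≠ m * k) ∧ (∀ x ∈ M, ∀ y ∈ M, x * y ∈ M) ∧ (∀ x ∈ M, x⁻¹ ∈ M) ∧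
    (∃ q, q ∉ M) := by
  have : Module.Finite F H := Module.finite_of_finrank_pos (by omega)
  have hex : ∃ m ∈ M, ∃ k, k * m ≠ m * k := by
    by_contra hcon
    push Not at hcon
    have : M ≤ Submodule.span F {(1 : H)} := by
      intro x hx
      obtain ⟨a, rfl⟩ := (hcenter x).1 (Subring.mem_center_iff.2 (fun g => hcon x hx g))
      rw [Submodule.mem_span_singleton]
      exact ⟨a, by rw [Algebra.smul_def, mul_one]⟩
    have h2 := Submodule.finrank_mono this
    rw [finrank_span_singleton one_ne_zero] at h2
    omega
  refine ⟨hex, ?_⟩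
  obtain ⟨m, hm, hk⟩ := hex
  obtain ⟨hc, -⟩ := cl_C hrank M hM h1 m hm hk
  refine ⟨?_, ?_, ?_⟩
  · intro x hx y hy
    rw [hc] at hx hy ⊢
    rw [mul_assoc, hy, ← mul_assoc, hx, mul_assoc]
  · intro x hx
    rw [hc] at hx ⊢
    exact ((show Commute x m from hx).inv_left₀).eq
  · by_contra hcon
    push Not at hcon
    have : M = ⊤ := by ext; simp [hcon]
    rw [this, finrank_top] at hM; omega

theorem cl_left {F H : Type*} [Field F] [DivisionRing H] [Algebra F H]
    (M N : Submodule F H) (hmul : ∀ x ∈ M, ∀ y ∈ M, x * y ∈ M) (hinv : ∀ x ∈ M, x⁻¹ ∈ M)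
    (h : ∃ c : H, c ≠ 0 ∧ (N : Set H) = (fun y => c * y) '' (M : Set H))
    (p : H) (hp : p ∈ N) (hp0 : p ≠ 0) (x : H) : x ∈ N ↔ p⁻¹ * x ∈ M := by
  obtain ⟨c, hc, h⟩ := h
  have hN : ∀ x, x ∈ N ↔ ∃ y ∈ M, c * y = x := by
    intro x; rw [← SetLike.mem_coe, h]; rfl
  obtain ⟨y, hy, rfl⟩ := (hN p).1 hp
  have hy0 : y ≠ 0 := by rintro rfl; simp at hp0
  rw [hN]
  constructor
  · rintro ⟨z, hz, rfl⟩
    rw [mul_inv_rev, mul_assoc, inv_mul_cancel_left₀ hc]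
    exact hmul _ (hinv _ hy) _ hz
  · intro hx
    refine ⟨_, hmul _ hy _ hx, ?_⟩
    rw [← mul_assoc, mul_inv_cancel_left₀ hp0]

theorem cl_right {F H : Type*} [Field F] [DivisionRing H] [Algebra F H]
    (M N : Submodule F H) (hmul : ∀ x ∈ M, ∀ y ∈ M, x * y ∈ M) (hinv : ∀ x ∈ M, x⁻¹ ∈ M)
    (h : ∃ c : H, c ≠ 0 ∧ (N : Set H) = (fun y => y * c) '' (M : Set H))
    (p : H) (hp : p ∈ N) (hp0 : p ≠ 0) (x : H) : x ∈ N ↔ x * p⁻¹ ∈ M := by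
  obtain ⟨c, hc, h⟩ := h
  have hN : ∀ x, x ∈ N ↔ ∃ y ∈ M, y * c = x := by
    intro x; rw [← SetLike.mem_coe, h]; rfl
  obtain ⟨y, hy, rfl⟩ := (hN p).1 hp
  have hy0 : y ≠ 0 := by rintro rfl; simp at hp0
  rw [hN]
  constructor
  · rintro ⟨z, hz, rfl⟩
    rw [mul_inv_rev, mul_assoc, mul_inv_cancel_left₀ hc]
    exact hmul _ hz _ (hinv _ hy)
  · intro hx
    refine ⟨_, hmul _ hx _ hy, ?_⟩
    rw [mul_assoc, inv_mul_cancel_right₀ hp0]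

theorem cl_fin {F H : Type*} [Field F] [DivisionRing H] [Algebra F H]
    (hrank : Module.finrank F H = 4)
    (hcenter : ∀ z : H, z ∈ Subring.center H ↔ ∃ a : F, z = algebraMap F H a)
    (L : Submodule F H) (hL : Module.finrank F L = 2) (h1 : (1 : H) ∈ L) (m : H) (hm : m ∈ L)
    (hm0 : m ≠ 0)
    (hyp : ∀ h : H, h ≠ 0 → ∀ M : Submodule F H, Module.finrank F M = 2 → 1 ∈ M →
      (∀ x, x ∈ M ↔ h⁻¹ * x * h ∈ L) → ∀ y ∈ M, m * y * m⁻¹ ∈ M) :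
    ∃ a : F, a ≠ 0 ∧ m = algebraMap F H a := by
  by_cases hk : ∃ k, k * m ≠ m * k
  · exfalso
    obtain ⟨hc, hs⟩ := cl_C hrank L hL h1 m hm hk
    obtain ⟨a, b, hab⟩ := (hs (m * m)).1 ((hc _).2 (mul_assoc _ _ _))
    refine cl_core m (algebraMap F H b) (algebraMap F H a) (Algebra.commutes b)
      (Algebra.commutes a) (by rw [← hab]; simp [Algebra.smul_def]) hk ?_
    intro g hg w hw y hy
    have hgi := inv_ne_zero hg
    have hinj : Function.Injective
        (LinearMap.mulRight F g ∘ₗ LinearMap.mulLeft F g⁻¹ : H →ₗ[F] H) := by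
      intro x y hxy
      exact mul_left_cancel₀ hgi (mul_right_cancel₀ hg hxy)
    have e := (Submodule.equivMapOfInjective _ hinj L).finrank_eq.symm
    have hM : ∀ x, x ∈ L.map (LinearMap.mulRight F g ∘ₗ LinearMap.mulLeft F g⁻¹ : H →ₗ[F] H) ↔
        (g⁻¹)⁻¹ * x * g⁻¹ ∈ L := by
      intro x
      rw [Submodule.mem_map, inv_inv]
      constructor
      · rintro ⟨y, hy, rfl⟩
        simpa [mul_assoc, hg] using hy
      · intro h
        exact ⟨_, h, by simp [mul_assoc, hg]⟩
    have := hyp g⁻¹ hgi _ (by rw [e, hL]) (by rw [hM]; simpa [hg] using h1) hM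
      (g⁻¹ * m * g) (by rw [hM]; simpa [mul_assoc, hg] using hm)
    rw [hM, inv_inv, hc] at this
    have hw' : w = g * m * g⁻¹ := by rw [← hw, mul_assoc, mul_inv_cancel₀ hg, mul_one]
    have hw0 : w ≠ 0 := by simp [hw', hg, hm0]
    have hy' : y = g * (m * (g⁻¹ * m * g) * m⁻¹) * g⁻¹ := by
      apply mul_right_cancel₀ hw0
      rw [hy, hw']
      simp [mul_assoc, hg, hm0]
    rw [hy', this]
  · push Not at hk
    obtain ⟨a, ha⟩ := (hcenter m).1 (Subring.mem_center_iff.2 hk)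
    refine ⟨a, ?_, ha⟩
    rintro rfl
    simp [ha] at hm0


/-- Let `H` be a quaternion skew field with centre `F` and let
`P` be a Clifford-like parallelism of `(P(H_F), ∥ₗ, ∥ᵣ)`.  If an automorphism
`β` of `P` (an additive bijection of `H`, semilinear with respect to some
automorphism `σ` of `F`, mapping `P`-parallel lines to `P`-parallel lines)
stabilises all parallel classes of `P` and fixes all lines of at least one
parallel class, then `β` acts identically on the projective space `P(H_F)`:
every `x ≠ 0` satisfies `β x = a • x` for some `a ∈ F∖{0}`. -/
theorem stmt_14 {F H : Type*} [Field F] [DivisionRing H] [Algebra F H]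
    (hrank : Module.finrank F H = 4)
    (hcenter : ∀ z : H, z ∈ Subring.center H ↔ ∃ a : F, z = algebraMap F H a)
    (P : Submodule F H → Submodule F H → Prop)
    (hlines : ∀ M N, P M N → Module.finrank F M = 2 ∧ Module.finrank F N = 2)
    (hrefl : ∀ M : Submodule F H, Module.finrank F M = 2 → P M M)
    (hsymm : ∀ M N, P M N → P N M)
    (htrans : ∀ M N K, P M N → P N K → P M K)
    (hpar : ∀ x : H, x ≠ 0 → ∀ M : Submodule F H, Module.finrank F M = 2 →
      ∃! N : Submodule F H, x ∈ N ∧ P N M)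
    (hCL : ∀ M N, P M N →
      (∃ c : H, c ≠ 0 ∧ (N : Set H) = (fun y => c * y) '' (M : Set H)) ∨
      (∃ c : H, c ≠ 0 ∧ (N : Set H) = (fun y => y * c) '' (M : Set H)))
    (σ : F ≃+* F) (β : H ≃+ H)
    (hsemi : ∀ (a : F) (x : H), β (a • x) = σ a • β x)
    (hauto : ∀ M N : Submodule F H, P M N → ∃ M' N' : Submodule F H,
      (M' : Set H) = ⇑β '' (M : Set H) ∧ (N' : Set H) = ⇑β '' (N : Set H) ∧ P M' N')
    (hstab : ∀ M : Submodule F H, Module.finrank F M = 2 → ∃ M' : Submodule F H,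
      (M' : Set H) = ⇑β '' (M : Set H) ∧ P M' M)
    (hfix : ∃ L : Submodule F H, Module.finrank F L = 2 ∧
      ∀ N : Submodule F H, P N L → ⇑β '' (N : Set H) = (N : Set H)) :
    ∀ x : H, x ≠ 0 → ∃ a : F, a ≠ 0 ∧ β x = a • x := by
  obtain ⟨L₀, hL₀, hfix⟩ := hfix
  obtain ⟨L, ⟨h1L, hLL₀⟩, -⟩ := hpar 1 one_ne_zero L₀ hL₀
  have hL : Module.finrank F L = 2 := (hlines _ _ hLL₀).1
  replace hfix : ∀ N : Submodule F H, P N L → ⇑β '' (N : Set H) = (N : Set H) :=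
    fun N hN => hfix N (htrans _ _ _ hN hLL₀)
  obtain ⟨-, hmul, hinv, q, hq⟩ := cl_line hrank hcenter L hL h1L
  have hβN : ∀ N, P N L → ∀ p ∈ N, β p ∈ N := by
    intro N hN p hp
    have : β p ∈ (N : Set H) := by rw [← hfix N hN]; exact ⟨p, hp, rfl⟩
    exact this
  have hm : β 1 ∈ L := hβN L (hrefl L hL) 1 h1L
  have hm0 : β 1 ≠ 0 := by simp
  have huniq : ∀ M : Submodule F H, Module.finrank F M = 2 → 1 ∈ M → P M L → M = L := by
    intro M hM h1M hML
    exact (hpar 1 one_ne_zero L hL).unique ⟨h1M, hML⟩ ⟨h1L, hrefl L hL⟩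
  rcases cl_D P hsymm htrans hCL L with hl | hr
  · have hb : ∀ p, p ≠ 0 → p⁻¹ * β p ∈ L := by
      intro p hp
      obtain ⟨N, ⟨hpN, hNL⟩, -⟩ := hpar p hp L hL
      exact (cl_left L N hmul hinv (hl N hNL) p hpN hp _).1 (hβN N hNL p hpN)
    have hout : ∀ p, p ∉ L → β p = p * β 1 := by
      intro p hp
      have hp0 : p ≠ 0 := by rintro rfl; exact hp L.zero_mem
      have hp1 : 1 + p ≠ 0 := by
        intro h
        apply hp
        rw [show p = -1 by rw [eq_neg_iff_add_eq_zero, add_comm]; exact h]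
        exact L.neg_mem h1L
      have e1 : p * (p⁻¹ * β p) = β p := mul_inv_cancel_left₀ hp0 _
      have e2 : (1 + p) * ((1 + p)⁻¹ * β (1 + p)) = β (1 + p) := mul_inv_cancel_left₀ hp1 _
      have m1 := hb p hp0
      have m2 := hb _ hp1
      generalize p⁻¹ * β p = l at *
      generalize (1 + p)⁻¹ * β (1 + p) = l' at *
      rw [map_add, ← e1] at e2
      have e3 : l' - β 1 = p * (l - l') := by
        rw [mul_sub, sub_eq_sub_iff_add_eq_add, add_comm (p * l), ← e2]; noncomm_ring
      by_cases hll : l - l' = 0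
      · rw [hll, mul_zero] at e3
        rw [← e1, sub_eq_zero.1 hll, sub_eq_zero.1 e3]
      · exfalso
        apply hp
        rw [← mul_inv_cancel_right₀ hll p, ← e3]
        exact hmul _ (L.sub_mem m2 hm) _ (hinv _ (L.sub_mem m1 m2))
    have hall : ∀ p, β p = p * β 1 := by
      intro p
      by_cases hp : p ∈ L
      · have := hout (q + p) (fun h => hq ((L.add_mem_iff_left hp).1 h))
        rw [map_add, hout q hq, add_mul] at this
        exact add_left_cancel this
      · exact hout p hp
    obtain ⟨a, ha, ham⟩ := cl_fin hrank hcenter L hL h1L (β 1) hm hm0 (by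
      intro h hh M hM h1M hMx y hy
      obtain ⟨-, hmulM, hinvM, -⟩ := cl_line hrank hcenter M hM h1M
      have hlM : ∀ N, P N M → ∃ c : H, c ≠ 0 ∧ (N : Set H) = (fun y => c * y) '' (M : Set H) := by
        rcases cl_D P hsymm htrans hCL M with hlM | hrM
        · exact hlM
        · obtain ⟨N, ⟨hN, hNM⟩, -⟩ := hpar h hh M hM
          obtain ⟨N', ⟨hN', hNL⟩, -⟩ := hpar h hh L hL
          have : N = N' := by
            ext x
            rw [cl_right M N hmulM hinvM (hrM N hNM) h hN hh,
              cl_left L N' hmul hinv (hl N' hNL) h hN' hh, hMx]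
            simp [mul_assoc, hh]
          subst this
          rw [huniq M hM h1M (htrans _ _ _ (hsymm _ _ hNM) hNL)]
          exact hl
      obtain ⟨M', hM', hP⟩ := hstab M hM
      have h1M' : β 1 ∈ M' := by
        rw [← SetLike.mem_coe, hM']; exact ⟨1, h1M, rfl⟩
      have : β 1 * y ∈ M' := by
        rw [cl_left M M' hmulM hinvM (hlM M' hP) _ h1M' hm0, inv_mul_cancel_left₀ hm0]
        exact hy
      rw [← SetLike.mem_coe, hM'] at this
      obtain ⟨z, hz, hze⟩ := this
      rw [hall z] at hze
      rw [← hze, mul_inv_cancel_right₀ hm0]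
      exact hz)
    intro x hx
    exact ⟨a, ha, by rw [hall, ham, Algebra.smul_def, Algebra.commutes]⟩
  · have hb : ∀ p, p ≠ 0 → β p * p⁻¹ ∈ L := by
      intro p hp
      obtain ⟨N, ⟨hpN, hNL⟩, -⟩ := hpar p hp L hL
      exact (cl_right L N hmul hinv (hr N hNL) p hpN hp _).1 (hβN N hNL p hpN)
    have hout : ∀ p, p ∉ L → β p = β 1 * p := by
      intro p hp
      have hp0 : p ≠ 0 := by rintro rfl; exact hp L.zero_mem
      have hp1 : 1 + p ≠ 0 := by
        intro h
        apply hp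
        rw [show p = -1 by rw [eq_neg_iff_add_eq_zero, add_comm]; exact h]
        exact L.neg_mem h1L
      have e1 : (β p * p⁻¹) * p = β p := inv_mul_cancel_right₀ hp0 _
      have e2 : (β (1 + p) * (1 + p)⁻¹) * (1 + p) = β (1 + p) := inv_mul_cancel_right₀ hp1 _
      have m1 := hb p hp0
      have m2 := hb _ hp1
      generalize β p * p⁻¹ = l at *
      generalize β (1 + p) * (1 + p)⁻¹ = l' at *
      rw [map_add, ← e1] at e2
      have e3 : l' - β 1 = (l - l') * p := by
        rw [sub_mul, sub_eq_sub_iff_add_eq_add, add_comm (l * p), ← e2]; noncomm_ring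
      by_cases hll : l - l' = 0
      · rw [hll, zero_mul] at e3
        rw [← e1, sub_eq_zero.1 hll, sub_eq_zero.1 e3]
      · exfalso
        apply hp
        rw [← inv_mul_cancel_left₀ hll p, ← e3]
        exact hmul _ (hinv _ (L.sub_mem m1 m2)) _ (L.sub_mem m2 hm)
    have hall : ∀ p, β p = β 1 * p := by
      intro p
      by_cases hp : p ∈ L
      · have := hout (q + p) (fun h => hq ((L.add_mem_iff_left hp).1 h))
        rw [map_add, hout q hq, mul_add] at this
        exact add_left_cancel this
      · exact hout p hp
    obtain ⟨a, ha, ham⟩ := cl_fin hrank hcenter L hL h1L (β 1) hm hm0 (by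
      intro h hh M hM h1M hMx y hy
      obtain ⟨-, hmulM, hinvM, -⟩ := cl_line hrank hcenter M hM h1M
      have hrM : ∀ N, P N M → ∃ c : H, c ≠ 0 ∧ (N : Set H) = (fun y => y * c) '' (M : Set H) := by
        rcases cl_D P hsymm htrans hCL M with hlM | hrM
        · have hhi := inv_ne_zero hh
          obtain ⟨N, ⟨hN, hNM⟩, -⟩ := hpar h⁻¹ hhi M hM
          obtain ⟨N', ⟨hN', hNL⟩, -⟩ := hpar h⁻¹ hhi L hL
          have : N = N' := by
            ext x
            rw [cl_left M N hmulM hinvM (hlM N hNM) _ hN hhi,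
              cl_right L N' hmul hinv (hr N' hNL) _ hN' hhi, hMx]
            simp [hh]
          subst this
          rw [huniq M hM h1M (htrans _ _ _ (hsymm _ _ hNM) hNL)]
          exact hr
        · exact hrM
      obtain ⟨M', hM', hP⟩ := hstab M hM
      have h1M' : β 1 ∈ M' := by
        rw [← SetLike.mem_coe, hM']; exact ⟨1, h1M, rfl⟩
      have : β 1 * y ∈ M' := by
        rw [← SetLike.mem_coe, hM']; exact ⟨y, hy, hall y⟩
      exact (cl_right M M' hmulM hinvM (hrM M' hP) _ h1M' hm0 _).1 this)
    intro x hx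
    exact ⟨a, ha, by rw [hall, ham, Algebra.smul_def]⟩
end
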